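/- Let (M,F) be a compact, simply-connected (n+2)-manifold with a non-regular A-foliation of codimension 2, with regular leaves of dimension n. If the boundary of the leaf-space disk M* consists of r edges, then r ≥ n. -/

import Mathlib

open scoped Manifold unitInterval
open Topology

noncomputable section

/-- A singular foliation on a topological space `M`: a partition of `M` into connected
leaves, together with the dimension of the leaf through each point.  This records the
topological content of a singular Riemannian foliation (the metric conditions are part of
the ambient geometric setting). -/
structure SFoliation (M : Type*) [TopologicalSpace M] where
  rel : M → M → Prop
  iseqv : Equivalence rel
  leafDim : M → ℕ
  leafDim_congr : ∀ {p q : M}, rel p q → leafDim p = leafDim q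
  leaf_connected : ∀ p : M, IsConnected {q : M | rel p q}

namespace SFoliation

variable {M : Type*} [TopologicalSpace M] (F : SFoliation M)

/-- The leaf through `p`. -/
def leaf (p : M) : Set M := {q : M | F.rel p q}

lemma mem_leaf_self (p : M) : p ∈ F.leaf p := F.iseqv.refl p

/-- The setoid given by the partition into leaves. -/
def toSetoid : Setoid M := ⟨F.rel, F.iseqv⟩

/-- The leaf space `M/F`, with the quotient topology. -/
def LeafSpace : Type _ := Quotient F.toSetoid

instance : TopologicalSpace F.LeafSpace := instTopologicalSpaceQuotient

/-- The leaf projection map. -/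
def proj (p : M) : F.LeafSpace := Quotient.mk F.toSetoid p

lemma continuous_proj : Continuous F.proj := continuous_quotient_mk'

/-- The dimension of the foliation: the maximal dimension of its leaves. -/
def dim : ℕ := ⨆ p : M, F.leafDim p

/-- A point lies on a regular leaf if its leaf has maximal dimension. -/
def IsRegular (p : M) : Prop := ∀ q : M, F.leafDim q ≤ F.leafDim p

/-- A set is saturated if it is a union of leaves. -/
def Saturated (U : Set M) : Prop := ∀ p ∈ U, F.leaf p ⊆ U

/-- A point lies on a principal leaf if its leaf is regular and has trivial holonomy,
encoded here by the existence of a saturated open product (foliated) trivialization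
around the leaf. -/
def IsPrincipal (p : M) : Prop :=
  F.IsRegular p ∧
    ∃ U : Set M, IsOpen U ∧ p ∈ U ∧ F.Saturated U ∧
      ∃ e : ↥U ≃ₜ ↥(F.leaf p) × ↥(F.proj '' U),
        ∀ x : U, ((e x).2 : F.LeafSpace) = F.proj (x : M)

/-- The principal stratum: the union of the principal leaves. -/
def Mprin : Set M := {p : M | F.IsPrincipal p}

/-- A continuous cross-section of the leaf projection. -/
def IsCrossSection (sec : C(F.LeafSpace, M)) : Prop := ∀ x : F.LeafSpace, F.proj (sec x) = x

end SFoliation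

/-- A topological space is aspherical if all its homotopy groups in degrees `≥ 2` vanish. -/
def Aspherical (X : Type*) [TopologicalSpace X] : Prop :=
  ∀ n : ℕ, 2 ≤ n → ∀ x : X, Subsingleton (HomotopyGroup (Fin n) X x)

/-- An A-foliation: a singular (Riemannian) foliation all of whose leaves are closed
and aspherical. -/
structure SFoliation.IsAFoliation {M : Type*} [TopologicalSpace M] (F : SFoliation M) : Prop where
  isClosed_leaf : ∀ p : M, IsClosed (F.leaf p)
  aspherical_leaf : ∀ p : M, Aspherical (F.leaf p)

/-- The standard `n`-torus `S¹ × ⋯ × S¹`. -/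
abbrev Torus (n : ℕ) : Type := Fin n → Circle

/-- A foliated homeomorphism: a homeomorphism sending leaves onto leaves. -/
structure FoliatedHomeo {M₁ M₂ : Type*} [TopologicalSpace M₁] [TopologicalSpace M₂]
    (F₁ : SFoliation M₁) (F₂ : SFoliation M₂) extends M₁ ≃ₜ M₂ where
  leaf_rel : ∀ p q : M₁, F₁.rel p q ↔ F₂.rel (toHomeomorph p) (toHomeomorph q)

section ExpData

variable {M : Type*} [TopologicalSpace M]

/-- Abstract normal exponential data along the leaf `L_p` of a singular foliation:
for each point `x` of the leaf, a map `exp x` from the normal space at `x`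
(identified with `ℝᵏ`) into `M`. -/
structure LeafExpData (F : SFoliation M) (p : M) (k : ℕ) where
  exp : F.leaf p → EuclideanSpace ℝ (Fin k) → M
  exp_zero : ∀ x : F.leaf p, exp x 0 = (x : M)
  continuous_exp : ∀ x : F.leaf p, Continuous (exp x)

/-- The leaf of the infinitesimal foliation `F^p` (at the point `x` of the leaf `L_p`)
through the normal vector `v`: the connected component containing `v` of the preimage,
under the normal exponential map, of the leaf of `F` through `exp x v`. -/
def LeafExpData.infLeaf {F : SFoliation M} {p : M} {k : ℕ} (E : LeafExpData F p k)
    (x : F.leaf p) (v : EuclideanSpace ℝ (Fin k)) : Set (EuclideanSpace ℝ (Fin k)) :=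
  connectedComponentIn ((E.exp x) ⁻¹' (F.leaf (E.exp x v))) v

/-- Sliding data along a curve `γ` in the leaf `L_p` (Mendes–Radeschi): a continuous
family of linear isometries of the normal spaces, starting at the identity, preserving
the infinitesimal foliations, and such that `exp_{γ t} (s • G t v)` stays in the leaf
of `exp_{γ 0} (s • v)`. -/
structure Sliding {F : SFoliation M} {p : M} {k : ℕ} (E : LeafExpData F p k)
    {x y : F.leaf p} (γ : Path x y) where
  G : unitInterval → (EuclideanSpace ℝ (Fin k) ≃ₗᵢ[ℝ] EuclideanSpace ℝ (Fin k))
  G_zero : G 0 = LinearIsometryEquiv.refl ℝ (EuclideanSpace ℝ (Fin k))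
  continuous_G : Continuous fun tv : unitInterval × EuclideanSpace ℝ (Fin k) => G tv.1 tv.2
  foliated : ∀ (t : unitInterval) (v : EuclideanSpace ℝ (Fin k)),
    (G t) '' (E.infLeaf x v) = E.infLeaf (γ t) (G t v)
  slides : ∀ (t : unitInterval) (s : ℝ) (v : EuclideanSpace ℝ (Fin k)),
    F.rel (E.exp (γ t) (s • (G t v))) (E.exp x (s • v))

end ExpData

namespace AS

/-! ### Alexander–Spanier cochains modulo two -/

section Algebra

variable {X Y : Type*}

/-- Cochains modulo two: arbitrary functions on finite lists of points. -/
abbrev Coch (X : Type*) : Type _ := List X → ZMod 2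

lemma add_self_coch (φ : Coch X) : φ + φ = 0 := CharTwo.add_self_eq_zero φ

/-- The value of the coboundary on a list. -/
def dFun : Coch X → List X → ZMod 2
  | _, [] => 0
  | φ, a :: l => φ l + dFun (fun m => φ (a :: m)) l

lemma dFun_add (l : List X) : ∀ φ ψ : Coch X, dFun (φ + ψ) l = dFun φ l + dFun ψ l := by
  induction l with
  | nil => intro φ ψ; simp [dFun]
  | cons a l ih =>
    intro φ ψ
    have := ih (fun m => φ (a :: m)) (fun m => ψ (a :: m))
    simp only [dFun]
    rw [show (fun m => (φ + ψ) (a :: m)) = (fun m => φ (a :: m)) + fun m => ψ (a :: m) from rfl,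
      this]
    simp only [Pi.add_apply]
    ring

/-- The coboundary. -/
def d : Coch X →ₗ[ZMod 2] Coch X :=
  AddMonoidHom.toZModLinearMap 2
    { toFun := dFun
      map_zero' := by
        funext l
        have := dFun_add l (0 : Coch X) 0
        simpa using this
      map_add' := fun φ ψ => funext fun l => dFun_add l φ ψ }

@[simp] lemma d_nil (φ : Coch X) : d φ [] = 0 := rfl

lemma d_cons (φ : Coch X) (a : X) (l : List X) :
    d φ (a :: l) = φ l + d (fun m => φ (a :: m)) l := rfl

lemma d_cons_fun (φ : Coch X) (a : X) :
    (fun l => d φ (a :: l)) = φ + d (fun m => φ (a :: m)) := rfl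

@[simp] lemma d_d (φ : Coch X) : d (d φ) = 0 := by
  funext l
  induction l generalizing φ with
  | nil => rfl
  | cons a l ih =>
    rw [d_cons, d_cons_fun, map_add, Pi.add_apply, ih, ← add_assoc, CharTwo.add_self_eq_zero]
    simp

/-- Cochains concentrated on nonempty lists of length `k`. -/
def Cc (X : Type*) (k : ℕ) : Submodule (ZMod 2) (Coch X) where
  carrier := {φ | ∀ l : List X, l.length ≠ k ∨ l = [] → φ l = 0}
  add_mem' := fun {a b} ha hb l hl => by simp [ha l hl, hb l hl]
  zero_mem' := fun _ _ => rfl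
  smul_mem' := fun c φ h l hl => by simp [h l hl]

lemma Cc_zero {φ : Coch X} (h : φ ∈ Cc X 0) : φ = 0 := by
  funext l
  apply h
  rcases l with _ | ⟨a, l⟩
  · exact Or.inr rfl
  · left; simp

lemma Cc_cons {φ : Coch X} {k : ℕ} (h : φ ∈ Cc X (k + 2)) (a : X) :
    (fun l => φ (a :: l)) ∈ Cc X (k + 1) := by
  intro l hl
  apply h
  left
  rcases hl with hl | hl
  · simpa using hl
  · simp [hl]

lemma d_length {k : ℕ} (l : List X) : ∀ {φ : Coch X}, (∀ m : List X, m.length ≠ k → φ m = 0) →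
    l.length ≠ k + 1 → d φ l = 0 := by
  induction l generalizing k with
  | nil => intro φ _ _; rfl
  | cons a l ih =>
    intro φ h hl
    rw [d_cons, h l (by simpa using hl), zero_add]
    rcases k with _ | k
    · rw [show (fun m => φ (a :: m)) = 0 from funext fun m => h _ (by simp)]
      simp
    · exact ih (k := k) (fun m hm => h _ (by simpa using hm)) (by simpa using hl)

lemma d_mem_Cc {φ : Coch X} {k : ℕ} (h : φ ∈ Cc X k) : d φ ∈ Cc X (k + 1) := by
  rintro l (hl | rfl)
  · exact d_length l (fun m hm => h m (Or.inl hm)) hl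
  · rfl

/-- Pullback of cochains. -/
def pb (g : X → Y) : Coch Y →ₗ[ZMod 2] Coch X where
  toFun φ := fun l => φ (l.map g)
  map_add' _ _ := rfl
  map_smul' _ _ := rfl

lemma pb_apply (g : X → Y) (φ : Coch Y) (l : List X) : pb g φ l = φ (l.map g) := rfl

lemma pb_id (φ : Coch X) : pb id φ = φ := by
  funext l
  simp [pb_apply]

lemma d_pb (g : X → Y) (φ : Coch Y) : d (pb g φ) = pb g (d φ) := by
  funext l
  induction l generalizing φ with
  | nil => rfl
  | cons a l ih =>
    rw [d_cons, pb_apply g (d φ), List.map_cons, d_cons]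
    exact congrArg _ (ih (fun m => φ (g a :: m)))

lemma pb_mem_Cc (g : X → Y) {φ : Coch Y} {k : ℕ} (h : φ ∈ Cc Y k) : pb g φ ∈ Cc X k := by
  rintro l (hl | rfl)
  · exact h _ (Or.inl (by simpa using hl))
  · exact h _ (Or.inr rfl)

/-- The prism operator, a chain homotopy between two pullbacks. -/
def prism (g h : X → Y) : Coch Y → List X → ZMod 2
  | _, [] => 0
  | φ, a :: l => φ (g a :: h a :: l.map h) + prism g h (fun m => φ (g a :: m)) l

lemma prism_add (g h : X → Y) (l : List X) : ∀ φ ψ : Coch Y,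
    prism g h (φ + ψ) l = prism g h φ l + prism g h ψ l := by
  induction l with
  | nil => intro φ ψ; simp [prism]
  | cons a l ih =>
    intro φ ψ
    have := ih (fun m => φ (g a :: m)) (fun m => ψ (g a :: m))
    simp only [prism]
    rw [show (fun m => (φ + ψ) (g a :: m)) = (fun m => φ (g a :: m)) + fun m => ψ (g a :: m)
      from rfl, this]
    simp only [Pi.add_apply]
    ring

lemma prism_homotopy (g h : X → Y) (φ : Coch Y) :
    d (prism g h φ) + prism g h (d φ) = pb g φ + pb h φ := by
  funext l
  induction l generalizing φ with
  | nil => simp [prism, pb_apply, CharTwo.add_self_eq_zero]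
  | cons a l ih =>
    have e1 : (fun m => prism g h φ (a :: m)) =
        pb h (fun m => φ (g a :: h a :: m)) + prism g h (fun m => φ (g a :: m)) := rfl
    have e2 : prism g h (d φ) (a :: l) = d φ (g a :: h a :: l.map h) +
      prism g h (φ + d (fun m => φ (g a :: m))) l := rfl
    have e3 := ih (fun m => φ (g a :: m))
    simp only [Pi.add_apply] at e3
    rw [Pi.add_apply, d_cons, e1, e2, map_add, d_pb, prism_add, d_cons, d_cons]
    simp only [Pi.add_apply, pb_apply, List.map_cons] at e3 ⊢
    generalize d (fun m => φ (g a :: h a :: m)) (l.map h) = u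
    generalize prism g h φ l = v at *
    rw [show v + (u + d (prism g h fun m => φ (g a :: m)) l) +
      (φ (h a :: l.map h) + (φ (g a :: l.map h) + u) + (v + prism g h (d fun m => φ (g a :: m)) l))
      = (v + v) + (u + u) + φ (h a :: l.map h) + φ (g a :: l.map h) +
      (d (prism g h fun m => φ (g a :: m)) l + prism g h (d fun m => φ (g a :: m)) l) by ring, e3,
      CharTwo.add_self_eq_zero, CharTwo.add_self_eq_zero]
    generalize φ (g a :: l.map h) = w
    rw [show 0 + 0 + φ (h a :: l.map h) + w + (φ (g a :: l.map g) + w)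
      = (w + w) + (φ (g a :: l.map g) + φ (h a :: l.map h)) by ring, CharTwo.add_self_eq_zero,
      zero_add]

lemma prism_length (g h : X → Y) {k : ℕ} (l : List X) : ∀ {φ : Coch Y},
    (∀ m : List Y, m.length ≠ k + 1 → φ m = 0) → l.length ≠ k → prism g h φ l = 0 := by
  induction l generalizing k with
  | nil => intro φ _ _; rfl
  | cons a l ih =>
    intro φ hφ hl
    simp only [prism]
    rw [hφ _ (by simpa using hl), zero_add]
    rcases k with _ | k
    · rcases l with _ | ⟨b, l⟩
      · rfl
      · simp only [prism]
        rw [hφ _ (by simp), zero_add]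
        have : ∀ (l : List X) (φ : Coch Y), (∀ m : List Y, φ m = 0) → prism g h φ l = 0 := by
          intro l
          induction l with
          | nil => intro φ _; rfl
          | cons a l ih => intro φ hφ; simp only [prism]; rw [hφ, zero_add]; exact ih _ fun m => hφ _
        exact this _ _ fun m => hφ _ (by simp)
    · exact ih (k := k) (fun m hm => hφ _ (by simpa using hm)) (by simpa using hl)

lemma prism_mem_Cc (g h : X → Y) {φ : Coch Y} {k : ℕ} (hφ : φ ∈ Cc Y (k + 1)) :
    prism g h φ ∈ Cc X k := by
  rintro l (hl | rfl)
  · exact prism_length g h l (fun m hm => hφ m (Or.inl hm)) hl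
  · rfl

/-- Cup product of a one-cochain (given as a function of two variables) with a cochain. -/
def cup (c : X → X → ZMod 2) (φ : Coch X) : Coch X
  | a :: b :: l => c a b * φ (b :: l)
  | _ => 0

/-- Product of a function with a cochain. -/
def fmul (w : X → ZMod 2) (φ : Coch X) : Coch X
  | a :: l => w a * φ (a :: l)
  | [] => 0

/-- The coboundary of a function of two variables. -/
def dTwo (c : X → X → ZMod 2) (x y z : X) : ZMod 2 := c y z + c x z + c x y

lemma cup_add (c : X → X → ZMod 2) (φ ψ : Coch X) : cup c (φ + ψ) = cup c φ + cup c ψ := by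
  funext l
  match l with
  | [] => simp [cup]
  | [a] => simp [cup]
  | a :: b :: l => simp [cup, mul_add]

lemma add_cup (c c' : X → X → ZMod 2) (φ : Coch X) : cup (c + c') φ = cup c φ + cup c' φ := by
  funext l
  match l with
  | [] => simp [cup]
  | [a] => simp [cup]
  | a :: b :: l => simp [cup, add_mul]

lemma fmul_add (w : X → ZMod 2) (φ ψ : Coch X) : fmul w (φ + ψ) = fmul w φ + fmul w ψ := by
  funext l
  match l with
  | [] => simp [fmul]
  | a :: l => simp [fmul, mul_add]

lemma add_fmul (w w' : X → ZMod 2) (φ : Coch X) : fmul (w + w') φ = fmul w φ + fmul w' φ := by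
  funext l
  match l with
  | [] => simp [fmul]
  | a :: l => simp [fmul, add_mul]

lemma cup_mem_Cc (c : X → X → ZMod 2) {φ : Coch X} {k : ℕ} (h : φ ∈ Cc X k) :
    cup c φ ∈ Cc X (k + 1) := by
  intro l hl
  match l with
  | [] => rfl
  | [a] => rfl
  | a :: b :: l =>
    have : φ (b :: l) = 0 := h _ (Or.inl (by simpa using hl))
    simp [cup, this]

lemma fmul_mem_Cc (w : X → ZMod 2) {φ : Coch X} {k : ℕ} (h : φ ∈ Cc X k) :
    fmul w φ ∈ Cc X k := by
  intro l hl
  match l with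
  | [] => rfl
  | a :: l =>
    have : φ (a :: l) = 0 := h _ hl
    simp [fmul, this]

lemma d_cons_cons (φ : Coch X) (a b : X) (l : List X) :
    d φ (a :: b :: l) = φ (b :: l) + φ (a :: l) + d (fun m => φ (a :: b :: m)) l := by
  rw [d_cons, d_cons, add_assoc]

lemma d_smul_fun (x : ZMod 2) (φ : Coch X) (l : List X) :
    d (fun m => x * φ m) l = x * d φ l := by
  have := congrFun (map_smul (d (X := X)) x φ) l
  simpa [Pi.smul_def] using this

lemma d_fmul (w : X → ZMod 2) (φ : Coch X) (h0 : φ [] = 0) :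
    d (fmul w φ) = cup (fun x y => w x + w y) φ + fmul w (d φ) := by
  funext l
  match l with
  | [] => simp [cup, fmul]
  | [a] => simp [cup, fmul, d_cons, h0]
  | a :: b :: l =>
    rw [d_cons_cons]
    simp only [fmul, Pi.add_apply, cup, d_cons_cons φ, d_smul_fun]
    generalize d (fun m => φ (a :: b :: m)) l = u
    generalize φ (b :: l) = v
    generalize φ (a :: l) = t
    generalize w a = p
    generalize w b = q
    revert u v t p q
    decide

/-- The defect of the Leibniz rule for `cup`. -/
def cupTwo (e : X → X → X → ZMod 2) (φ : Coch X) : Coch X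
  | a :: b :: z :: l => e a b z * φ (z :: l)
  | _ => 0

lemma d_cup (c : X → X → ZMod 2) (φ : Coch X) (h0 : φ [] = 0) :
    d (cup c φ) = cupTwo (dTwo c) φ + cup c (d φ) := by
  funext l
  match l with
  | [] => simp [cup, cupTwo]
  | [a] => simp [cup, cupTwo, d_cons]
  | [a, b] => simp [cup, cupTwo, d_cons, h0]
  | a :: b :: z :: l =>
    rw [d_cons_cons, d_cons]
    simp only [cup, Pi.add_apply, cupTwo, d_cons_cons φ, d_smul_fun, dTwo]
    generalize d (fun m => φ (b :: z :: m)) l = u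
    generalize φ (z :: l) = v
    generalize φ (b :: l) = t
    generalize c b z = p
    generalize c a z = q
    generalize c a b = s
    revert u v t p q s
    decide

end Algebra

section Germs

variable {X Y : Type*}

lemma mem_of_eq {V : Type*} [AddCommGroup V] [Module (ZMod 2) V] {S : Submodule (ZMod 2) V}
    {a b : V} (h : a ∈ S) (e : a = b) : b ∈ S := e ▸ h

/-- A cochain vanishes on all lists contained in `U`. -/
def Van {X : Type*} (φ : Coch X) (U : Set X) : Prop := ∀ l : List X, (∀ x ∈ l, x ∈ U) → φ l = 0

lemma Van.d {φ : Coch X} {U : Set X} (h : Van φ U) : Van (d φ) U := by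
  intro l
  induction l generalizing φ with
  | nil => intro _; rfl
  | cons a l ih =>
    intro hl
    rw [d_cons, h l fun x hx => hl x (List.mem_cons_of_mem _ hx), zero_add]
    have ha := hl a List.mem_cons_self
    refine ih (φ := fun m => φ (a :: m)) (fun m hm => h _ ?_)
      fun x hx => hl x (List.mem_cons_of_mem _ hx)
    simpa [ha] using hm

lemma Van.prism {φ : Coch Y} {U : Set Y} {V : Set X} {g h : X → Y} (hφ : Van φ U)
    (hg : Set.MapsTo g V U) (hh : Set.MapsTo h V U) : Van (prism g h φ) V := by
  intro l
  induction l generalizing φ with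
  | nil => intro _; rfl
  | cons a l ih =>
    intro hl
    have hl' : ∀ x ∈ l, x ∈ V := fun x hx => hl x (List.mem_cons_of_mem _ hx)
    have ha := hl a List.mem_cons_self
    simp only [AS.prism]
    rw [hφ _ ?_, zero_add]
    · refine ih (φ := fun m => φ (g a :: m)) (fun m hm => hφ _ ?_) hl'
      simp only [List.mem_cons, forall_eq_or_imp]
      exact ⟨hg ha, hm⟩
    · simp only [List.mem_cons, forall_eq_or_imp, List.mem_map, forall_exists_index, and_imp,
        forall_apply_eq_imp_iff₂]
      exact ⟨hg ha, hh ha, fun x hx => hh (hl' x hx)⟩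

open Classical in
/-- Restriction of a cochain to the lists contained in `U`. -/
def cutoff (U : Set X) (φ : Coch X) : Coch X := fun l => if ∀ x ∈ l, x ∈ U then φ l else 0

lemma cutoff_mem_Cc (U : Set X) {φ : Coch X} {k : ℕ} (h : φ ∈ Cc X k) : cutoff U φ ∈ Cc X k := by
  intro l hl
  simp [cutoff, h l hl]

lemma cutoff_add_van (U : Set X) (φ : Coch X) : Van (cutoff U φ + φ) U := by
  intro l hl
  simp only [cutoff, Pi.add_apply, if_pos hl]
  exact CharTwo.add_self_eq_zero _

variable [TopologicalSpace X] [TopologicalSpace Y]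

/-- Cochains whose germ vanishes at every point of `S`. -/
def Z (S : Set X) : Submodule (ZMod 2) (Coch X) where
  carrier := {φ | ∀ p ∈ S, ∃ U ∈ 𝓝 p, Van φ U}
  add_mem' := by
    intro a b ha hb p hp
    obtain ⟨U, hU, h⟩ := ha p hp
    obtain ⟨V, hV, h'⟩ := hb p hp
    refine ⟨U ∩ V, Filter.inter_mem hU hV, fun l hl => ?_⟩
    simp [h l fun x hx => (hl x hx).1, h' l fun x hx => (hl x hx).2]
  zero_mem' := fun p _ => ⟨Set.univ, Filter.univ_mem, fun _ _ => rfl⟩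
  smul_mem' := by
    intro c a ha p hp
    obtain ⟨U, hU, h⟩ := ha p hp
    exact ⟨U, hU, fun l hl => by simp [h l hl]⟩

lemma mem_Z {S : Set X} {φ : Coch X} : φ ∈ Z S ↔ ∀ p ∈ S, ∃ U ∈ 𝓝 p, Van φ U := Iff.rfl

lemma Z_anti {S T : Set X} (h : S ⊆ T) {φ : Coch X} (hφ : φ ∈ Z T) : φ ∈ Z S :=
  fun p hp => hφ p (h hp)

lemma mem_Z_union {S T : Set X} {φ : Coch X} (h : φ ∈ Z S) (h' : φ ∈ Z T) : φ ∈ Z (S ∪ T) :=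
  fun p hp => hp.elim (h p) (h' p)

lemma mem_Z_of_union {S T U : Set X} {φ : Coch X} (h : φ ∈ Z S) (h' : φ ∈ Z T)
    (hU : U ⊆ S ∪ T) : φ ∈ Z U := Z_anti hU (mem_Z_union h h')

lemma d_mem_Z {S : Set X} {φ : Coch X} (h : φ ∈ Z S) : d φ ∈ Z S := fun p hp =>
  let ⟨U, hU, hh⟩ := h p hp
  ⟨U, hU, hh.d⟩

lemma exists_open_mem_Z {S : Set X} {φ : Coch X} (h : φ ∈ Z S) :
    ∃ O : Set X, IsOpen O ∧ S ⊆ O ∧ φ ∈ Z O := by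
  refine ⟨{p | ∃ U ∈ 𝓝 p, Van φ U}, ?_, h, fun p hp => hp⟩
  rw [isOpen_iff_mem_nhds]
  rintro p ⟨U, hU, hv⟩
  filter_upwards [eventually_mem_nhds_iff.2 hU] with q hq using ⟨U, hq, hv⟩

lemma fmul_mem_Z (w : X → ZMod 2) {S : Set X} {φ : Coch X} (h : φ ∈ Z S) : fmul w φ ∈ Z S := by
  intro p hp
  obtain ⟨U, hU, hv⟩ := h p hp
  refine ⟨U, hU, fun l hl => ?_⟩
  match l with
  | [] => rfl
  | a :: l => simp [fmul, hv (a :: l) hl]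

lemma cup_mem_Z (c : X → X → ZMod 2) {S : Set X} {φ : Coch X} (h : φ ∈ Z S) :
    cup c φ ∈ Z S := by
  intro p hp
  obtain ⟨U, hU, hv⟩ := h p hp
  refine ⟨U, hU, fun l hl => ?_⟩
  match l with
  | [] => rfl
  | [a] => rfl
  | a :: b :: l => simp [cup, hv (b :: l) fun x hx => hl x (List.mem_cons_of_mem _ hx)]

lemma pb_mem_Z {g : X → Y} {S : Set X} {T : Set Y} (hg : ∀ p ∈ S, ContinuousAt g p)
    (hST : Set.MapsTo g S T) {φ : Coch Y} (hφ : φ ∈ Z T) : pb g φ ∈ Z S := by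
  intro p hp
  obtain ⟨U, hU, hv⟩ := hφ _ (hST hp)
  refine ⟨g ⁻¹' U, hg p hp hU, fun l hl => hv _ ?_⟩
  simpa using hl

lemma prism_mem_Z {g h : X → Y} {S : Set X} {T : Set Y} (hg : ∀ p ∈ S, ContinuousAt g p)
    (hh : ∀ p ∈ S, ContinuousAt h p) (hgh : ∀ p ∈ S, g p = h p)
    (hST : Set.MapsTo g S T) {φ : Coch Y} (hφ : φ ∈ Z T) : prism g h φ ∈ Z S := by
  intro p hp
  obtain ⟨U, hU, hv⟩ := hφ _ (hST hp)
  refine ⟨g ⁻¹' U ∩ h ⁻¹' U, Filter.inter_mem (hg p hp hU) (hh p hp (hgh p hp ▸ hU)),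
    hv.prism (fun x hx => hx.1) fun x hx => hx.2⟩

/-- Splitting of cochains vanishing near the intersection of two closed sets. -/
lemma split [NormalSpace X] {A₁ A₂ : Set X} (h₁ : IsClosed A₁) (h₂ : IsClosed A₂) {k : ℕ}
    {φ : Coch X} (hk : φ ∈ Cc X k) (h : φ ∈ Z (A₁ ∩ A₂)) :
    ∃ φ₁ ∈ Cc X k, ∃ φ₂ ∈ Cc X k, φ₁ + φ₂ = φ ∧ φ₁ ∈ Z A₁ ∧ φ₂ ∈ Z A₂ ∧
      ∀ B : Set X, φ ∈ Z B → φ₁ ∈ Z B ∧ φ₂ ∈ Z B := by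
  classical
  obtain ⟨O, hO, hAO, hφO⟩ := exists_open_mem_Z h
  have hd : Disjoint (A₁ \ O) (A₂ \ O) := by
    rw [Set.disjoint_left]
    exact fun x hx hx' => hx.2 (hAO ⟨hx.1, hx'.1⟩)
  obtain ⟨P, Q, hP, hQ, hAP, hAQ, hPQ⟩ :=
    normal_separation (h₁.sdiff hO) (h₂.sdiff hO) hd
  set w : X → ZMod 2 := fun x => if x ∈ P then 0 else 1
  have e : ∀ B, φ ∈ Z B → fmul w φ ∈ Z B := fun B hB => fmul_mem_Z w hB
  have e' : ∀ B, φ ∈ Z B → φ + fmul w φ ∈ Z B := fun B hB => add_mem hB (e B hB)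
  refine ⟨fmul w φ, fmul_mem_Cc w hk, φ + fmul w φ, add_mem hk (fmul_mem_Cc w hk), by grind,
    ?_, ?_, fun B hB => ⟨e B hB, e' B hB⟩⟩
  · intro p hp
    by_cases hpO : p ∈ O
    · exact e O hφO p hpO
    · refine ⟨P, hP.mem_nhds (hAP ⟨hp, hpO⟩), fun l hl => ?_⟩
      match l with
      | [] => rfl
      | a :: l =>
        have : a ∈ P := hl a List.mem_cons_self
        simp [fmul, w, this]
  · intro p hp
    by_cases hpO : p ∈ O
    · exact e' O hφO p hpO
    · refine ⟨Q, hQ.mem_nhds (hAQ ⟨hp, hpO⟩), fun l hl => ?_⟩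
      match l with
      | [] => simp [fmul, hk [] (Or.inr rfl)]
      | a :: l =>
        have : a ∉ P := fun h => Set.disjoint_left.1 hPQ h (hl a List.mem_cons_self)
        simp only [Pi.add_apply, fmul, w, this, if_false, one_mul]
        exact CharTwo.add_self_eq_zero _

end Germs

section Cohomology

variable {X : Type*} [TopologicalSpace X]

/-- Relative cocycles of degree `k` of the pair `(A, B)`. -/
structure Cyc (k : ℕ) (A B : Set X) (φ : Coch X) : Prop where
  cc : φ ∈ Cc X (k + 1)
  rel : φ ∈ Z B
  cyc : d φ ∈ Z A

/-- Relative coboundaries of degree `k` of the pair `(A, B)`. -/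
def Null (k : ℕ) (A B : Set X) (φ : Coch X) : Prop := ∃ ψ ∈ Cc X k, ψ ∈ Z B ∧ φ + d ψ ∈ Z A

lemma Cyc.mono {k : ℕ} {A B A' B' : Set X} {φ : Coch X} (h : Cyc k A B φ) (hA : A' ⊆ A)
    (hB : B' ⊆ B) : Cyc k A' B' φ := ⟨h.cc, Z_anti hB h.rel, Z_anti hA h.cyc⟩

lemma Cyc.add {k : ℕ} {A B : Set X} {φ ψ : Coch X} (h : Cyc k A B φ) (h' : Cyc k A B ψ) :
    Cyc k A B (φ + ψ) :=
  ⟨add_mem h.cc h'.cc, add_mem h.rel h'.rel, mem_of_eq (add_mem h.cyc h'.cyc) (by simp)⟩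

lemma Null.mono {k : ℕ} {A B A' B' : Set X} {φ : Coch X} (h : Null k A B φ) (hA : A' ⊆ A)
    (hB : B' ⊆ B) : Null k A' B' φ :=
  let ⟨ψ, h1, h2, h3⟩ := h
  ⟨ψ, h1, Z_anti hB h2, Z_anti hA h3⟩

lemma Null.add {k : ℕ} {A B : Set X} {φ ψ : Coch X} (h : Null k A B φ) (h' : Null k A B ψ) :
    Null k A B (φ + ψ) := by
  obtain ⟨a, h1, h2, h3⟩ := h
  obtain ⟨b, h1', h2', h3'⟩ := h'
  exact ⟨a + b, add_mem h1 h1', add_mem h2 h2',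
    mem_of_eq (add_mem h3 h3') (by simp only [map_add]; grind)⟩

lemma Null.of_add {k : ℕ} {A B : Set X} {φ ψ : Coch X} (h : Null k A B (φ + ψ))
    (h' : Null k A B ψ) : Null k A B φ := by
  have := h.add h'
  rwa [show φ + ψ + ψ = φ by grind] at this

lemma null_of_mem {k : ℕ} {A : Set X} (B : Set X) {φ : Coch X} (h : φ ∈ Z A) : Null k A B φ :=
  ⟨0, zero_mem _, zero_mem _, by simpa using h⟩

lemma null_d {k : ℕ} (A : Set X) {B : Set X} {ψ : Coch X} (h : ψ ∈ Cc X k) (hB : ψ ∈ Z B) :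
    Null k A B (d ψ) := ⟨ψ, h, hB, by simp only [add_self_coch]; exact zero_mem _⟩

/-- Gluing of nullity over a union of two closed sets. -/
lemma Null.union [NormalSpace X] {A₁ A₂ : Set X} (c₁ : IsClosed A₁) (c₂ : IsClosed A₂) {k : ℕ}
    {B : Set X} {φ : Coch X} (h₁ : Null (k + 1) A₁ B φ)
    (h₂ : Null (k + 1) A₂ B φ)
    (hI : ∀ ψ, Cyc k (A₁ ∩ A₂) B ψ → Null k (A₁ ∩ A₂) B ψ) : Null (k + 1) (A₁ ∪ A₂) B φ := by
  obtain ⟨a, ha, haB, haZ⟩ := h₁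
  obtain ⟨b, hb, hbB, hbZ⟩ := h₂
  obtain ⟨e, he, heB, heZ⟩ := hI (a + b) ⟨add_mem ha hb, add_mem haB hbB,
    mem_of_eq (add_mem (Z_anti Set.inter_subset_left haZ) (Z_anti Set.inter_subset_right hbZ))
      (by simp only [map_add]; grind)⟩
  obtain ⟨u, hu, v, hv, huv, huA, hvA, hB⟩ := split c₁ c₂
    (add_mem (add_mem ha hb) (d_mem_Cc he)) heZ
  have hB' := hB B (add_mem (add_mem haB hbB) (d_mem_Z heB))
  refine ⟨a + u, add_mem ha hu, add_mem haB hB'.1, ?_⟩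
  refine mem_Z_union (mem_of_eq (add_mem haZ (d_mem_Z huA)) (by simp only [map_add]; grind)) ?_
  have := congrArg d huv
  simp only [map_add, d_d] at this
  exact mem_of_eq (add_mem hbZ (d_mem_Z hvA)) (by simp only [map_add]; grind)

end Cohomology

section Dimension

variable {X : Type*} [TopologicalSpace X]

/-- Cohomological dimension at most `n`, hereditarily for closed subsets. -/
def DimLE (A : Set X) (n : ℕ) : Prop := ∀ A' ⊆ A, IsClosed A' → ∀ B : Set X, IsClosed B →
  ∀ k, n < k → ∀ φ, Cyc k A' B φ → Null k A' B φ

lemma DimLE.mono {A A' : Set X} {n n' : ℕ} (h : DimLE A n) (hA : A' ⊆ A) (hn : n ≤ n') :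
    DimLE A' n' :=
  fun C hC hCc B hB k hk φ hφ => h C (hC.trans hA) hCc B hB k (hn.trans_lt hk) φ hφ

lemma DimLE.union {A₁ A₂ : Set X} {n : ℕ} (c₁ : IsClosed A₁) (c₂ : IsClosed A₂)
    (h₁ : DimLE A₁ n) (h₂ : DimLE A₂ n) : DimLE (A₁ ∪ A₂) n := by
  intro C hC hCc B hB k hk φ hφ
  have hC1 : IsClosed (C ∩ A₁) := hCc.inter c₁
  obtain ⟨a, ha, haB, haZ⟩ := h₁ (C ∩ A₁) Set.inter_subset_right hC1 B hB k hk φ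
    (hφ.mono Set.inter_subset_left le_rfl)
  obtain ⟨b, hb, hbB, hbZ⟩ := h₂ (C ∩ A₂) Set.inter_subset_right (hCc.inter c₂) (B ∪ C ∩ A₁)
    (hB.union hC1) k hk (φ + d a) ⟨add_mem hφ.cc (d_mem_Cc ha),
      mem_Z_union (add_mem hφ.rel (d_mem_Z haB)) haZ,
      by simpa using Z_anti Set.inter_subset_left hφ.cyc⟩
  refine ⟨a + b, add_mem ha hb, add_mem haB (Z_anti Set.subset_union_left hbB), ?_⟩
  have h1 : φ + d (a + b) ∈ Z (C ∩ A₁) :=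
    mem_of_eq (add_mem haZ (d_mem_Z (Z_anti Set.subset_union_right hbB)))
      (by simp only [map_add]; grind)
  have h2 : φ + d (a + b) ∈ Z (C ∩ A₂) := mem_of_eq hbZ (by simp only [map_add]; grind)
  exact mem_Z_of_union h1 h2 fun x hx => (hC hx).imp (fun h => ⟨hx, h⟩) fun h => ⟨hx, h⟩

lemma dimLE_of_subsingleton [RegularSpace X] {A : Set X} (hA : A.Subsingleton) : DimLE A 0 := by
  intro C hC hCc B hB k hk φ hφ
  obtain ⟨k, rfl⟩ : ∃ j, k = j + 1 := ⟨k - 1, by omega⟩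
  rcases C.eq_empty_or_nonempty with rfl | ⟨p, hp⟩
  · exact null_of_mem B fun _ h => h.elim
  have hCp : C ⊆ {p} := fun x hx => hA (hC hx) (hC hp)
  by_cases hpB : p ∈ B
  · exact null_of_mem B (Z_anti (hCp.trans (by simpa using hpB)) hφ.rel)
  obtain ⟨U, hU, hv⟩ := hφ.cyc p hp
  have hd : Disjoint (𝓝ˢ B) (𝓝 p) := RegularSpace.regular hB hpB
  obtain ⟨S, hS, T, hT, hST⟩ := Filter.disjoint_iff.1 hd
  refine ⟨cutoff T fun l => φ (p :: l), cutoff_mem_Cc _ (Cc_cons hφ.cc p), ?_, ?_⟩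
  · intro q hq
    refine ⟨S, mem_nhdsSet_iff_forall.1 hS q hq, fun l hl => ?_⟩
    match l with
    | [] => exact cutoff_mem_Cc _ (Cc_cons hφ.cc p) [] (Or.inr rfl)
    | a :: l =>
      have : a ∉ T := fun h => Set.disjoint_left.1 hST (hl a List.mem_cons_self) h
      simp [cutoff, this]
  · intro q hq
    obtain rfl : q = p := hCp hq
    refine ⟨U ∩ T, Filter.inter_mem hU hT, fun l hl => ?_⟩
    have h1 : d φ (q :: l) = 0 := hv _ (by
      simp only [List.mem_cons, forall_eq_or_imp]
      exact ⟨mem_of_mem_nhds hU, fun x hx => (hl x hx).1⟩)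
    have h2 := (cutoff_add_van T fun l => φ (q :: l)).d l fun x hx => (hl x hx).2
    rw [d_cons] at h1
    simp only [map_add, Pi.add_apply] at h2 ⊢
    grind

lemma real_continuation {P : ℝ → Prop} (hP : ∀ u v, u ≤ v → P v → P u) {a : ℝ} (ha : P a)
    (h : ∀ t, ∃ ε > 0, ∀ u v, t - ε < u → u ≤ v → v < t + ε → P u → P v) (b : ℝ) : P b := by
  by_contra hb
  have hbd : BddAbove {t | P t} := ⟨b, fun t ht => le_of_not_gt fun hlt => hb (hP b t hlt.le ht)⟩
  obtain ⟨ε, hε, hh⟩ := h (sSup {t | P t})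
  obtain ⟨u, hu, hlt⟩ := exists_lt_of_lt_csSup ⟨a, ha⟩
    (show sSup {t | P t} - ε < sSup {t | P t} by linarith)
  have hus : u ≤ sSup {t | P t} := le_csSup hbd hu
  have h2 := hh u (sSup {t | P t} + ε / 2) hlt (by linarith) (by linarith) hu
  have := le_csSup hbd h2
  linarith

lemma exists_forall_dist_lt {A : Set X} (hA : IsCompact A) {g : X → ℝ} (hg : ContinuousOn g A)
    {O : Set X} (hO : IsOpen O) {t : ℝ} (h : ∀ x ∈ A, g x = t → x ∈ O) :
    ∃ ε > 0, ∀ x ∈ A, |g x - t| < ε → x ∈ O := by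
  rcases (A \ O).eq_empty_or_nonempty with he | hne
  · exact ⟨1, one_pos, fun x hx _ => by_contra fun hxO => (he.subset ⟨hx, hxO⟩ : False)⟩
  obtain ⟨y, hy, hmin⟩ := (hA.diff hO).exists_isMinOn hne
    ((hg.mono Set.sdiff_subset).sub continuousOn_const).abs (f := fun x => |g x - t|)
  refine ⟨|g y - t|, abs_pos.2 fun h0 => hy.2 (h y hy.1 (sub_eq_zero.1 h0)), fun x hx hlt => ?_⟩
  by_contra hxO
  exact absurd (hmin ⟨hx, hxO⟩) (not_le.2 hlt)

lemma DimLE.of_fibers [NormalSpace X] {A : Set X} (hAc : IsCompact A)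
    {g : X → ℝ} (hg : ContinuousOn g A) {n : ℕ} (h : ∀ t, DimLE (A ∩ g ⁻¹' {t}) n) :
    DimLE A (n + 1) := by
  intro C hC hCc B hB k hk φ hφ
  obtain ⟨k, rfl⟩ : ∃ j, k = j + 1 := ⟨k - 1, by omega⟩
  have hCK : IsCompact C := hAc.of_isClosed_subset hCc hC
  have hgC := hg.mono hC
  have cl : ∀ S : Set ℝ, IsClosed S → IsClosed (C ∩ g ⁻¹' S) :=
    fun S hS => hgC.preimage_isClosed_of_isClosed hCc hS
  have key : ∀ b, Null (k + 1) (C ∩ g ⁻¹' Set.Iic b) B φ := by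
    obtain ⟨M, hM⟩ := hCK.exists_bound_of_continuousOn hgC
    refine real_continuation (a := -M - 1)
      (fun u v huv hv => hv.mono (Set.inter_subset_inter_right _
        (Set.preimage_mono (Set.Iic_subset_Iic.2 huv))) le_rfl) ?_ fun t => ?_
    · refine null_of_mem B fun p hp => absurd hp.2 ?_
      have := hM p hp.1
      rw [Real.norm_eq_abs, abs_le] at this
      simp only [Set.mem_preimage, Set.mem_Iic, not_le]
      linarith
    · have hfc := cl {t} isClosed_singleton
      obtain ⟨a, ha, haB, haZ⟩ := h t (C ∩ g ⁻¹' {t}) (Set.inter_subset_inter_left _ hC) hfc B hB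
        (k + 1) (by omega) φ (hφ.mono Set.inter_subset_left le_rfl)
      obtain ⟨O, hO, hfO, hOZ⟩ := exists_open_mem_Z haZ
      obtain ⟨ε, hε, hh⟩ := exists_forall_dist_lt hCK hgC hO (t := t) fun x hx ht => hfO ⟨hx, ht⟩
      refine ⟨ε, hε, fun u v hu huv hv hPu => ?_⟩
      have e : C ∩ g ⁻¹' Set.Iic v = (C ∩ g ⁻¹' Set.Iic u) ∪ (C ∩ g ⁻¹' Set.Icc u v) := by
        rw [← Set.inter_union_distrib_left, ← Set.preimage_union, Set.Iic_union_Icc_eq_Iic huv]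
      rw [e]
      refine Null.union (cl _ isClosed_Iic) (cl _ isClosed_Icc) hPu ⟨a, ha, haB, ?_⟩ ?_
      · refine Z_anti (fun x hx => hh x hx.1 ?_) hOZ
        obtain ⟨h1, h2⟩ := hx.2
        rw [abs_lt]
        constructor <;> linarith
      · intro ψ hψ
        refine h u _ (fun x hx => ⟨hC hx.1.1, ?_⟩) ((cl _ isClosed_Iic).inter (cl _ isClosed_Icc))
          B hB k (by omega) ψ hψ
        exact le_antisymm hx.1.2 hx.2.2.1
  obtain ⟨M, hM⟩ := hCK.exists_bound_of_continuousOn hgC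
  refine (key M).mono (fun x hx => ⟨hx, ?_⟩) le_rfl
  exact (le_abs_self _).trans (hM x hx)

lemma DimLE.of_fibers_circle [NormalSpace X] {A : Set X} (hA : IsClosed A) (hAc : IsCompact A)
    {g : X → ℂ} (hg : ContinuousOn g A) (h1 : ∀ x ∈ A, ‖g x‖ = 1) {n : ℕ}
    (h : ∀ t, DimLE (A ∩ g ⁻¹' {t}) n) : DimLE A (n + 1) := by
  have hre : ContinuousOn (fun x => (g x).re) A := Complex.continuous_re.comp_continuousOn hg
  have him : ContinuousOn (fun x => (g x).im) A := Complex.continuous_im.comp_continuousOn hg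
  have key : ∀ S : Set ℝ, IsClosed S → (∀ u ∈ S, ∀ v ∈ S, u ^ 2 = v ^ 2 → u = v) →
      DimLE (A ∩ (fun x => (g x).im) ⁻¹' S) (n + 1) := by
    intro S hS hinj
    have hc := him.preimage_isClosed_of_isClosed hA hS
    refine DimLE.of_fibers (hAc.of_isClosed_subset hc Set.inter_subset_left)
      (hre.mono Set.inter_subset_left) fun t => ?_
    rcases (A ∩ (fun x => (g x).im) ⁻¹' S ∩ (fun x => (g x).re) ⁻¹' {t}).eq_empty_or_nonempty with
      he | ⟨y, hy⟩
    · rw [he]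
      exact (h 0).mono (Set.empty_subset _) le_rfl
    · refine (h (g y)).mono (fun x hx => ⟨hx.1.1, ?_⟩) le_rfl
      have hr : (g x).re = (g y).re := hx.2.trans hy.2.symm
      refine Complex.ext hr (hinj _ hx.1.2 _ hy.1.2 ?_)
      have e1 := h1 x hx.1.1
      have e2 := h1 y hy.1.1
      have n1 := Complex.normSq_apply (g x)
      have n2 := Complex.normSq_apply (g y)
      rw [Complex.normSq_eq_norm_sq, e1] at n1
      rw [Complex.normSq_eq_norm_sq, e2] at n2
      rw [hr] at n1
      simp only
      linarith
  have hu := DimLE.union (him.preimage_isClosed_of_isClosed hA isClosed_Ici)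
    (him.preimage_isClosed_of_isClosed hA isClosed_Iic)
    (key (Set.Ici 0) isClosed_Ici fun u hu v hv huv => (sq_eq_sq₀ hu hv).1 huv)
    (key (Set.Iic 0) isClosed_Iic fun u hu v hv huv => by
      have := (sq_eq_sq₀ (a := -u) (b := -v) (neg_nonneg.2 hu) (neg_nonneg.2 hv)).1
        (by simpa using huv)
      linarith)
  refine hu.mono (fun x hx => ?_) le_rfl
  rcases le_total 0 (g x).im with h | h
  · exact Or.inl ⟨hx, h⟩
  · exact Or.inr ⟨hx, h⟩

lemma dimLE_of_coords [T4Space X] (n : ℕ) : ∀ {A : Set X}, IsClosed A → IsCompact A →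
    ∀ u : Fin n → X → ℝ, (∀ i, ContinuousOn (u i) A) →
    (∀ x ∈ A, ∀ y ∈ A, (∀ i, u i x = u i y) → x = y) → DimLE A n := by
  induction n with
  | zero =>
    intro A _ _ u _ h
    exact dimLE_of_subsingleton fun x hx y hy => h x hx y hy fun i => i.elim0
  | succ n ih =>
    intro A hA hAc u hu h
    refine DimLE.of_fibers hAc (hu 0) fun t => ?_
    have hc := (hu 0).preimage_isClosed_of_isClosed hA (isClosed_singleton (x := t))
    refine ih hc (hAc.of_isClosed_subset hc Set.inter_subset_left) (fun i => u i.succ)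
      (fun i => (hu _).mono Set.inter_subset_left) fun x hx y hy hxy => h x hx.1 y hy.1 fun i => ?_
    refine Fin.cases ?_ hxy i
    exact hx.2.trans hy.2.symm

lemma dimLE_of_circle_coords [T4Space X] (n : ℕ) : ∀ {A : Set X}, IsClosed A → IsCompact A →
    ∀ u : Fin n → X → ℂ, (∀ i, ContinuousOn (u i) A) → (∀ i, ∀ x ∈ A, ‖u i x‖ = 1) →
    (∀ x ∈ A, ∀ y ∈ A, (∀ i, u i x = u i y) → x = y) → DimLE A n := by
  induction n with
  | zero =>
    intro A _ _ u _ _ h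
    exact dimLE_of_subsingleton fun x hx y hy => h x hx y hy fun i => i.elim0
  | succ n ih =>
    intro A hA hAc u hu h1 h
    refine DimLE.of_fibers_circle hA hAc (hu 0) (h1 0) fun t => ?_
    have hc := (hu 0).preimage_isClosed_of_isClosed hA (isClosed_singleton (x := t))
    refine ih hc (hAc.of_isClosed_subset hc Set.inter_subset_left) (fun i => u i.succ)
      (fun i => (hu _).mono Set.inter_subset_left) (fun i x hx => h1 _ x hx.1)
      fun x hx y hy hxy => h x hx.1 y hy.1 fun i => ?_
    refine Fin.cases ?_ hxy i
    exact hx.2.trans hy.2.symm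

end Dimension

section Homotopy

variable {X Y : Type*} [TopologicalSpace X] [TopologicalSpace Y]

/-- All relative cocycles of degree `k` are coboundaries. -/
def Acyc (k : ℕ) (A B : Set X) : Prop := ∀ φ, Cyc k A B φ → Null k A B φ

/-- The relative cohomology in degree `k` has exactly two classes. -/
def OneDim (k : ℕ) (A B : Set X) : Prop := ∃ ω, Cyc k A B ω ∧ ¬ Null k A B ω ∧
  ∀ φ, Cyc k A B φ → Null k A B φ ∨ Null k A B (φ + ω)

lemma eventually_prism {G : ℝ → Y → X} (hG : Continuous fun p : ℝ × Y => G p.1 p.2)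
    {K : Set Y} (hK : IsCompact K) (t : ℝ) {T : Set X} (hT : ∀ p ∈ K, G t p ∈ T) {φ : Coch X}
    (hφ : φ ∈ Z T) : ∀ᶠ s in 𝓝 t, prism (G t) (G s) φ ∈ Z K := by
  have key : ∀ p ∈ K, ∀ᶠ z : ℝ × Y in 𝓝 (t, p),
      ∃ U ∈ 𝓝 z.2, Van (prism (G t) (G z.1) φ) U := by
    intro p hp
    obtain ⟨W, hW, hv⟩ := hφ _ (hT p hp)
    have h1 : ∀ᶠ z : ℝ × Y in 𝓝 (t, p), G z.1 z.2 ∈ W ∧ G t z.2 ∈ W := by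
      refine Filter.Eventually.and ?_ ?_
      · exact hG.continuousAt.eventually_mem hW
      · exact (hG.comp (continuous_const.prodMk continuous_snd)).continuousAt.eventually_mem hW
    rw [nhds_prod_eq] at h1 ⊢
    obtain ⟨Q, hQ, P, hP, hPQ⟩ := Filter.eventually_prod_iff.1 h1
    refine Filter.eventually_prod_iff.2 ⟨Q, hQ, _, eventually_eventually_nhds.2 hP,
      fun {s} hs {y} hy => ⟨{y | P y}, hy, hv.prism (fun z hz => ?_) fun z hz => ?_⟩⟩
    · exact (hPQ hs hz).2
    · exact (hPQ hs hz).1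
  have := hK.eventually_forall_of_forall_eventually (x₀ := t)
    (P := fun s q => ∃ U ∈ 𝓝 q, Van (prism (G t) (G s) φ) U) key
  filter_upwards [this] with s hs p hp using hs p hp

lemma homotopy {G : ℝ → Y → X} (hG : Continuous fun p : ℝ × Y => G p.1 p.2)
    {K B : Set Y} {A' B' : Set X} (hK : IsCompact K) (hBc : IsCompact B)
    (hKA : ∀ t ∈ Set.Icc (0 : ℝ) 1, ∀ p ∈ K, G t p ∈ A')
    (hBB : ∀ t ∈ Set.Icc (0 : ℝ) 1, ∀ p ∈ B, G t p ∈ B') {k : ℕ} {φ : Coch X}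
    (hφ : Cyc k A' B' φ) : Null k K B (pb (G 0) φ + pb (G 1) φ) := by
  set c : ℝ → ℝ := fun t => max 0 (min 1 t) with hc
  have hcI : ∀ t, c t ∈ Set.Icc (0 : ℝ) 1 := fun t => ⟨le_max_left _ _, by simp [hc]⟩
  have hGc : Continuous fun p : ℝ × Y => G (c p.1) p.2 :=
    hG.comp ((continuous_const.max (continuous_const.min continuous_fst)).prodMk continuous_snd)
  have key : ∀ b u, u ≤ b → Null k K B (pb (G (c 0)) φ + pb (G (c u)) φ) := by
    refine real_continuation (a := 0) (fun u v huv h w hw => h w (hw.trans huv)) ?_ fun t => ?_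
    · intro u hu
      have : c u = c 0 := by simp [hc, hu, (hu.trans zero_le_one)]
      rw [this, add_self_coch]
      exact null_of_mem B (zero_mem _)
    · have e1 := eventually_prism (G := fun t => G (c t)) hGc hK t (hKA _ (hcI t)) hφ.cyc
      have e2 := eventually_prism (G := fun t => G (c t)) hGc hBc t (hBB _ (hcI t)) hφ.rel
      obtain ⟨ε, hε, hh⟩ := Metric.eventually_nhds_iff.1 (e1.and e2)
      have loc : ∀ s, dist s t < ε → Null k K B (pb (G (c t)) φ + pb (G (c s)) φ) := by
        intro s hs
        obtain ⟨h1, h2⟩ := hh hs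
        refine ⟨prism (G (c t)) (G (c s)) φ, prism_mem_Cc _ _ hφ.cc, h2, ?_⟩
        rw [← prism_homotopy]
        exact mem_of_eq h1 (by grind)
      refine ⟨ε, hε, fun u v hu huv hv hPu w hw => ?_⟩
      rcases le_total w u with hwu | hwu
      · exact hPu w hwu
      · have d1 := loc u (by rw [Real.dist_eq, abs_lt]; constructor <;> linarith)
        have d2 := loc w (by rw [Real.dist_eq, abs_lt]; constructor <;> linarith)
        have := ((hPu u le_rfl).add d1).add d2
        rwa [show pb (G (c 0)) φ + pb (G (c u)) φ + (pb (G (c t)) φ + pb (G (c u)) φ) +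
          (pb (G (c t)) φ + pb (G (c w)) φ) = pb (G (c 0)) φ + pb (G (c w)) φ by grind] at this
  simpa [hc] using key 1 1 le_rfl

lemma acyc_of_deformation {G : ℝ → X → X} (hG : Continuous fun p : ℝ × X => G p.1 p.2)
    {A E : Set X} (hA : IsCompact A) (hE : IsCompact E)
    (hGA : ∀ t ∈ Set.Icc (0 : ℝ) 1, ∀ p ∈ A, G t p ∈ A)
    (hGE : ∀ t ∈ Set.Icc (0 : ℝ) 1, ∀ p ∈ E, G t p ∈ E) (h0 : G 0 = id)
    (h1 : ∀ p ∈ A, G 1 p ∈ E) (k : ℕ) : Acyc k A E := by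
  intro φ hφ
  have h := homotopy hG hA hE hGA hGE hφ
  rw [h0, pb_id] at h
  refine h.of_add (null_of_mem E (pb_mem_Z (fun p _ => ?_) h1 hφ.rel))
  exact (hG.comp (continuous_const.prodMk continuous_id)).continuousAt

lemma oneDim_zero {A : Set X} (hA : IsCompact A) {p : X} (hp : p ∈ A) {G : ℝ → X → X}
    (hG : Continuous fun p : ℝ × X => G p.1 p.2)
    (hGA : ∀ t ∈ Set.Icc (0 : ℝ) 1, ∀ p ∈ A, G t p ∈ A) (h0 : G 0 = id)
    (h1 : G 1 = fun _ => p) : OneDim 0 A ∅ := by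
  classical
  set ω : Coch X := fun l => if l.length = 1 then 1 else 0 with hω
  have hωc : ω ∈ Cc X 1 := by
    rintro l (hl | rfl)
    · simp [hω, hl]
    · simp [hω]
  refine ⟨ω, ⟨hωc, fun _ h => h.elim, ?_⟩, ?_, fun φ hφ => ?_⟩
  · suffices d ω = 0 by rw [this]; exact zero_mem _
    funext l
    by_cases hl : l.length = 2
    · match l, hl with
      | [a, b], _ => simp [d_cons, hω, CharTwo.add_self_eq_zero]
    · exact d_mem_Cc hωc l (Or.inl hl)
  · rintro ⟨ψ, hψ, _, hz⟩
    rw [Cc_zero hψ, map_zero, add_zero] at hz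
    obtain ⟨U, hU, hv⟩ := hz p hp
    simpa [hω] using hv [p] (by simpa using mem_of_mem_nhds hU)
  · have h := homotopy (B := ∅) (B' := ∅) hG hA isCompact_empty hGA (fun _ _ _ h => h.elim) hφ
    rw [h0, pb_id, h1] at h
    rcases (by decide : ∀ x : ZMod 2, x = 0 ∨ x = 1) (φ [p]) with h' | h'
    · left
      have : pb (fun _ : X => p) φ = 0 := by
        funext l
        match l with
        | [] => exact hφ.cc _ (Or.inr rfl)
        | [a] => exact h'
        | a :: b :: l => exact hφ.cc _ (Or.inl (by simp))
      rwa [this, add_zero] at h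
    · right
      have : pb (fun _ : X => p) φ = ω := by
        funext l
        match l with
        | [] => exact hφ.cc _ (Or.inr rfl)
        | [a] => exact h'
        | a :: b :: l => exact (hφ.cc _ (Or.inl (by simp))).trans (by simp [hω])
      rwa [this] at h

end Homotopy

section Suspension

variable {X : Type*} [TopologicalSpace X] {A E₀ E₁ : Set X}

lemma Acyc.susp_zero (h₀ : Acyc 0 A E₀) : Acyc 0 A (E₀ ∪ E₁) := by
  intro φ hφ
  obtain ⟨ψ, hψ, _, hz⟩ := h₀ φ (hφ.mono le_rfl Set.subset_union_left)
  rw [Cc_zero hψ, map_zero, add_zero] at hz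
  exact null_of_mem _ hz

lemma Acyc.susp_aux [NormalSpace X] (c₀ : IsClosed E₀) (c₁ : IsClosed E₁)
    (s₁ : E₁ ⊆ A) (h₀ : ∀ k, Acyc k A E₀) (h₁ : ∀ k, Acyc k A E₁) {k : ℕ}
    {φ : Coch X} (hφ : Cyc (k + 1) A (E₀ ∪ E₁) φ) :
    ∃ ψ, Cyc k A (E₀ ∩ E₁) ψ ∧ (Null k A (E₀ ∩ E₁) ψ → Null (k + 1) A (E₀ ∪ E₁) φ) ∧
      ∀ ω ω₀ ω₁, ω₀ ∈ Cc X (k + 1) → ω₁ ∈ Cc X (k + 1) → ω₀ ∈ Z E₀ → ω₁ ∈ Z E₁ →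
        ω₀ + ω₁ = ω → Null k A (E₀ ∩ E₁) (ψ + ω) → Null (k + 1) A (E₀ ∪ E₁) (φ + d ω₀) := by
  obtain ⟨a, ha, haB, haZ⟩ := h₀ _ φ (hφ.mono le_rfl Set.subset_union_left)
  obtain ⟨b, hb, hbB, hbZ⟩ := h₁ _ φ (hφ.mono le_rfl Set.subset_union_right)
  have main : ∀ ω ω₀ ω₁, ω₀ ∈ Cc X (k + 1) → ω₁ ∈ Cc X (k + 1) → ω₀ ∈ Z E₀ → ω₁ ∈ Z E₁ →
      ω₀ + ω₁ = ω → Null k A (E₀ ∩ E₁) (a + b + ω) → Null (k + 1) A (E₀ ∪ E₁) (φ + d ω₀) := by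
    rintro ω ω₀ ω₁ c0 c1 z0 z1 hω ⟨η, hη, hηB, hηZ⟩
    obtain ⟨u, hu, v, hv, huv, hu0, hv1, -⟩ := split c₀ c₁ hη hηB
    have hx : a + ω₀ + d u ∈ Z E₁ := by
      refine mem_of_eq (add_mem (add_mem (add_mem hbB z1) (d_mem_Z hv1)) (Z_anti s₁ hηZ)) ?_
      rw [← huv, ← hω]
      simp only [map_add]; grind
    refine ⟨a + ω₀ + d u, add_mem (add_mem ha c0) (d_mem_Cc hu),
      mem_Z_union (add_mem (add_mem haB z0) (d_mem_Z hu0)) hx, ?_⟩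
    exact mem_of_eq haZ (by simp only [map_add, d_d]; grind)
  refine ⟨a + b, ⟨add_mem ha hb, add_mem (Z_anti Set.inter_subset_left haB)
    (Z_anti Set.inter_subset_right hbB), mem_of_eq (add_mem haZ hbZ)
      (by simp only [map_add]; grind)⟩, fun h => ?_, main⟩
  simpa using main 0 0 0 (zero_mem _) (zero_mem _) (zero_mem _) (zero_mem _) (by simp)
    (by simpa using h)

lemma Acyc.susp [NormalSpace X] (c₀ : IsClosed E₀) (c₁ : IsClosed E₁)
    (s₁ : E₁ ⊆ A) (h₀ : ∀ k, Acyc k A E₀) (h₁ : ∀ k, Acyc k A E₁) {k : ℕ}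
    (h : Acyc k A (E₀ ∩ E₁)) : Acyc (k + 1) A (E₀ ∪ E₁) := by
  intro φ hφ
  obtain ⟨ψ, hψ, hn, -⟩ := Acyc.susp_aux c₀ c₁ s₁ h₀ h₁ hφ
  exact hn (h ψ hψ)

lemma OneDim.susp [NormalSpace X] (c₀ : IsClosed E₀) (c₁ : IsClosed E₁)
    (s₁ : E₁ ⊆ A) (h₀ : ∀ k, Acyc k A E₀) (h₁ : ∀ k, Acyc k A E₁) {k : ℕ}
    (h : OneDim k A (E₀ ∩ E₁)) : OneDim (k + 1) A (E₀ ∪ E₁) := by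
  obtain ⟨ω, hω, hnn, hall⟩ := h
  obtain ⟨u, hu, v, hv, huv, hu0, hv1, -⟩ := split c₀ c₁ hω.cc hω.rel
  have huv' : d u + d v = d ω := by rw [← map_add, huv]
  have hd1 : d u ∈ Z E₁ :=
    mem_of_eq (add_mem (Z_anti s₁ hω.cyc) (d_mem_Z hv1)) (by rw [← huv']; grind)
  refine ⟨d u, ⟨d_mem_Cc hu, mem_Z_union (d_mem_Z hu0) hd1, by simp⟩, ?_, fun φ hφ => ?_⟩
  · rintro ⟨x, hx, hxB, hxZ⟩
    apply hnn
    have hx0 := Z_anti Set.subset_union_left hxB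
    have hx1 := Z_anti Set.subset_union_right hxB
    have n0 := h₀ k (u + x) ⟨add_mem hu hx, add_mem hu0 hx0, by simpa using hxZ⟩
    have n1 := h₁ k (v + x) ⟨add_mem hv hx, add_mem hv1 hx1,
      mem_of_eq (add_mem hxZ hω.cyc) (by rw [← huv', map_add]; grind)⟩
    have := (n0.mono le_rfl Set.inter_subset_left).add (n1.mono le_rfl Set.inter_subset_right)
    rwa [show u + x + (v + x) = ω by rw [← huv]; grind] at this
  · obtain ⟨ψ, hψ, hn, hm⟩ := Acyc.susp_aux c₀ c₁ s₁ h₀ h₁ hφ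
    exact (hall ψ hψ).imp hn fun h => hm ω u v hu hv hu0 hv1 huv h

end Suspension

section Box

/-- The closed unit box. -/
def box (m : ℕ) : Set (Fin m → ℝ) := {y | ∀ i, y i ∈ Set.Icc (0 : ℝ) 1}

/-- The faces of the box in the first `l` directions. -/
def faces (m l : ℕ) : Set (Fin m → ℝ) :=
  {y | y ∈ box m ∧ ∃ i : Fin m, i.val < l ∧ (y i = 0 ∨ y i = 1)}

lemma box_eq (m : ℕ) : box m = Set.pi Set.univ fun _ => Set.Icc (0 : ℝ) 1 := by
  ext y; simp [box, Pi.le_def, forall_and]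

lemma isCompact_box (m : ℕ) : IsCompact (box m) := by
  rw [box_eq]
  exact isCompact_univ_pi fun _ => isCompact_Icc

lemma isClosed_coord (m : ℕ) (i : Fin m) (v : ℝ) : IsClosed {y : Fin m → ℝ | y i = v} :=
  isClosed_eq (continuous_apply i) continuous_const

lemma isCompact_faces (m l : ℕ) : IsCompact (faces m l) := by
  have : faces m l = box m ∩ ⋃ i : Fin m, {y | i.val < l ∧ (y i = 0 ∨ y i = 1)} := by
    ext y; simp [faces]
  rw [this]
  refine (isCompact_box m).inter_right (isClosed_iUnion_of_finite fun i => ?_)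
  by_cases h : i.val < l
  · simp only [h, true_and, Set.ofPred_or]
    exact (isClosed_coord m i 0).union (isClosed_coord m i 1)
  · simp [h]

lemma faces_subset (m l : ℕ) : faces m l ⊆ box m := fun _ h => h.1

/-- The union of the faces in the first `l` directions and one face in direction `l`. -/
def halfFaces {m : ℕ} (l : Fin m) (v : ℝ) : Set (Fin m → ℝ) :=
  faces m l ∪ box m ∩ {y | y l = v}

lemma acyc_halfFaces {m : ℕ} (l : Fin m) {v : ℝ} (hv : v ∈ Set.Icc (0 : ℝ) 1) (k : ℕ) :
    Acyc k (box m) (halfFaces l v) := by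
  have hbox : ∀ t ∈ Set.Icc (0 : ℝ) 1, ∀ p ∈ box m,
      Function.update p l (p l + t * (v - p l)) ∈ box m := by
    intro t ht p hp i
    by_cases h : i = l
    · subst h
      have := hp i
      simp only [Function.update_self, Set.mem_Icc] at *
      constructor <;> nlinarith
    · simpa [Function.update_of_ne h] using hp i
  refine acyc_of_deformation (G := fun t y => Function.update y l (y l + t * (v - y l))) ?_
    (isCompact_box m) ((isCompact_faces m l).union ((isCompact_box m).inter_right
      (isClosed_coord m l v))) hbox ?_ ?_ ?_ k
  · fun_prop
  · rintro t ht p (⟨hp, i, hi, h⟩ | ⟨hp, h⟩)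
    · refine Or.inl ⟨hbox t ht p hp, i, hi, ?_⟩
      rwa [Function.update_of_ne (fun e => by simp [e] at hi)]
    · have h' : p l = v := h
      refine Or.inr ⟨hbox t ht p hp, ?_⟩
      simp [h']
  · funext y
    simp
  · intro p hp
    exact Or.inr ⟨hbox 1 (by simp) p hp, by simp⟩

lemma halfFaces_union {m : ℕ} (l : Fin m) :
    halfFaces l 0 ∪ halfFaces l 1 = faces m (l + 1) := by
  ext y
  constructor
  · rintro ((⟨h, i, hi, hy⟩ | ⟨h, hy⟩) | (⟨h, i, hi, hy⟩ | ⟨h, hy⟩))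
    · exact ⟨h, i, by omega, hy⟩
    · exact ⟨h, l, by omega, Or.inl hy⟩
    · exact ⟨h, i, by omega, hy⟩
    · exact ⟨h, l, by omega, Or.inr hy⟩
  · rintro ⟨h, i, hi, hy⟩
    by_cases hil : i = l
    · subst hil
      exact hy.imp (fun h' => Or.inr ⟨h, h'⟩) fun h' => Or.inr ⟨h, h'⟩
    · exact Or.inl (Or.inl ⟨h, i, by have := Fin.val_ne_of_ne hil; omega, hy⟩)

lemma halfFaces_inter {m : ℕ} (l : Fin m) :
    halfFaces l 0 ∩ halfFaces l 1 = faces m l := by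
  ext y
  constructor
  · rintro ⟨h | ⟨h, hy⟩, h' | ⟨h', hy'⟩⟩
    · exact h
    · exact h
    · exact h'
    · exact absurd (hy.symm.trans hy' : (0 : ℝ) = 1) zero_ne_one
  · exact fun h => ⟨Or.inl h, Or.inl h⟩

lemma isClosed_halfFaces {m : ℕ} (l : Fin m) (v : ℝ) : IsClosed (halfFaces l v) :=
  (isCompact_faces m l).isClosed.union
    ((isCompact_box m).isClosed.inter (isClosed_coord m l v))

lemma halfFaces_subset {m : ℕ} (l : Fin m) (v : ℝ) : halfFaces l v ⊆ box m := by
  rintro y (h | h)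
  · exact h.1
  · exact h.1

lemma oneDim_faces (m : ℕ) : ∀ l ≤ m, OneDim l (box m) (faces m l) := by
  intro l
  induction l with
  | zero =>
    intro _
    have : faces m 0 = ∅ := by ext y; simp [faces]
    rw [this]
    refine oneDim_zero (isCompact_box m) (p := 0) (fun i => by simp)
      (G := fun t y => y + t • (0 - y)) (by fun_prop) ?_ (by funext y; simp) (by funext y; simp)
    intro t ht p hp i
    have := hp i
    simp only [Set.mem_Icc, Pi.add_apply, Pi.smul_apply, Pi.sub_apply, Pi.zero_apply,
      smul_eq_mul] at *
    constructor <;> nlinarith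
  | succ l ih =>
    intro hl
    have := ih (by omega)
    rw [← halfFaces_inter ⟨l, hl⟩] at this
    have := OneDim.susp (isClosed_halfFaces _ _) (isClosed_halfFaces _ _) (halfFaces_subset _ _)
      (acyc_halfFaces _ (by simp)) (acyc_halfFaces _ (by simp)) this
    rwa [halfFaces_union] at this

lemma acyc_faces (m : ℕ) : ∀ l < m, Acyc l (box m) (faces m (l + 1)) := by
  intro l
  induction l with
  | zero =>
    intro hl
    rw [← halfFaces_union ⟨0, hl⟩]
    exact (acyc_halfFaces _ (by simp) 0).susp_zero
  | succ l ih =>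
    intro hl
    have := ih (by omega)
    rw [← halfFaces_inter ⟨l + 1, hl⟩] at this
    have := Acyc.susp (isClosed_halfFaces _ _) (isClosed_halfFaces _ _) (halfFaces_subset _ _)
      (acyc_halfFaces _ (by simp)) (acyc_halfFaces _ (by simp)) this
    rwa [halfFaces_union] at this

/-- The open box. -/
def openBox (m : ℕ) : Set (Fin m → ℝ) := {y | ∀ i, 0 < y i ∧ y i < 1}

lemma isOpen_openBox (m : ℕ) : IsOpen (openBox m) := by
  have : openBox m = Set.pi Set.univ fun _ => Set.Ioo (0 : ℝ) 1 := by
    ext y; simp [openBox]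
  rw [this]
  exact isOpen_set_pi Set.finite_univ fun _ _ => isOpen_Ioo

lemma openBox_subset (m : ℕ) : openBox m ⊆ box m := fun _ h i => ⟨(h i).1.le, (h i).2.le⟩

lemma mem_faces_iff {m : ℕ} {y : Fin m → ℝ} (hy : y ∈ box m) :
    y ∈ faces m m ↔ y ∉ openBox m := by
  constructor
  · rintro ⟨_, i, _, h | h⟩ hy'
    · exact (hy' i).1.ne' h
    · exact (hy' i).2.ne h
  · intro h
    simp only [openBox, Set.mem_ofPred_eq, not_forall] at h
    obtain ⟨i, hi⟩ := h
    refine ⟨hy, i, i.isLt, ?_⟩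
    obtain ⟨h1, h2⟩ := hy i
    by_contra! hne
    exact hi ⟨lt_of_le_of_ne h1 hne.1.symm, lt_of_le_of_ne h2 hne.2⟩

end Box

section Cells

variable {X : Type*} [TopologicalSpace X] {m : ℕ}

/-- A chart whose target contains the closed unit box. -/
def IsCell (e : OpenPartialHomeomorph X (Fin m → ℝ)) : Prop := box m ⊆ e.target

/-- The open cell determined by a chart. -/
def cell (e : OpenPartialHomeomorph X (Fin m → ℝ)) : Set X := e.source ∩ e ⁻¹' openBox m

variable {e : OpenPartialHomeomorph X (Fin m → ℝ)}

lemma isOpen_cell (e : OpenPartialHomeomorph X (Fin m → ℝ)) : IsOpen (cell e) :=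
  e.isOpen_inter_preimage (isOpen_openBox m)

lemma symm_mem_cell (he : IsCell e) {y : Fin m → ℝ} (hy : y ∈ openBox m) : e.symm y ∈ cell e := by
  have := he (openBox_subset m hy)
  exact ⟨e.map_target this, by simpa [e.right_inv this] using hy⟩

lemma symm_notMem_cell (he : IsCell e) {y : Fin m → ℝ} (hy : y ∈ faces m m) :
    e.symm y ∉ cell e := fun h => by
  have := he hy.1
  exact (mem_faces_iff hy.1).1 hy (by simpa [e.right_inv this] using h.2)

lemma cell_eq_image (he : IsCell e) : cell e = e.symm '' openBox m := by
  ext x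
  constructor
  · exact fun h => ⟨e x, h.2, e.left_inv h.1⟩
  · rintro ⟨y, hy, rfl⟩
    exact symm_mem_cell he hy

lemma continuousAt_symm (he : IsCell e) {y : Fin m → ℝ} (hy : y ∈ box m) :
    ContinuousAt e.symm y := e.continuousAt_symm (he hy)

/-- Extension by zero of a cochain on the box. -/
def extend (e : OpenPartialHomeomorph X (Fin m → ℝ)) (ψ : Coch (Fin m → ℝ)) : Coch X :=
  cutoff (cell e) (pb e ψ)

lemma extend_add (ψ ψ' : Coch (Fin m → ℝ)) : extend e (ψ + ψ') = extend e ψ + extend e ψ' := by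
  funext l
  simp only [extend, cutoff, map_add, Pi.add_apply]
  split_ifs <;> simp

lemma extend_mem_Cc {k : ℕ} {ψ : Coch (Fin m → ℝ)} (h : ψ ∈ Cc _ k) : extend e ψ ∈ Cc X k :=
  cutoff_mem_Cc _ (pb_mem_Cc _ h)

lemma extend_mem_cell {T : Set (Fin m → ℝ)} {ψ : Coch (Fin m → ℝ)} (h : ψ ∈ Z T) :
    extend e ψ ∈ Z (cell e ∩ e ⁻¹' T) := by
  intro p hp
  obtain ⟨U, hU, hv⟩ := pb_mem_Z (S := cell e ∩ e ⁻¹' T) (fun p hp => e.continuousAt hp.1.1)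
    (fun p hp => hp.2) h p hp
  refine ⟨U, hU, fun l hl => ?_⟩
  simp [extend, cutoff, hv l hl]

lemma pb_symm_mem (he : IsCell e) {φ : Coch X} (h : φ ∈ Z (cell e)ᶜ) :
    pb e.symm φ ∈ Z (faces m m) :=
  pb_mem_Z (fun _ hy => continuousAt_symm he hy.1) (fun _ hy => symm_notMem_cell he hy) h

variable [T2Space X]

lemma extend_mem_compl (he : IsCell e) {k : ℕ} {ψ : Coch (Fin m → ℝ)} (hk : ψ ∈ Cc _ k)
    (h : ψ ∈ Z (faces m m)) : extend e ψ ∈ Z (cell e)ᶜ := by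
  intro p hp
  have hcomp : IsCompact (e.symm '' box m) := (isCompact_box m).image_of_continuousOn
    fun y hy => (continuousAt_symm he hy).continuousWithinAt
  by_cases hpb : p ∈ e.symm '' box m
  · obtain ⟨y, hy, rfl⟩ := hpb
    have hyf : y ∈ faces m m := (mem_faces_iff hy).2 fun h => hp (symm_mem_cell he h)
    obtain ⟨U, hU, hv⟩ := h y hyf
    have hc : ContinuousAt e (e.symm y) := e.continuousAt (e.map_target (he hy))
    rw [ContinuousAt, e.right_inv (he hy)] at hc
    refine ⟨e ⁻¹' U, hc hU, fun l hl => ?_⟩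
    have : ψ (l.map e) = 0 := hv _ (by simpa using hl)
    simp [extend, cutoff, pb_apply, this]
  · refine ⟨(e.symm '' box m)ᶜ, hcomp.isClosed.isOpen_compl.mem_nhds hpb, fun l hl => ?_⟩
    match l with
    | [] => exact extend_mem_Cc hk [] (Or.inr rfl)
    | a :: l =>
      have : a ∉ cell e := fun h => hl a List.mem_cons_self
        (cell_eq_image he ▸ Set.image_mono (openBox_subset m) <| cell_eq_image he ▸ h)
      simp [extend, cutoff, this]

lemma d_extend (he : IsCell e) {k : ℕ} {ψ : Coch (Fin m → ℝ)} (hk : ψ ∈ Cc _ k)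
    (h : ψ ∈ Z (faces m m)) : d (extend e ψ) + extend e (d ψ) ∈ Z (Set.univ : Set X) := by
  refine mem_Z_of_union (S := cell e) (T := (cell e)ᶜ) ?_
    (add_mem (d_mem_Z (extend_mem_compl he hk h)) (extend_mem_compl he (d_mem_Cc hk) (d_mem_Z h)))
    (by simp)
  intro p hp
  refine ⟨cell e, (isOpen_cell e).mem_nhds hp, fun l hl => ?_⟩
  have h1 := (cutoff_add_van (cell e) (pb e ψ)).d l hl
  have h2 := cutoff_add_van (cell e) (pb e (d ψ)) l hl
  simp only [map_add, Pi.add_apply, d_pb, extend] at *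
  grind

lemma extend_mem_univ (he : IsCell e) {k : ℕ} {ψ : Coch (Fin m → ℝ)} (hk : ψ ∈ Cc _ k)
    (h : ψ ∈ Z (box m)) : extend e ψ ∈ Z (Set.univ : Set X) :=
  mem_Z_of_union (extend_mem_cell h) (extend_mem_compl he hk (Z_anti (faces_subset m m) h))
    fun x _ => (em (x ∈ cell e)).imp (fun hx => ⟨hx, openBox_subset m hx.2⟩) id

lemma Cyc.pb_symm (he : IsCell e) {k : ℕ} {φ : Coch X} (h : Cyc k Set.univ (cell e)ᶜ φ) :
    Cyc k (box m) (faces m m) (pb e.symm φ) :=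
  ⟨pb_mem_Cc _ h.cc, pb_symm_mem he h.rel, by
    rw [d_pb]
    exact pb_mem_Z (fun _ hy => continuousAt_symm he hy) (fun _ _ => Set.mem_univ _) h.cyc⟩

lemma extend_pb (he : IsCell e) {k : ℕ} {φ : Coch X} (hk : φ ∈ Cc X k) (h : φ ∈ Z (cell e)ᶜ) :
    φ + extend e (pb e.symm φ) ∈ Z (Set.univ : Set X) := by
  refine mem_Z_of_union (S := cell e) (T := (cell e)ᶜ) ?_
    (add_mem h (extend_mem_compl he (pb_mem_Cc _ hk) (pb_symm_mem he h))) (by simp)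
  intro p hp
  refine ⟨cell e, (isOpen_cell e).mem_nhds hp, fun l hl => ?_⟩
  have : (l.map e).map e.symm = l := by
    rw [List.map_map]
    exact (List.map_congr_left fun x hx => e.left_inv (hl x hx).1).trans (List.map_id l)
  simp only [extend, cutoff, if_pos hl, Pi.add_apply, pb_apply, this]
  exact CharTwo.add_self_eq_zero _

lemma Cyc.extend (he : IsCell e) {k : ℕ} {ψ : Coch (Fin m → ℝ)}
    (h : Cyc k (box m) (faces m m) ψ) : Cyc k Set.univ (cell e)ᶜ (extend e ψ) :=
  ⟨extend_mem_Cc h.cc, extend_mem_compl he h.cc h.rel, mem_of_eq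
    (add_mem (d_extend he h.cc h.rel) (extend_mem_univ he (d_mem_Cc h.cc) h.cyc)) (by grind)⟩

lemma Null.extend (he : IsCell e) {k : ℕ} {ψ : Coch (Fin m → ℝ)} (hk : ψ ∈ Cc _ (k + 1))
    (h : Null k (box m) (faces m m) ψ) : Null k Set.univ (cell e)ᶜ (extend e ψ) := by
  obtain ⟨a, ha, haB, haZ⟩ := h
  refine ⟨AS.extend e a, extend_mem_Cc ha, extend_mem_compl he ha haB, ?_⟩
  have h1 := extend_mem_univ he (add_mem hk (d_mem_Cc ha)) haZ
  rw [extend_add] at h1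
  exact mem_of_eq (add_mem h1 (d_extend he ha haB)) (by grind)

lemma Null.of_pb_symm (he : IsCell e) {k : ℕ} {φ : Coch X} (h : Cyc k Set.univ (cell e)ᶜ φ)
    (hn : Null k (box m) (faces m m) (pb e.symm φ)) : Null k Set.univ (cell e)ᶜ φ :=
  Null.of_add (null_of_mem _ (extend_pb he h.cc h.rel)) (hn.extend he (pb_mem_Cc _ h.cc))

lemma Null.pb_symm (he : IsCell e) {k : ℕ} {φ : Coch X} (hn : Null k Set.univ (cell e)ᶜ φ) :
    Null k (box m) (faces m m) (pb e.symm φ) := by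
  obtain ⟨a, ha, haB, haZ⟩ := hn
  refine ⟨pb e.symm a, pb_mem_Cc _ ha, pb_symm_mem he haB, ?_⟩
  rw [d_pb, ← map_add]
  exact pb_mem_Z (fun _ hy => continuousAt_symm he hy) (fun _ _ => Set.mem_univ _) haZ

lemma pb_extend (he : IsCell e) {k : ℕ} {ψ : Coch (Fin m → ℝ)} (hk : ψ ∈ Cc _ k)
    (h : ψ ∈ Z (faces m m)) : ψ + pb e.symm (extend e ψ) ∈ Z (box m) := by
  refine mem_Z_of_union (S := openBox m) (T := faces m m) ?_
    (add_mem h (pb_symm_mem he (extend_mem_compl he hk h)))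
    fun y hy => (em (y ∈ openBox m)).imp id (mem_faces_iff hy).2
  intro p hp
  refine ⟨openBox m, (isOpen_openBox m).mem_nhds hp, fun l hl => ?_⟩
  have h1 : (l.map e.symm).map e = l := by
    rw [List.map_map]
    exact (List.map_congr_left fun x hx => e.right_inv (he (openBox_subset m (hl x hx)))).trans
      (List.map_id l)
  have h2 : ∀ x ∈ l.map e.symm, x ∈ cell e := by
    simpa using fun x hx => symm_mem_cell he (hl x hx)
  simp only [extend, cutoff, Pi.add_apply, pb_apply, if_pos h2, h1]
  exact CharTwo.add_self_eq_zero _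

lemma oneDim_cell (he : IsCell e) : OneDim m Set.univ (cell e)ᶜ := by
  obtain ⟨ω, hω, hn, hall⟩ := oneDim_faces m m le_rfl
  refine ⟨extend e ω, hω.extend he, fun h => hn ?_, fun φ hφ => ?_⟩
  · exact Null.of_add (null_of_mem _ (pb_extend he hω.cc hω.rel)) (h.pb_symm he)
  · refine (hall _ (hφ.pb_symm he)).imp (fun h => h.of_pb_symm he hφ) fun h => ?_
    refine Null.of_pb_symm he (hφ.add (hω.extend he)) ?_
    rw [map_add]
    have h2 := h.add (null_of_mem _ (pb_extend he hω.cc hω.rel))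
    rwa [show pb e.symm φ + ω + (ω + pb e.symm (extend e ω)) =
      pb e.symm φ + pb e.symm (extend e ω) by grind] at h2

lemma acyc_cell {e : OpenPartialHomeomorph X (Fin (m + 1) → ℝ)} (he : IsCell e) :
    Acyc m Set.univ (cell e)ᶜ := fun _ hφ =>
  (acyc_faces (m + 1) m (by omega) _ (hφ.pb_symm he)).of_pb_symm he hφ

end Cells

section Subcells

variable {X : Type*} [TopologicalSpace X] {m : ℕ}

/-- The affine map taking the sup-norm ball of radius `ρ` around `c` to the unit box. -/
def affineBox (c : Fin m → ℝ) (ρ : ℝ) (hρ : 0 < ρ) : (Fin m → ℝ) ≃ₜ (Fin m → ℝ) where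
  toFun y i := (y i - c i) / (2 * ρ) + 1 / 2
  invFun y i := 2 * ρ * (y i - 1 / 2) + c i
  left_inv y := by ext i; field_simp; ring
  right_inv y := by ext i; field_simp; ring
  continuous_toFun := by fun_prop
  continuous_invFun := by fun_prop

/-- The subchart of a chart whose box is a given ball. -/
def subchart (e : OpenPartialHomeomorph X (Fin m → ℝ)) (c : Fin m → ℝ) (ρ : ℝ) (hρ : 0 < ρ) :
    OpenPartialHomeomorph X (Fin m → ℝ) := e.transHomeomorph (affineBox c ρ hρ)

variable {e : OpenPartialHomeomorph X (Fin m → ℝ)} {c : Fin m → ℝ} {ρ : ℝ} {hρ : 0 < ρ}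

lemma isCell_subchart (h : Metric.closedBall c ρ ⊆ e.target) : IsCell (subchart e c ρ hρ) := by
  intro y hy
  refine h ?_
  rw [Metric.mem_closedBall, dist_pi_le_iff hρ.le]
  intro i
  have h1 : dist (2 * ρ * (y i - 1 / 2) + c i) (c i) ≤ ρ := by
    rw [Real.dist_eq, abs_le]
    have := hy i
    rw [Set.mem_Icc] at this
    constructor <;> nlinarith
  exact h1

lemma mem_cell_subchart {x : X} :
    x ∈ cell (subchart e c ρ hρ) ↔ x ∈ e.source ∧ e x ∈ Metric.ball c ρ := by
  refine and_congr Iff.rfl ?_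
  rw [Metric.mem_ball, dist_pi_lt_iff hρ]
  refine forall_congr' fun i => ?_
  change 0 < (e x i - c i) / (2 * ρ) + 1 / 2 ∧ (e x i - c i) / (2 * ρ) + 1 / 2 < 1 ↔ _
  rw [Real.dist_eq, abs_lt, ← sub_lt_iff_lt_add, ← lt_sub_iff_add_lt, lt_div_iff₀ (by positivity),
    div_lt_iff₀ (by positivity)]
  constructor <;> rintro ⟨h1, h2⟩ <;> constructor <;> linarith

lemma exists_cell (e : OpenPartialHomeomorph X (Fin m → ℝ)) {x : X} (hx : x ∈ e.source)
    {O : Set X} (hO : O ∈ 𝓝 x) :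
    ∃ e' : OpenPartialHomeomorph X (Fin m → ℝ), IsCell e' ∧ x ∈ cell e' ∧ cell e' ⊆ O := by
  have h1 : e.target ∩ e.symm ⁻¹' O ∈ 𝓝 (e x) := by
    refine Filter.inter_mem (e.open_target.mem_nhds (e.map_source hx)) ?_
    refine e.continuousAt_symm (e.map_source hx) ?_
    rwa [e.left_inv hx]
  obtain ⟨ρ, hρ, h⟩ := Metric.nhds_basis_closedBall.mem_iff.1 h1
  refine ⟨subchart e (e x) ρ hρ, isCell_subchart fun y hy => (h hy).1,
    mem_cell_subchart.2 ⟨hx, Metric.mem_ball_self hρ⟩, fun z hz => ?_⟩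
  obtain ⟨hz1, hz2⟩ := mem_cell_subchart.1 hz
  have := (h (Metric.ball_subset_closedBall hz2)).2
  rwa [Set.mem_preimage, e.left_inv hz1] at this

/-- The piecewise affine map stretching a ball over the box. -/
def stretch (c : Fin m → ℝ) (ρ : ℝ) (y : Fin m → ℝ) : Fin m → ℝ :=
  fun i => max 0 (min 1 ((y i - c i) / (2 * ρ) + 1 / 2))

lemma continuous_stretch (c : Fin m → ℝ) (ρ : ℝ) : Continuous (stretch c ρ) := by
  unfold stretch
  fun_prop

lemma stretch_mem_box (c : Fin m → ℝ) (ρ : ℝ) (y : Fin m → ℝ) : stretch c ρ y ∈ box m :=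
  fun i => ⟨le_max_left _ _, by simp [stretch]⟩

lemma stretch_eq_zero (hρ : 0 < ρ) {y : Fin m → ℝ} {i : Fin m} (h : y i ≤ c i - ρ) :
    stretch c ρ y i = 0 := by
  have : (y i - c i) / (2 * ρ) + 1 / 2 ≤ 0 := by
    rw [← le_sub_iff_add_le, div_le_iff₀ (by positivity)]
    linarith
  exact max_eq_left ((min_le_right _ _).trans this)

lemma stretch_eq_one (hρ : 0 < ρ) {y : Fin m → ℝ} {i : Fin m} (h : c i + ρ ≤ y i) :
    stretch c ρ y i = 1 := by
  have : 1 ≤ (y i - c i) / (2 * ρ) + 1 / 2 := by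
    rw [← sub_le_iff_le_add, le_div_iff₀ (by positivity)]
    linarith
  simp only [stretch, min_eq_left this]
  simp

lemma ball_bounds (hρ : 0 < ρ) (h : Metric.closedBall c ρ ⊆ openBox m) (i : Fin m) :
    0 < c i - ρ ∧ c i + ρ < 1 := by
  constructor
  · refine (h (a := fun j => c j - ρ) ?_ i).1
    rw [Metric.mem_closedBall, dist_pi_le_iff hρ.le]
    intro j
    simp [abs_of_pos hρ]
  · refine (h (a := fun j => c j + ρ) ?_ i).2
    rw [Metric.mem_closedBall, dist_pi_le_iff hρ.le]
    intro j
    simp [abs_of_pos hρ]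

lemma stretch_homotopy (hρ : 0 < ρ) (h : Metric.closedBall c ρ ⊆ openBox m) {k : ℕ}
    {φ : Coch (Fin m → ℝ)} (hφ : Cyc k (box m) (faces m m) φ) :
    Null k (box m) (faces m m) (φ + pb (stretch c ρ) φ) := by
  have hb : ∀ t ∈ Set.Icc (0 : ℝ) 1, ∀ p ∈ box m, p + t • (stretch c ρ p - p) ∈ box m := by
    intro t ht p hp i
    have h1 := hp i
    have h2 := stretch_mem_box c ρ p i
    simp only [Set.mem_Icc, Pi.add_apply, Pi.smul_apply, Pi.sub_apply, smul_eq_mul] at *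
    constructor <;> nlinarith
  have := homotopy (G := fun t y => y + t • (stretch c ρ y - y))
    (by have := continuous_stretch c ρ; fun_prop) (isCompact_box m) (isCompact_faces m m) hb
    (fun t ht p hp => ?_) hφ
  · have h0 : (fun y => y + (0 : ℝ) • (stretch c ρ y - y)) = id := by
      funext y
      simp
    have h1 : (fun y => y + (1 : ℝ) • (stretch c ρ y - y)) = stretch c ρ := by
      funext y
      simp
    rwa [h0, h1, pb_id] at this
  · obtain ⟨hp, i, hi, hpi⟩ := hp
    refine ⟨hb t ht p hp, i, hi, ?_⟩
    have hbb := ball_bounds hρ h i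
    rcases hpi with h0 | h1
    · left
      simp [stretch_eq_zero hρ (h0.trans_le hbb.1.le), h0]
    · right
      simp [stretch_eq_one hρ (hbb.2.le.trans_eq h1.symm), h1]

lemma stretch_mem_faces (hρ : 0 < ρ) {y : Fin m → ℝ} (hy : y ∉ Metric.ball c ρ) :
    stretch c ρ y ∈ faces m m := by
  rw [Metric.mem_ball, dist_pi_lt_iff hρ] at hy
  push Not at hy
  obtain ⟨i, hi⟩ := hy
  refine ⟨stretch_mem_box c ρ y, i, i.isLt, ?_⟩
  rw [Real.dist_eq, le_abs] at hi
  rcases hi with hi | hi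
  · exact Or.inr (stretch_eq_one hρ (by linarith))
  · exact Or.inl (stretch_eq_zero hρ (by linarith))

lemma isPreconnected_cell (he : IsCell e) : IsPreconnected (cell e) := by
  rw [cell_eq_image he]
  refine IsPreconnected.image ?_ _
    fun y hy => (continuousAt_symm he (openBox_subset m hy)).continuousWithinAt
  refine Convex.isPreconnected ?_
  have : openBox m = Set.pi Set.univ fun _ => Set.Ioo (0 : ℝ) 1 := by
    ext y; simp [openBox]
  rw [this]
  exact convex_pi fun _ _ => convex_Ioo _ _

variable [T2Space X]

lemma exists_shrink (he : IsCell e) (h : Metric.closedBall c ρ ⊆ openBox m) {φ : Coch X} {k : ℕ}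
    (hφ : Cyc k Set.univ (cell e)ᶜ φ) : ∃ φ', Cyc k Set.univ (cell (subchart e c ρ hρ))ᶜ φ' ∧
      Null k Set.univ (cell e)ᶜ (φ + φ') := by
  have h0 := hφ.pb_symm he
  have hsf : Z (faces m m) ≤ (Z (Metric.ball c ρ)ᶜ).comap (pb (stretch c ρ)) := fun ψ hψ =>
    pb_mem_Z (fun _ _ => (continuous_stretch c ρ).continuousAt)
      (fun y hy => stretch_mem_faces hρ hy) hψ
  have hbo : faces m m ⊆ (Metric.ball c ρ)ᶜ := fun y hy hy' =>
    (mem_faces_iff hy.1).1 hy (h (Metric.ball_subset_closedBall hy'))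
  have h1 : Cyc k (box m) (faces m m) (pb (stretch c ρ) (pb e.symm φ)) :=
    ⟨pb_mem_Cc _ h0.cc, Z_anti hbo (hsf h0.rel), by
      rw [d_pb]
      exact pb_mem_Z (fun _ _ => (continuous_stretch c ρ).continuousAt)
        (fun y _ => stretch_mem_box c ρ y) h0.cyc⟩
  have h2 := h1.extend he
  refine ⟨extend e (pb (stretch c ρ) (pb e.symm φ)), ⟨h2.cc, ?_, h2.cyc⟩, ?_⟩
  · refine mem_Z_of_union h2.rel (extend_mem_cell (hsf h0.rel)) fun x hx => ?_
    by_cases hxe : x ∈ cell e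
    · exact Or.inr ⟨hxe, fun hb => hx (mem_cell_subchart.2 ⟨hxe.1, hb⟩)⟩
    · exact Or.inl hxe
  · have h3 := (stretch_homotopy hρ h h0).extend he (add_mem h0.cc h1.cc)
    rw [extend_add] at h3
    have h4 := (null_of_mem (k := k) (cell e)ᶜ (extend_pb he hφ.cc hφ.rel)).add h3
    rwa [show φ + extend e (pb e.symm φ) + (extend e (pb e.symm φ) +
      extend e (pb (stretch c ρ) (pb e.symm φ))) =
      φ + extend e (pb (stretch c ρ) (pb e.symm φ)) by grind] at h4

/-- Classes supported in a cell are represented in arbitrarily small subcells. -/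
lemma exists_subcell (he : IsCell e) {x : X} (hx : x ∈ cell e) {O : Set X} (hO : O ∈ 𝓝 x) :
    ∃ e' : OpenPartialHomeomorph X (Fin m → ℝ), IsCell e' ∧ x ∈ cell e' ∧ cell e' ⊆ O ∧
      cell e' ⊆ cell e ∧
      ∀ k φ, Cyc k Set.univ (cell e)ᶜ φ → ∃ φ', Cyc k Set.univ (cell e')ᶜ φ' ∧
        Null k Set.univ (cell e)ᶜ (φ + φ') := by
  have h1 : openBox m ∩ e.symm ⁻¹' O ∈ 𝓝 (e x) := by
    refine Filter.inter_mem ((isOpen_openBox m).mem_nhds hx.2) ?_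
    refine e.continuousAt_symm (e.map_source hx.1) ?_
    rwa [e.left_inv hx.1]
  obtain ⟨ρ, hρ, h⟩ := Metric.nhds_basis_closedBall.mem_iff.1 h1
  have hbox : Metric.closedBall (e x) ρ ⊆ openBox m := fun y hy => (h hy).1
  refine ⟨subchart e (e x) ρ hρ,
    isCell_subchart ((hbox.trans (openBox_subset m)).trans he),
    mem_cell_subchart.2 ⟨hx.1, Metric.mem_ball_self hρ⟩, fun z hz => ?_, fun z hz => ?_,
    fun k φ hφ => exists_shrink he hbox hφ⟩
  · obtain ⟨hz1, hz2⟩ := mem_cell_subchart.1 hz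
    have := (h (Metric.ball_subset_closedBall hz2)).2
    rwa [Set.mem_preimage, e.left_inv hz1] at this
  · obtain ⟨hz1, hz2⟩ := mem_cell_subchart.1 hz
    exact ⟨hz1, hbox (Metric.ball_subset_closedBall hz2)⟩

lemma dimLE_closedCell [T4Space X] (he : IsCell e) : DimLE (e.symm '' box m) m := by
  have hc : IsCompact (e.symm '' box m) := (isCompact_box m).image_of_continuousOn
    fun y hy => (continuousAt_symm he hy).continuousWithinAt
  refine dimLE_of_coords m hc.isClosed hc (fun i x => e x i) (fun i => ?_) ?_
  · refine (continuous_apply i).comp_continuousOn (e.continuousOn.mono ?_)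
    rintro _ ⟨y, hy, rfl⟩
    exact e.map_target (he hy)
  · rintro _ ⟨y, hy, rfl⟩ _ ⟨z, hz, rfl⟩ h
    have : e (e.symm y) = e (e.symm z) := funext h
    rw [e.right_inv (he hy), e.right_inv (he hz)] at this
    rw [this]

end Subcells

/-- Spaces locally homeomorphic to `ℝᵐ`. -/
def LocEuc (m : ℕ) (X : Type*) [TopologicalSpace X] : Prop :=
  ∀ x : X, ∃ e : OpenPartialHomeomorph X (Fin m → ℝ), x ∈ e.source

lemma LocEuc.exists_cell {m : ℕ} {X : Type*} [TopologicalSpace X] (h : LocEuc m X) {x : X}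
    {O : Set X} (hO : O ∈ 𝓝 x) :
    ∃ e : OpenPartialHomeomorph X (Fin m → ℝ), IsCell e ∧ x ∈ cell e ∧ cell e ⊆ O :=
  let ⟨e, he⟩ := h x
  AS.exists_cell e he hO

lemma LocEuc.dimLE {m : ℕ} {X : Type*} [TopologicalSpace X] [CompactSpace X] [T4Space X]
    (h : LocEuc m X) : DimLE (Set.univ : Set X) m := by
  choose e he hx _ using fun x : X => h.exists_cell (x := x) Filter.univ_mem
  obtain ⟨t, ht⟩ := isCompact_univ.elim_finite_subcover (fun x => cell (e x))
    (fun x => isOpen_cell _) fun x _ => Set.mem_iUnion.2 ⟨x, hx x⟩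
  have key : ∀ t : Finset X, DimLE (⋃ x ∈ t, (e x).symm '' box m) m ∧
      IsClosed (⋃ x ∈ t, (e x).symm '' box m) := by
    classical
    intro t
    induction t using Finset.induction_on with
    | empty => simpa using (dimLE_of_subsingleton Set.subsingleton_empty).mono le_rfl (Nat.zero_le m)
    | insert a s _ ih =>
      have hc : IsClosed ((e a).symm '' box m) := ((isCompact_box m).image_of_continuousOn
        fun y hy => (continuousAt_symm (he a) hy).continuousWithinAt).isClosed
      rw [Finset.set_biUnion_insert]
      exact ⟨(dimLE_closedCell (he a)).union hc ih.2 ih.1, hc.union ih.2⟩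
  refine (key t).1.mono (ht.trans (Set.iUnion₂_mono fun x _ => ?_)) le_rfl
  rw [cell_eq_image (he x)]
  exact Set.image_mono (openBox_subset m)

section Fundamental

variable {X : Type*} [TopologicalSpace X] {m : ℕ}

/-- Decomposition of a compactly supported top cocycle along an open cover. -/
lemma Cyc.exists_add [NormalSpace X] (hd : DimLE (Set.univ : Set X) m) {V Q : Set X}
    (hV : IsOpen V) (hQ : IsOpen Q) {φ : Coch X} (hφ : Cyc m Set.univ (V ∪ Q)ᶜ φ) :
    ∃ φ₁ φ₂, Cyc m Set.univ Vᶜ φ₁ ∧ Cyc m Set.univ Qᶜ φ₂ ∧ φ₁ + φ₂ = φ := by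
  obtain ⟨φ₁, h1, φ₂, h2, hs, z1, z2, -⟩ := split hV.isClosed_compl hQ.isClosed_compl hφ.cc
    (by rw [← Set.compl_union]; exact hφ.rel)
  have hc : Cyc (m + 1) Set.univ (Vᶜ ∪ Qᶜ) (d φ₁) := by
    refine ⟨d_mem_Cc h1, mem_Z_union (d_mem_Z z1) ?_, by simp⟩
    refine mem_of_eq (add_mem (Z_anti (Set.subset_univ _) hφ.cyc) (d_mem_Z z2)) ?_
    rw [← hs, map_add]
    grind
  obtain ⟨η, e1, e2, e3⟩ := hd Set.univ subset_rfl isClosed_univ _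
    (hV.isClosed_compl.union hQ.isClosed_compl) _ (Nat.lt_succ_self m) _ hc
  refine ⟨φ₁ + η, φ₂ + η, ⟨add_mem h1 e1, add_mem z1 (Z_anti Set.subset_union_left e2), ?_⟩,
    ⟨add_mem h2 e1, add_mem z2 (Z_anti Set.subset_union_right e2), ?_⟩, ?_⟩
  · rwa [map_add]
  · refine mem_of_eq (add_mem e3 hφ.cyc) ?_
    rw [← hs]
    simp only [map_add]
    grind
  · rw [← hs]
    grind

/-- Top cocycles are sums of cocycles supported in small sets. -/
lemma Cyc.induction [CompactSpace X] [NormalSpace X] (hd : DimLE (Set.univ : Set X) m)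
    {W : Set X} {P : Coch X → Prop} (h0 : ∀ φ ∈ Z Set.univ, P φ)
    (hadd : ∀ φ ψ, P φ → P ψ → P (φ + ψ))
    (hloc : ∀ x ∈ W, ∃ Q, IsOpen Q ∧ x ∈ Q ∧ ∀ φ, Cyc m Set.univ Qᶜ φ → P φ) {φ : Coch X}
    (hφ : Cyc m Set.univ Wᶜ φ) : P φ := by
  obtain ⟨O, hO, hWO, hφO⟩ := exists_open_mem_Z hφ.rel
  have key : ∃ U, IsOpen U ∧ Oᶜ ⊆ U ∧ ∀ φ, Cyc m Set.univ Uᶜ φ → P φ := by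
    refine hO.isClosed_compl.isCompact.induction_on
      (p := fun s => ∃ U, IsOpen U ∧ s ⊆ U ∧ ∀ φ, Cyc m Set.univ Uᶜ φ → P φ) ?_ ?_ ?_ ?_
    · exact ⟨∅, isOpen_empty, subset_rfl, fun φ hφ => h0 _ (by simpa using hφ.rel)⟩
    · exact fun s t hst ⟨U, h1, h2, h3⟩ => ⟨U, h1, hst.trans h2, h3⟩
    · rintro s t ⟨U, h1, h2, h3⟩ ⟨V, h1', h2', h3'⟩
      refine ⟨U ∪ V, h1.union h1', Set.union_subset_union h2 h2', fun φ hφ => ?_⟩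
      obtain ⟨φ₁, φ₂, c1, c2, rfl⟩ := hφ.exists_add hd h1 h1'
      exact hadd _ _ (h3 _ c1) (h3' _ c2)
    · intro x hx
      obtain ⟨Q, hQ, hxQ, hP⟩ := hloc x (by by_contra h; exact hx (hWO h))
      exact ⟨Q, mem_nhdsWithin_of_mem_nhds (hQ.mem_nhds hxQ), Q, hQ, subset_rfl, hP⟩
  obtain ⟨U, -, hU, h⟩ := key
  exact h φ ⟨hφ.cc, Z_anti (Set.compl_subset_comm.1 hU) hφO, hφ.cyc⟩

/-- Functionals on three subspaces which are compatible extend to the whole space. -/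
lemma exists_functional {V : Type*} [AddCommGroup V] [Module (ZMod 2) V]
    {C₁ C₂ D : Submodule (ZMod 2) V} {f₁ f₂ : V →ₗ[ZMod 2] ZMod 2}
    (h : ∀ p ∈ C₁, ∀ q ∈ C₂, p + q ∈ D → f₁ p = f₂ q) :
    ∃ f : V →ₗ[ZMod 2] ZMod 2, (∀ p ∈ C₁, f p = f₁ p) ∧ (∀ q ∈ C₂, f q = f₂ q) ∧
      ∀ r ∈ D, f r = 0 := by
  let T : (C₁ × C₂) × D →ₗ[ZMod 2] V := LinearMap.coprod (LinearMap.coprod C₁.subtype C₂.subtype)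
    D.subtype
  let g : (C₁ × C₂) × D →ₗ[ZMod 2] ZMod 2 := LinearMap.coprod
    (LinearMap.coprod (f₁ ∘ₗ C₁.subtype) (f₂ ∘ₗ C₂.subtype)) 0
  have hg : g ∈ LinearMap.range T.dualMap := by
    rw [LinearMap.range_dualMap_eq_dualAnnihilator_ker, Submodule.mem_dualAnnihilator]
    rintro ⟨⟨p, q⟩, r⟩ hk
    have h1 : (p : V) + q + r = 0 := hk
    have h2 : (p : V) + q = -r := eq_neg_of_add_eq_zero_left h1
    have h3 := h p p.2 q q.2 (h2 ▸ neg_mem r.2)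
    change f₁ p + f₂ q + 0 = 0
    rw [h3, add_zero]
    exact CharTwo.add_self_eq_zero _
  obtain ⟨f, hf⟩ := hg
  refine ⟨f, fun p hp => ?_, fun q hq => ?_, fun r hr => ?_⟩
  · have := LinearMap.congr_fun hf ((⟨p, hp⟩, 0), 0)
    simpa [T, g] using this
  · have := LinearMap.congr_fun hf ((0, ⟨q, hq⟩), 0)
    simpa [T, g] using this
  · have := LinearMap.congr_fun hf ((0, 0), ⟨r, hr⟩)
    simpa [T, g] using this

/-- A functional on top cochains which evaluates compactly supported top classes of an open set,
nontrivially on every cell. -/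
structure Fund (m : ℕ) (U : Set X) (Λ : Coch X →ₗ[ZMod 2] ZMod 2) : Prop where
  d_zero : ∀ ψ ∈ Cc X m, ψ ∈ Z Uᶜ → Λ (d ψ) = 0
  z_zero : ∀ φ ∈ Z Set.univ, Λ φ = 0
  null : ∀ e : OpenPartialHomeomorph X (Fin m → ℝ), IsCell e → cell e ⊆ U →
    ∀ ω, Cyc m Set.univ (cell e)ᶜ ω → Λ ω = 0 → Null m Set.univ (cell e)ᶜ ω

variable {U V W : Set X} {Λ J : Coch X →ₗ[ZMod 2] ZMod 2}

lemma Fund.eq_zero (h : Fund m U Λ) {φ : Coch X} (hn : Null m Set.univ Uᶜ φ) : Λ φ = 0 := by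
  obtain ⟨ψ, h1, h2, h3⟩ := hn
  have := h.z_zero _ h3
  rwa [map_add, h.d_zero ψ h1 h2, add_zero] at this

lemma Fund.mono (h : Fund m U Λ) (hV : V ⊆ U) : Fund m V Λ :=
  ⟨fun ψ h1 h2 => h.d_zero ψ h1 (Z_anti (Set.compl_subset_compl.2 hV) h2), h.z_zero,
    fun e he hc => h.null e he (hc.trans hV)⟩

lemma zmod_two_ne {a b : ZMod 2} : a ≠ b ↔ a + b = 1 := by revert a b; decide

lemma zmod_two_ne_zero {a : ZMod 2} : a ≠ 0 ↔ a = 1 := by revert a; decide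

lemma Fund.null_add (h : Fund m U Λ) {e : OpenPartialHomeomorph X (Fin m → ℝ)} (he : IsCell e)
    (hU : cell e ⊆ U) {ω ω' : Coch X} (h1 : Cyc m Set.univ (cell e)ᶜ ω)
    (h2 : Cyc m Set.univ (cell e)ᶜ ω') (hI : Λ ω = Λ ω') :
    Null m Set.univ (cell e)ᶜ (ω + ω') :=
  h.null e he hU _ (h1.add h2) (by rw [map_add, hI]; exact CharTwo.add_self_eq_zero _)

variable [T2Space X]

lemma Fund.exists_one (h : Fund m U Λ) {e : OpenPartialHomeomorph X (Fin m → ℝ)} (he : IsCell e)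
    (hU : cell e ⊆ U) : ∃ ω, Cyc m Set.univ (cell e)ᶜ ω ∧ Λ ω = 1 := by
  obtain ⟨ω, h1, h2, -⟩ := oneDim_cell he
  exact ⟨ω, h1, zmod_two_ne_zero.1 fun h0 => h2 (h.null e he hU ω h1 h0)⟩

lemma fund_cell {e : OpenPartialHomeomorph X (Fin m → ℝ)} (he : IsCell e) :
    ∃ Λ, Fund m (cell e) Λ := by
  obtain ⟨ω, h1, h2, h3⟩ := oneDim_cell he
  have hω : ω ∉ (Cc X m ⊓ Z (cell e)ᶜ).map d ⊔ Z Set.univ := by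
    intro h
    obtain ⟨_, ⟨ψ, ⟨hψ1, hψ2⟩, rfl⟩, z, hz, rfl⟩ := Submodule.mem_sup.1 h
    exact h2 ((null_d _ hψ1 hψ2).add (null_of_mem _ hz))
  obtain ⟨Λ, hne, hker⟩ := Submodule.exists_le_ker_of_notMem hω
  have hnull : ∀ φ, Null m Set.univ (cell e)ᶜ φ → Λ φ = 0 := by
    rintro φ ⟨ψ, y1, y2, y3⟩
    have ha : Λ (d ψ) = 0 := hker (Submodule.mem_sup_left ⟨ψ, ⟨y1, y2⟩, rfl⟩)
    have hb : Λ (φ + d ψ) = 0 := hker (Submodule.mem_sup_right y3)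
    rwa [map_add, ha, add_zero] at hb
  refine ⟨Λ, fun ψ y1 y2 => hnull _ (null_d _ y1 y2), fun φ hφ => hnull _ (null_of_mem _ hφ),
    fun e' he' hsub φ hφ hφ0 => ?_⟩
  rcases (cell e').eq_empty_or_nonempty with h0 | ⟨x, hx⟩
  · exact null_of_mem _ (by simpa [h0] using hφ.rel)
  obtain ⟨e'', -, -, hO, -, hc⟩ := exists_subcell he (hsub hx) ((isOpen_cell e').mem_nhds hx)
  obtain ⟨ω', hω', hωω'⟩ := hc m ω h1
  replace hω' := hω'.mono subset_rfl (Set.compl_subset_compl.2 hO)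
  have hcc := Set.compl_subset_compl.2 hsub
  have hne' : Λ ω' ≠ 0 := by
    intro h
    have := hnull _ hωω'
    rw [map_add, h, add_zero] at this
    exact hne this
  obtain ⟨ω₀, -, -, hall⟩ := oneDim_cell he'
  have hω₀ : Null m Set.univ (cell e')ᶜ (ω' + ω₀) :=
    (hall ω' hω').resolve_left fun h => hne' (hnull _ (h.mono subset_rfl hcc))
  refine (hall φ hφ).resolve_right fun h => hne' ?_
  have := hnull _ ((h.add hω₀).mono subset_rfl hcc)
  rw [show φ + ω₀ + (ω' + ω₀) = φ + ω' by grind, map_add, hφ0, zero_add] at this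
  exact this

variable [CompactSpace X]

lemma Fund.union (hd : DimLE (Set.univ : Set X) m) (hl : LocEuc m X) (hU : IsOpen U)
    (hV : IsOpen V) (h : Fund m U Λ) (h' : Fund m V J) : ∃ K, Fund m (U ∪ V) K := by
  have hIJ : ∀ φ, Cyc m Set.univ (U ∩ V)ᶜ φ → Λ φ = J φ := by
    intro φ hφ
    refine hφ.induction hd (P := fun φ => Λ φ = J φ) ?_ ?_ ?_
    · intro φ hφ
      rw [h.z_zero φ hφ, h'.z_zero φ hφ]
    · intro φ ψ h1 h2
      rw [map_add, map_add, h1, h2]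
    · intro x hx
      obtain ⟨e, he, hxe, heO⟩ := hl.exists_cell ((hU.inter hV).mem_nhds hx)
      refine ⟨cell e, isOpen_cell e, hxe, fun φ hφ => ?_⟩
      have hU' := Set.compl_subset_compl.2 (heO.trans Set.inter_subset_left)
      have hV' := Set.compl_subset_compl.2 (heO.trans Set.inter_subset_right)
      by_cases hn : Null m Set.univ (cell e)ᶜ φ
      · rw [h.eq_zero (hn.mono subset_rfl hU'), h'.eq_zero (hn.mono subset_rfl hV')]
      · rw [zmod_two_ne_zero.1 fun h0 => hn (h.null e he (heO.trans Set.inter_subset_left) φ hφ h0),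
          zmod_two_ne_zero.1 fun h0 => hn (h'.null e he (heO.trans Set.inter_subset_right) φ hφ h0)]
  let C : Set X → Submodule (ZMod 2) (Coch X) := fun W =>
    Cc X (m + 1) ⊓ Z Wᶜ ⊓ (Z Set.univ).comap d
  have hC : ∀ W φ, φ ∈ C W ↔ Cyc m Set.univ Wᶜ φ := fun W φ =>
    ⟨fun hφ => ⟨hφ.1.1, hφ.1.2, hφ.2⟩, fun hφ => ⟨⟨hφ.cc, hφ.rel⟩, hφ.cyc⟩⟩
  obtain ⟨K, hK1, hK2, hK3⟩ := exists_functional (C₁ := C U) (C₂ := C V) (f₁ := Λ) (f₂ := J)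
    (D := (Cc X m ⊓ Z (U ∪ V)ᶜ).map d ⊔ Z Set.univ) (by
      intro p hp q hq hpq
      rw [hC] at hp hq
      obtain ⟨_, ⟨ψ, ⟨hψ1, hψ2⟩, rfl⟩, z, hz, hzs⟩ := Submodule.mem_sup.1 hpq
      rw [SetLike.mem_coe, Set.compl_union] at hψ2
      obtain ⟨ψ₁, k1, ψ₂, k2, hs, z1, z2, -⟩ :=
        split hU.isClosed_compl hV.isClosed_compl hψ1 hψ2
      have hp' : p + d ψ₁ = q + d ψ₂ + z := by
        rw [← hs, map_add] at hzs
        grind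
      have hcyc : Cyc m Set.univ (U ∩ V)ᶜ (p + d ψ₁) := by
        refine ⟨add_mem hp.cc (d_mem_Cc k1), ?_, by simpa using hp.cyc⟩
        rw [Set.compl_inter]
        refine mem_Z_union (add_mem hp.rel (d_mem_Z z1)) ?_
        rw [hp']
        exact add_mem (add_mem hq.rel (d_mem_Z z2)) (Z_anti (Set.subset_univ _) hz)
      have h1 := hIJ _ hcyc
      nth_rewrite 2 [hp'] at h1
      simpa [h.d_zero ψ₁ k1 z1, h'.d_zero ψ₂ k2 z2, h'.z_zero z hz] using h1)
  refine ⟨K, fun ψ h1 h2 => hK3 _ (Submodule.mem_sup_left ⟨ψ, ⟨h1, h2⟩, rfl⟩),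
    fun φ hφ => hK3 _ (Submodule.mem_sup_right hφ), fun e he heU ω hω hω0 => ?_⟩
  have aux : ∀ {T Λ'} {x : X}, Fund m T Λ' → IsOpen T → (∀ φ ∈ C T, K φ = Λ' φ) → x ∈ cell e →
      x ∈ T → Null m Set.univ (cell e)ᶜ ω := by
    intro T Λ' x hI hT hK hxe hxT
    obtain ⟨e', he', hx', hT', hee, hsub⟩ := exists_subcell he hxe (hT.mem_nhds hxT)
    obtain ⟨φ', hφ', hn⟩ := hsub m ω hω
    have hcc := Set.compl_subset_compl.2 hee
    refine Null.of_add hn ((hI.null e' he' hT' φ' hφ' ?_).mono subset_rfl hcc)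
    rw [← hK φ' ((hC _ _).2 (hφ'.mono subset_rfl (Set.compl_subset_compl.2 hT')))]
    obtain ⟨ψ, y1, y2, y3⟩ := hn
    have := hK3 _ (Submodule.mem_sup_right y3)
    rwa [map_add, map_add, hω0, zero_add, hK3 (d ψ) (Submodule.mem_sup_left ⟨ψ, ⟨y1,
      Z_anti (Set.compl_subset_compl.2 heU) y2⟩, rfl⟩), add_zero] at this
  rcases (cell e).eq_empty_or_nonempty with h0 | ⟨x, hx⟩
  · exact null_of_mem _ (by simpa [h0] using hω.rel)
  · rcases heU hx with hxU | hxV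
    · exact aux h hU hK1 hx hxU
    · exact aux h' hV hK2 hx hxV

/-- A compact locally Euclidean Hausdorff space has a mod two fundamental class. -/
lemma exists_fund (hd : DimLE (Set.univ : Set X) m) (hl : LocEuc m X) :
    ∃ Λ : Coch X →ₗ[ZMod 2] ZMod 2, Fund m Set.univ Λ := by
  have key : ∃ U, IsOpen U ∧ (Set.univ : Set X) ⊆ U ∧ ∃ Λ, Fund m U Λ := by
    refine isCompact_univ.induction_on
      (p := fun s : Set X => ∃ U, IsOpen U ∧ s ⊆ U ∧ ∃ Λ, Fund m U Λ) ?_ ?_ ?_ ?_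
    · refine ⟨∅, isOpen_empty, subset_rfl, 0, fun _ _ _ => rfl, fun _ _ => rfl,
        fun e he h0 ω hω _ => ?_⟩
      rw [Set.subset_empty_iff] at h0
      exact null_of_mem _ (by simpa [h0] using hω.rel)
    · exact fun s t hst ⟨U, h1, h2, h3⟩ => ⟨U, h1, hst.trans h2, h3⟩
    · rintro s t ⟨U, h1, h2, Λ, h3⟩ ⟨V, h1', h2', J, h3'⟩
      exact ⟨U ∪ V, h1.union h1', Set.union_subset_union h2 h2', h3.union hd hl h1 h1' h3'⟩
    · intro x _
      obtain ⟨e, he, hxe, -⟩ := hl.exists_cell (x := x) Filter.univ_mem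
      exact ⟨cell e, mem_nhdsWithin_of_mem_nhds ((isOpen_cell e).mem_nhds hxe), cell e,
        isOpen_cell e, subset_rfl, fund_cell he⟩
  obtain ⟨U, -, hU, Λ, h⟩ := key
  exact ⟨Λ, h.mono hU⟩

end Fundamental

section DegreeOne

variable {X : Type*} [TopologicalSpace X]

/-- A function of two variables which is a one-cocycle near every point of `S`. -/
def CocOn (c : X → X → ZMod 2) (S : Set X) : Prop :=
  ∀ p ∈ S, ∃ U ∈ 𝓝 p, ∀ x ∈ U, ∀ y ∈ U, ∀ z ∈ U, dTwo c x y z = 0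

/-- The function `c` is the coboundary of `g` near every point of `S`. -/
def NullBy (c : X → X → ZMod 2) (g : X → ZMod 2) (S : Set X) : Prop :=
  ∀ p ∈ S, ∃ U ∈ 𝓝 p, ∀ x ∈ U, ∀ y ∈ U, c x y = g x + g y

/-- The function `c` is a coboundary near `S`. -/
def NullOn (c : X → X → ZMod 2) (S : Set X) : Prop := ∃ g, NullBy c g S

variable {c c' : X → X → ZMod 2} {g g' : X → ZMod 2} {S T : Set X}

lemma CocOn.mono (h : CocOn c S) (hT : T ⊆ S) : CocOn c T := fun p hp => h p (hT hp)

lemma NullBy.mono (h : NullBy c g S) (hT : T ⊆ S) : NullBy c g T := fun p hp => h p (hT hp)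

lemma NullOn.mono (h : NullOn c S) (hT : T ⊆ S) : NullOn c T := h.imp fun _ h => h.mono hT

lemma NullBy.add (h : NullBy c g S) (h' : NullBy c' g' S) : NullBy (c + c') (g + g') S := by
  intro p hp
  obtain ⟨U, hU, h1⟩ := h p hp
  obtain ⟨V, hV, h2⟩ := h' p hp
  refine ⟨U ∩ V, Filter.inter_mem hU hV, fun x hx y hy => ?_⟩
  simp only [Pi.add_apply, h1 x hx.1 y hy.1, h2 x hx.2 y hy.2]
  ring

lemma NullOn.add (h : NullOn c S) (h' : NullOn c' S) : NullOn (c + c') S :=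
  let ⟨_, h1⟩ := h
  let ⟨_, h2⟩ := h'
  ⟨_, h1.add h2⟩

lemma NullBy.cocOn (h : NullBy c g S) : CocOn c S := by
  intro p hp
  obtain ⟨U, hU, h1⟩ := h p hp
  refine ⟨U, hU, fun x hx y hy z hz => ?_⟩
  rw [dTwo, h1 x hx y hy, h1 y hy z hz, h1 x hx z hz]
  generalize g x = a
  generalize g y = b
  generalize g z = e
  revert a b e
  decide

lemma CocOn.add (h : CocOn c S) (h' : CocOn c' S) : CocOn (c + c') S := by
  intro p hp
  obtain ⟨U, hU, h1⟩ := h p hp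
  obtain ⟨V, hV, h2⟩ := h' p hp
  refine ⟨U ∩ V, Filter.inter_mem hU hV, fun x hx y hy z hz => ?_⟩
  have e1 := h1 x hx.1 y hy.1 z hz.1
  have e2 := h2 x hx.2 y hy.2 z hz.2
  rw [dTwo] at e1 e2 ⊢
  simp only [Pi.add_apply]
  linear_combination e1 + e2

lemma CocOn.exists_open (h : CocOn c S) : ∃ O, IsOpen O ∧ S ⊆ O ∧ CocOn c O := by
  refine ⟨{p | ∃ U ∈ 𝓝 p, ∀ x ∈ U, ∀ y ∈ U, ∀ z ∈ U, dTwo c x y z = 0}, ?_, h, fun p hp => hp⟩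
  rw [isOpen_iff_mem_nhds]
  rintro p ⟨U, hU, hv⟩
  filter_upwards [eventually_mem_nhds_iff.2 hU] with q hq using ⟨U, hq, hv⟩

lemma NullBy.exists_open (h : NullBy c g S) : ∃ O, IsOpen O ∧ S ⊆ O ∧ NullBy c g O := by
  refine ⟨{p | ∃ U ∈ 𝓝 p, ∀ x ∈ U, ∀ y ∈ U, c x y = g x + g y}, ?_, h, fun p hp => hp⟩
  rw [isOpen_iff_mem_nhds]
  rintro p ⟨U, hU, hv⟩
  filter_upwards [eventually_mem_nhds_iff.2 hU] with q hq using ⟨U, hq, hv⟩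

/-- A one-cocycle is locally the coboundary of its partial evaluation. -/
lemma CocOn.exists_nhds_nullBy (h : CocOn c S) {p : X} (hp : p ∈ S) :
    ∃ U, IsOpen U ∧ p ∈ U ∧ ∀ x ∈ U, ∀ y ∈ U, c x y = c p x + c p y := by
  obtain ⟨U, hU, h1⟩ := h p hp
  obtain ⟨V, hVU, hV, hpV⟩ := mem_nhds_iff.1 hU
  refine ⟨V, hV, hpV, fun x hx y hy => ?_⟩
  have := h1 p (hVU hpV) x (hVU hx) y (hVU hy)
  rw [dTwo] at this
  revert this
  generalize c x y = a
  generalize c p x = b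
  generalize c p y = e
  revert a b e
  decide

/-- Two primitives differ by a locally constant function. -/
lemma NullBy.const (h : NullBy c g S) (h' : NullBy c g' S) {p : X} (hp : p ∈ S) :
    ∃ U ∈ 𝓝 p, ∀ x ∈ U, g x + g' x = g p + g' p := by
  obtain ⟨U, hU, h1⟩ := h p hp
  obtain ⟨V, hV, h2⟩ := h' p hp
  refine ⟨U ∩ V, Filter.inter_mem hU hV, fun x hx => ?_⟩
  have e := (h1 x hx.1 p (mem_of_mem_nhds hU)).symm.trans (h2 x hx.2 p (mem_of_mem_nhds hV))
  revert e
  generalize g x = a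
  generalize g' x = b
  generalize g p = a'
  generalize g' p = b'
  revert a b a' b'
  decide

lemma NullBy.add_const (h : NullBy c g S) (a : ZMod 2) : NullBy c (fun x => g x + a) S := by
  intro p hp
  obtain ⟨U, hU, h1⟩ := h p hp
  refine ⟨U, hU, fun x hx y hy => ?_⟩
  rw [h1 x hx y hy]
  change g x + g y = g x + a + (g y + a)
  generalize g x = b
  generalize g y = e
  revert a b e
  decide

lemma NullBy.cup_add_mem (h : NullBy c g S) (φ : Coch X) :
    cup c φ + cup (fun x y => g x + g y) φ ∈ Z S := by
  intro p hp
  obtain ⟨U, hU, h1⟩ := h p hp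
  refine ⟨U, hU, fun l hl => ?_⟩
  match l with
  | [] => rfl
  | [_] => rfl
  | x :: y :: l =>
    simp only [Pi.add_apply, cup]
    rw [h1 x (hl x (by simp)) y (hl y (by simp))]
    exact CharTwo.add_self_eq_zero _

lemma CocOn.cupTwo_mem (h : CocOn c S) (φ : Coch X) : cupTwo (dTwo c) φ ∈ Z S := by
  intro p hp
  obtain ⟨U, hU, h1⟩ := h p hp
  refine ⟨U, hU, fun l hl => ?_⟩
  match l with
  | [] => rfl
  | [_] => rfl
  | [_, _] => rfl
  | x :: y :: z :: l =>
    simp only [cupTwo]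
    rw [h1 x (hl x (by simp)) y (hl y (by simp)) z (hl z (by simp)), zero_mul]

lemma cupTwo_mem_Z (e : X → X → X → ZMod 2) {φ : Coch X} (h : φ ∈ Z S) : cupTwo e φ ∈ Z S := by
  intro p hp
  obtain ⟨U, hU, hv⟩ := h p hp
  refine ⟨U, hU, fun l hl => ?_⟩
  match l with
  | [] => rfl
  | [_] => rfl
  | [_, _] => rfl
  | x :: y :: z :: l =>
    simp only [cupTwo]
    rw [hv (z :: l) fun w hw => hl w (by simp at hw ⊢; tauto), mul_zero]

lemma CocOn.d_cup_add_mem (h : CocOn c S) {φ : Coch X} {k : ℕ} (hk : φ ∈ Cc X k)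
    (hφ : φ ∈ Z T) : d (cup c φ) + cup c (d φ) ∈ Z (S ∪ T) := by
  rw [d_cup c φ (hk _ (Or.inr rfl)), add_assoc, add_self_coch, add_zero]
  exact mem_Z_union (h.cupTwo_mem φ) (cupTwo_mem_Z _ hφ)

lemma NullBy.d_fmul_mem (h : NullBy c g S) {φ : Coch X} {k : ℕ} (hk : φ ∈ Cc X k)
    (hφ : φ ∈ Z T) : d (fmul g φ) + fmul g (d φ) + cup c φ ∈ Z (S ∪ T) := by
  rw [d_fmul g φ (hk _ (Or.inr rfl))]
  have h1 := mem_Z_union (h.cup_add_mem φ)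
    (add_mem (cup_mem_Z c hφ) (cup_mem_Z (fun x y => g x + g y) hφ))
  exact mem_of_eq h1 (by grind)

end DegreeOne

section Duality

variable {X : Type*} [TopologicalSpace X] [CompactSpace X] [T2Space X] {m : ℕ} {W : Set X}
  {Λ : Coch X →ₗ[ZMod 2] ZMod 2}

/-- In a connected open set, classes are detected by the fundamental functional. -/
lemma Fund.null_of_connected (h : Fund m Set.univ Λ) (hd : DimLE (Set.univ : Set X) m)
    (hl : LocEuc m X) (hW : IsOpen W) (hc : IsPreconnected W) {φ : Coch X}
    (hφ : Cyc m Set.univ Wᶜ φ) (h0 : Λ φ = 0) : Null m Set.univ Wᶜ φ := by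
  rcases W.eq_empty_or_nonempty with rfl | ⟨x₀, hx₀⟩
  · exact null_of_mem _ (by simpa using hφ.rel)
  let R : X → X → Prop := fun x y => ∀ e e' : OpenPartialHomeomorph X (Fin m → ℝ), IsCell e →
    IsCell e' → x ∈ cell e → y ∈ cell e' → cell e ⊆ W → cell e' ⊆ W → ∀ ω ω',
    Cyc m Set.univ (cell e)ᶜ ω → Cyc m Set.univ (cell e')ᶜ ω' → Λ ω = 1 → Λ ω' = 1 →
    Null m Set.univ Wᶜ (ω + ω')
  have hR : ∀ x ∈ W, ∀ y ∈ W, R x y := by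
    intro x hx y hy
    refine hc.induction₂ R ?_ ?_ ?_ hx hy
    · intro x hx
      obtain ⟨e₀, he₀, hx0, hW0⟩ := hl.exists_cell (hW.mem_nhds hx)
      refine mem_nhdsWithin_of_mem_nhds (Filter.mem_of_superset ((isOpen_cell e₀).mem_nhds hx0) ?_)
      intro y hy e e' he he' hxe hye hWe hWe' ω ω' hω hω' h1 h1'
      have aux : ∀ (e : OpenPartialHomeomorph X (Fin m → ℝ)) (z : X), IsCell e → z ∈ cell e →
          z ∈ cell e₀ → cell e ⊆ W → ∀ ω, Cyc m Set.univ (cell e)ᶜ ω → Λ ω = 1 →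
          ∀ ω', Cyc m Set.univ (cell e₀)ᶜ ω' → Λ ω' = 1 → Null m Set.univ Wᶜ (ω + ω') := by
        intro e z he hz hz0 heW ω hω hω1 ω' hω' hω1'
        obtain ⟨e₁, he₁, hz1, hs⟩ := hl.exists_cell
          (((isOpen_cell e).inter (isOpen_cell e₀)).mem_nhds ⟨hz, hz0⟩)
        obtain ⟨ω₁, k1, k2⟩ := h.exists_one he₁ (Set.subset_univ _)
        have s1 := hs.trans Set.inter_subset_left
        have s2 := hs.trans Set.inter_subset_right
        have n1 := h.null_add he (Set.subset_univ _) hω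
          (k1.mono subset_rfl (Set.compl_subset_compl.2 s1)) (hω1.trans k2.symm)
        have n2 := h.null_add he₀ (Set.subset_univ _) hω'
          (k1.mono subset_rfl (Set.compl_subset_compl.2 s2)) (hω1'.trans k2.symm)
        have := (n1.mono subset_rfl (Set.compl_subset_compl.2 heW)).add
          (n2.mono subset_rfl (Set.compl_subset_compl.2 hW0))
        rwa [show ω + ω₁ + (ω' + ω₁) = ω + ω' by grind] at this
      obtain ⟨ω₀, k1, k2⟩ := h.exists_one he₀ (Set.subset_univ _)
      have := (aux e x he hxe hx0 hWe ω hω h1 ω₀ k1 k2).add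
        (aux e' y he' hye hy hWe' ω' hω' h1' ω₀ k1 k2)
      rwa [show ω + ω₀ + (ω' + ω₀) = ω + ω' by grind] at this
    · intro x y z _ hy _ hxy hyz e e' he he' hx' hz' hWe hWe' ω ω' hω hω' h1 h1'
      obtain ⟨e₀, he₀, hy0, hW0⟩ := hl.exists_cell (hW.mem_nhds hy)
      obtain ⟨ω₀, k1, k2⟩ := h.exists_one he₀ (Set.subset_univ _)
      have := (hxy e e₀ he he₀ hx' hy0 hWe hW0 ω ω₀ hω k1 h1 k2).add
        (hyz e₀ e' he₀ he' hy0 hz' hW0 hWe' ω₀ ω' k1 hω' k2 h1')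
      rwa [show ω + ω₀ + (ω₀ + ω') = ω + ω' by grind] at this
    · intro x y _ _ hxy e e' he he' hx' hz' hWe hWe' ω ω' hω hω' h1 h1'
      rw [add_comm]
      exact hxy e' e he' he hz' hx' hWe' hWe ω' ω hω' hω h1' h1
  obtain ⟨e₀, he₀, hxe₀, hW₀⟩ := hl.exists_cell (hW.mem_nhds hx₀)
  obtain ⟨ω₀, k1, k2⟩ := h.exists_one he₀ (Set.subset_univ _)
  have key : Null m Set.univ Wᶜ (φ + Λ φ • ω₀) := by
    refine hφ.induction hd (P := fun φ => Null m Set.univ Wᶜ (φ + Λ φ • ω₀)) ?_ ?_ ?_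
    · intro φ hφ
      rw [h.z_zero φ hφ, zero_smul, add_zero]
      exact null_of_mem _ hφ
    · intro φ ψ h1 h2
      have := h1.add h2
      rwa [show φ + Λ φ • ω₀ + (ψ + Λ ψ • ω₀) = φ + ψ + Λ (φ + ψ) • ω₀ by
        rw [map_add, add_smul]; abel] at this
    · intro x hx
      obtain ⟨e, he, hxe, hWe⟩ := hl.exists_cell (hW.mem_nhds hx)
      refine ⟨cell e, isOpen_cell e, hxe, fun φ hφ => ?_⟩
      by_cases hz : Λ φ = 0
      · rw [hz, zero_smul, add_zero]
        exact (h.null e he (Set.subset_univ _) φ hφ hz).mono subset_rfl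
          (Set.compl_subset_compl.2 hWe)
      · replace hz := zmod_two_ne_zero.1 hz
        rw [hz, one_smul]
        exact hR x hx x₀ hx₀ e e₀ he he₀ hxe hxe₀ hWe hW₀ φ ω₀ hφ k1 hz k2
  rwa [h0, zero_smul, add_zero] at key

/-- A degree one class of a connected open set is detected by cup products. -/
lemma Fund.exists_cup (h : Fund (m + 1) Set.univ Λ) (hd : DimLE (Set.univ : Set X) (m + 1))
    (hl : LocEuc (m + 1) X) (hW : IsOpen W) (hc : IsPreconnected W) {c : X → X → ZMod 2}
    (hcc : CocOn c W) (hn : ¬ NullOn c W) :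
    ∃ β, Cyc m Set.univ Wᶜ β ∧ Λ (cup c β) = 1 := by
  by_contra! hcon
  have hβ : ∀ β, Cyc m Set.univ Wᶜ β → Λ (cup c β) = 0 := fun β hβ => by
    by_contra h'
    exact hcon β hβ (zmod_two_ne_zero.1 h')
  apply hn
  rcases W.eq_empty_or_nonempty with rfl | ⟨x₀, hx₀⟩
  · exact ⟨0, fun p hp => hp.elim⟩
  obtain ⟨e₀, he₀, hxe₀, hW₀⟩ := hl.exists_cell (hW.mem_nhds hx₀)
  obtain ⟨ω₀, k1, k2⟩ := h.exists_one he₀ (Set.subset_univ _)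
  replace k1 := k1.mono subset_rfl (Set.compl_subset_compl.2 hW₀)
  have heta : ∀ ω, Cyc (m + 1) Set.univ Wᶜ ω → Λ ω = 1 → ∃ η ∈ Cc X (m + 1), η ∈ Z Wᶜ ∧
      ω + ω₀ + d η ∈ Z Set.univ := by
    intro ω hω h1
    refine h.null_of_connected hd hl hW hc (hω.add k1) ?_
    rw [map_add, h1, k2]
    exact CharTwo.add_self_eq_zero _
  have hcell : ∀ {e : OpenPartialHomeomorph X (Fin (m + 1) → ℝ)} {ω : Coch X}, cell e ⊆ W →
      Cyc (m + 1) Set.univ (cell e)ᶜ ω → Cyc (m + 1) Set.univ Wᶜ ω := fun he hω =>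
    hω.mono subset_rfl (Set.compl_subset_compl.2 he)
  have hindep : ∀ (e : OpenPartialHomeomorph X (Fin (m + 1) → ℝ)) b, IsCell e → cell e ⊆ W →
      NullBy c b (cell e) → ∀ ω ω' η η', Cyc (m + 1) Set.univ (cell e)ᶜ ω → Λ ω = 1 →
      Cyc (m + 1) Set.univ (cell e)ᶜ ω' → Λ ω' = 1 → η ∈ Cc X (m + 1) → η ∈ Z Wᶜ →
      η' ∈ Cc X (m + 1) → η' ∈ Z Wᶜ → ω + ω₀ + d η ∈ Z Set.univ → ω' + ω₀ + d η' ∈ Z Set.univ →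
      Λ (fmul b ω + cup c η) = Λ (fmul b ω' + cup c η') := by
    intro e b he heW hb ω ω' η η' hω h1 hω' h1' y1 y2 y1' y2' y3 y3'
    obtain ⟨θ, t1, t2, t3⟩ := h.null_add he (Set.subset_univ _) hω hω' (h1.trans h1'.symm)
    have e1 : Λ (cup c (η + η' + θ)) = 0 := by
      refine hβ _ ⟨add_mem (add_mem y1 y1') t1, add_mem (add_mem y2 y2')
        (Z_anti (Set.compl_subset_compl.2 heW) t2), ?_⟩
      refine mem_of_eq (add_mem (add_mem y3 y3') t3) ?_
      simp only [map_add]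
      grind
    have e2 := h.z_zero _ (fmul_mem_Z b t3)
    have e3 := hb.d_fmul_mem t1 t2
    rw [Set.union_compl_self] at e3
    replace e3 := h.z_zero _ e3
    have e4 := h.d_zero (fmul b θ) (fmul_mem_Cc b t1) (by simp [mem_Z])
    simp only [cup_add, fmul_add, map_add] at e1 e2 e3 ⊢
    grind
  let Good : OpenPartialHomeomorph X (Fin (m + 1) → ℝ) → (X → ZMod 2) → Prop := fun e b =>
    IsCell e ∧ cell e ⊆ W ∧ NullBy c b (cell e) ∧ ∀ ω η, Cyc (m + 1) Set.univ (cell e)ᶜ ω →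
      Λ ω = 1 → η ∈ Cc X (m + 1) → η ∈ Z Wᶜ → ω + ω₀ + d η ∈ Z Set.univ →
      Λ (fmul b ω + cup c η) = 0
  have fmul_const : ∀ ω ∈ Cc X (m + 2), ∀ a : ZMod 2, fmul (fun _ => a) ω = a • ω := by
    intro ω hω a
    funext l
    match l with
    | [] => simp [fmul, hω [] (Or.inr rfl)]
    | x :: l => rfl
  have hex : ∀ x ∈ W, ∃ e b, Good e b ∧ x ∈ cell e := by
    intro x hx
    obtain ⟨U, hU, hxU, hcU⟩ := hcc.exists_nhds_nullBy hx
    obtain ⟨e, he, hxe, hs⟩ := hl.exists_cell ((hU.inter hW).mem_nhds ⟨hxU, hx⟩)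
    have heW := hs.trans Set.inter_subset_right
    have hb : NullBy c (c x) (cell e) := fun p hp => ⟨U, hU.mem_nhds (hs hp).1, hcU⟩
    obtain ⟨ω, q1, q2⟩ := h.exists_one he (Set.subset_univ _)
    obtain ⟨η, z1, z2, z3⟩ := heta ω (hcell heW q1) q2
    refine ⟨e, fun y => c x y + Λ (fmul (c x) ω + cup c η), ⟨he, heW, hb.add_const _,
      fun ω' η' hω' h1' y1 y2 y3 => ?_⟩, hxe⟩
    have e1 := hindep e _ he heW hb ω ω' η η' q1 q2 hω' h1' z1 z2 y1 y2 z3 y3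
    have e2 : fmul (fun y => c x y + Λ (fmul (c x) ω + cup c η)) ω' =
        fmul (c x) ω' + Λ (fmul (c x) ω + cup c η) • ω' := by
      rw [← fmul_const ω' hω'.cc, ← add_fmul]
      rfl
    rw [e2, e1]
    simp only [map_add, map_smul, h1', smul_eq_mul]
    grind
  have huniq : ∀ e b e' b' x, Good e b → Good e' b' → x ∈ cell e → x ∈ cell e' → b x = b' x := by
    rintro e b e' b' x ⟨he, heW, hb, hg⟩ ⟨he', heW', hb', hg'⟩ hx hx'
    obtain ⟨U, hU, hconst⟩ := (hb.mono (Set.inter_subset_left (t := cell e'))).const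
      (hb'.mono Set.inter_subset_right) ⟨hx, hx'⟩
    obtain ⟨e₁, he₁, hx1, hs⟩ := hl.exists_cell (Filter.inter_mem hU
      (((isOpen_cell e).inter (isOpen_cell e')).mem_nhds ⟨hx, hx'⟩))
    obtain ⟨ω, q1, q2⟩ := h.exists_one he₁ (Set.subset_univ _)
    have s1 : cell e₁ ⊆ cell e := fun y hy => (hs hy).2.1
    have s2 : cell e₁ ⊆ cell e' := fun y hy => (hs hy).2.2
    obtain ⟨η, z1, z2, z3⟩ := heta ω (hcell (s1.trans heW) q1) q2
    have e1 := hg ω η (q1.mono subset_rfl (Set.compl_subset_compl.2 s1)) q2 z1 z2 z3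
    have e2 := hg' ω η (q1.mono subset_rfl (Set.compl_subset_compl.2 s2)) q2 z1 z2 z3
    have e3 : fmul (b + b') ω + (b x + b' x) • ω ∈ Z Set.univ := by
      rw [← fmul_const ω q1.cc, ← add_fmul]
      intro p _
      by_cases hp : p ∈ cell e₁
      · refine ⟨cell e₁, (isOpen_cell e₁).mem_nhds hp, fun l hl => ?_⟩
        match l with
        | [] => rfl
        | y :: l =>
          have := hconst y (hs (hl y (by simp))).1
          simp only [fmul, Pi.add_apply, this]
          rw [CharTwo.add_self_eq_zero, zero_mul]
      · exact fmul_mem_Z _ q1.rel p hp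
    replace e3 := h.z_zero _ e3
    rw [add_fmul] at e3
    simp only [map_add, map_smul, q2, smul_eq_mul] at e1 e2 e3
    by_contra hne
    rw [← ne_eq, zmod_two_ne] at hne
    rw [hne] at e3
    grind
  have : Nonempty (OpenPartialHomeomorph X (Fin (m + 1) → ℝ)) := ⟨e₀⟩
  choose! E B hgood hmem using hex
  refine ⟨fun x => B x x, fun p hp => ?_⟩
  obtain ⟨U, hU, hcU⟩ := (hgood p hp).2.2.1 p (hmem p hp)
  refine ⟨U ∩ cell (E p), Filter.inter_mem hU ((isOpen_cell _).mem_nhds (hmem p hp)),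
    fun x hx y hy => ?_⟩
  have hxW := (hgood p hp).2.1 hx.2
  have hyW := (hgood p hp).2.1 hy.2
  rw [hcU x hx.1 y hy.1, huniq _ _ _ _ x (hgood p hp) (hgood x hxW) hx.2 (hmem x hxW),
    huniq _ _ _ _ y (hgood p hp) (hgood y hyW) hy.2 (hmem y hyW)]

/-- Closed sets of codimension at least two do not separate. -/
lemma Fund.isPreconnected_diff (h : Fund (m + 1) Set.univ Λ)
    (hd : DimLE (Set.univ : Set X) (m + 1)) (hl : LocEuc (m + 1) X) (hW : IsOpen W)
    (hc : IsPreconnected W) {F : Set X} (hF : IsClosed F) {n : ℕ} (hFd : DimLE F n)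
    (hnm : n < m) : IsPreconnected (W \ F) := by
  rw [isPreconnected_iff_subset_of_disjoint]
  intro U V hU hV hUV hdis
  by_contra! hne
  obtain ⟨hn1, hn2⟩ := hne
  obtain ⟨v, hv, hvU⟩ := Set.not_subset.1 hn1
  obtain ⟨u, hu, huV⟩ := Set.not_subset.1 hn2
  have hWF : IsOpen (W \ F) := hW.sdiff hF
  have huU : u ∈ U := (hUV hu).resolve_right huV
  have hvV : v ∈ V := (hUV hv).resolve_left hvU
  obtain ⟨e, he, -, hs⟩ := hl.exists_cell ((hWF.inter hU).mem_nhds ⟨hu, huU⟩)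
  obtain ⟨e', he', -, hs'⟩ := hl.exists_cell ((hWF.inter hV).mem_nhds ⟨hv, hvV⟩)
  obtain ⟨ω, q1, q2⟩ := h.exists_one he (Set.subset_univ _)
  obtain ⟨ω', q1', q2'⟩ := h.exists_one he' (Set.subset_univ _)
  have hsW : cell e ⊆ W := fun y hy => (hs hy).1.1
  have hsW' : cell e' ⊆ W := fun y hy => (hs' hy).1.1
  obtain ⟨η, y1, y2, y3⟩ := h.null_of_connected hd hl hW hc
    ((q1.mono subset_rfl (Set.compl_subset_compl.2 hsW)).add
      (q1'.mono subset_rfl (Set.compl_subset_compl.2 hsW')))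
    (by rw [map_add, q2, q2']; exact CharTwo.add_self_eq_zero _)
  have hFe : F ⊆ (cell e)ᶜ := fun y hy hy' => (hs hy').1.2 hy
  have hFe' : F ⊆ (cell e')ᶜ := fun y hy hy' => (hs' hy').1.2 hy
  have hηF : Cyc m F Wᶜ η := by
    refine ⟨y1, y2, mem_of_eq (add_mem (add_mem (Z_anti (Set.subset_univ _) y3)
      (Z_anti hFe q1.rel)) (Z_anti hFe' q1'.rel)) ?_⟩
    grind
  obtain ⟨θ, t1, t2, t3⟩ := hFd F subset_rfl hF _ hW.isClosed_compl m hnm η hηF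
  set η' := η + d θ with hη'
  have hη'Z : η' ∈ Z (W \ F)ᶜ := by
    refine mem_Z_of_union (add_mem y2 (d_mem_Z t2)) t3 fun y hy => ?_
    by_contra hy'
    simp only [Set.mem_union, not_or, Set.notMem_compl_iff] at hy'
    exact hy ⟨hy'.1, hy'.2⟩
  have hη'c : η' ∈ Cc X (m + 1) := add_mem y1 (d_mem_Cc t1)
  classical
  let w : X → ZMod 2 := fun x => if x ∈ U then 1 else 0
  have hnw : NullBy (fun _ _ => 0) w (W \ F) := by
    intro p hp
    rcases hUV hp with hpU | hpV
    · refine ⟨U, hU.mem_nhds hpU, fun x hx y hy => ?_⟩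
      simp only [w, if_pos hx, if_pos hy]
      decide
    · have hnot : ∀ x ∈ V ∩ (W \ F), x ∉ U := fun x hx hxU => by
        have : x ∈ W \ F ∩ (U ∩ V) := ⟨hx.2, hxU, hx.1⟩
        rw [hdis] at this
        exact this
      refine ⟨V ∩ (W \ F), (hV.inter hWF).mem_nhds ⟨hpV, hp⟩, fun x hx y hy => ?_⟩
      simp [w, hnot x hx, hnot y hy]
  have e1 := hnw.d_fmul_mem hη'c hη'Z
  rw [Set.union_compl_self] at e1
  replace e1 := h.z_zero _ e1
  have e2 : cup (fun _ _ => 0) η' = 0 := by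
    funext l
    match l with
    | [] => rfl
    | [_] => rfl
    | _ :: _ :: _ => simp [cup]
  have e3 := h.z_zero _ (fmul_mem_Z w y3)
  have e4 : fmul w ω + ω ∈ Z Set.univ := by
    intro p _
    by_cases hp : p ∈ cell e
    · refine ⟨cell e, (isOpen_cell e).mem_nhds hp, fun l hl => ?_⟩
      match l with
      | [] => simp [fmul, q1.cc [] (Or.inr rfl)]
      | y :: l =>
        have : y ∈ U := (hs (hl y (by simp))).2
        simp only [fmul, Pi.add_apply, w, if_pos this, one_mul]
        exact CharTwo.add_self_eq_zero _
    · exact add_mem (fmul_mem_Z w q1.rel) q1.rel p hp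
  have e5 : fmul w ω' ∈ Z Set.univ := by
    intro p _
    by_cases hp : p ∈ cell e'
    · refine ⟨cell e', (isOpen_cell e').mem_nhds hp, fun l hl => ?_⟩
      match l with
      | [] => rfl
      | y :: l =>
        have hy := hs' (hl y (by simp))
        have : y ∉ U := fun hyU => by
          have : y ∈ W \ F ∩ (U ∩ V) := ⟨hy.1, hyU, hy.2⟩
          rw [hdis] at this
          exact this
        simp [fmul, w, this]
    · exact fmul_mem_Z w q1'.rel p hp
  replace e4 := h.z_zero _ e4
  replace e5 := h.z_zero _ e5
  have e6 := h.d_zero (fmul w η') (fmul_mem_Cc w hη'c) (by simp [mem_Z])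
  have e7 : d η' = d η := by simp [hη']
  rw [e2, e7] at e1
  simp only [fmul_add, map_add, map_zero, q2] at e1 e3 e4 e5 e6
  grind

/-- Criterion for a one-cocycle on the complement of a closed set in a cell to be trivial. -/
lemma Fund.nullOn_diff (h : Fund (m + 2) Set.univ Λ)
    (hd : DimLE (Set.univ : Set X) (m + 2)) (hl : LocEuc (m + 2) X)
    {F : Set X} (hF : IsClosed F) (hFd : DimLE F m)
    {e : OpenPartialHomeomorph X (Fin (m + 2) → ℝ)} (he : IsCell e) {c : X → X → ZMod 2}
    (hc : CocOn c (cell e \ F))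
    (hα : ∀ α ∈ Cc X (m + 1), α ∈ Z (cell e)ᶜ → d α ∈ Z F → Λ (cup c (d α)) = 0) :
    NullOn c (cell e \ F) := by
  by_contra hn
  obtain ⟨β, hβ, h1⟩ := h.exists_cup hd hl ((isOpen_cell e).sdiff hF)
    (h.isPreconnected_diff hd hl (isOpen_cell e) (isPreconnected_cell he) hF hFd (by omega)) hc hn
  obtain ⟨α, a1, a2, a3⟩ := acyc_cell he β
    (hβ.mono subset_rfl (Set.compl_subset_compl.2 Set.sdiff_subset))
  have h2 : d α ∈ Z F := by
    refine mem_of_eq (add_mem (Z_anti (Set.subset_univ _) a3)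
      (Z_anti (fun y hy hy' => hy'.2 hy) hβ.rel)) (b := d α) (by grind)
  have h3 := hα α a1 a2 h2
  have h4 := h.z_zero _ (cup_mem_Z c a3)
  rw [cup_add, map_add, h1, h3] at h4
  exact absurd h4 (by decide)

end Duality

lemma add_self_fun {X : Type*} (c : X → X → ZMod 2) : c + c = 0 := by
  funext x y
  exact CharTwo.add_self_eq_zero _

section Toolbox

variable {X Y : Type*} [TopologicalSpace X] [TopologicalSpace Y]
  {c c' : X → X → ZMod 2} {g g' : X → ZMod 2} {S T A B : Set X}

/-- The pullback of a function of two variables. -/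
def pull (f : Y → X) (c : X → X → ZMod 2) : Y → Y → ZMod 2 := fun x y => c (f x) (f y)

lemma NullBy.pull {f : Y → X} {S' : Set Y} (h : NullBy c g S) (hf : ∀ p ∈ S', ContinuousAt f p)
    (hm : Set.MapsTo f S' S) : NullBy (pull f c) (g ∘ f) S' := by
  intro p hp
  obtain ⟨U, hU, h1⟩ := h (f p) (hm hp)
  exact ⟨f ⁻¹' U, hf p hp hU, fun x hx y hy => h1 _ hx _ hy⟩

lemma NullOn.pull {f : Y → X} {S' : Set Y} (h : NullOn c S) (hf : ∀ p ∈ S', ContinuousAt f p)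
    (hm : Set.MapsTo f S' S) : NullOn (pull f c) S' :=
  let ⟨_, h⟩ := h
  ⟨_, h.pull hf hm⟩

lemma CocOn.pull {f : Y → X} {S' : Set Y} (h : CocOn c S) (hf : ∀ p ∈ S', ContinuousAt f p)
    (hm : Set.MapsTo f S' S) : CocOn (pull f c) S' := by
  intro p hp
  obtain ⟨U, hU, h1⟩ := h (f p) (hm hp)
  exact ⟨f ⁻¹' U, hf p hp hU, fun x hx y hy z hz => h1 _ hx _ hy _ hz⟩

lemma CocOn.union (h : CocOn c S) (h' : CocOn c T) : CocOn c (S ∪ T) := fun p hp =>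
  hp.elim (h p) (h' p)

lemma NullOn.add_cancel (h : NullOn (c + c') S) (h' : NullOn c' S) : NullOn c S := by
  have := h.add h'
  rwa [add_assoc, add_self_fun, add_zero] at this

lemma CocOn.add_cancel (h : CocOn (c + c') S) (h' : CocOn c' S) : CocOn c S := by
  have := h.add h'
  rwa [add_assoc, add_self_fun, add_zero] at this

lemma CocOn.self_eq_zero (h : CocOn c S) {p : X} (hp : p ∈ S) : c p p = 0 := by
  obtain ⟨U, hU, h1⟩ := h p hp
  have := h1 p (mem_of_mem_nhds hU) p (mem_of_mem_nhds hU) p (mem_of_mem_nhds hU)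
  rw [dTwo] at this
  revert this
  generalize c p p = a
  revert a
  decide

lemma CocOn.exists_nullBy (h : CocOn c S) {p : X} (hp : p ∈ S) :
    ∃ U, IsOpen U ∧ p ∈ U ∧ NullBy c (c p) U :=
  let ⟨U, hU, hpU, h1⟩ := h.exists_nhds_nullBy hp
  ⟨U, hU, hpU, fun _ hq => ⟨U, hU.mem_nhds hq, h1⟩⟩

lemma CocOn.nullOn_of_subsingleton (h : CocOn c S) (hS : S.Subsingleton) : NullOn c S := by
  rcases S.eq_empty_or_nonempty with rfl | ⟨p, hp⟩
  · exact ⟨0, fun p hp => hp.elim⟩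
  · obtain ⟨U, -, hpU, h1⟩ := h.exists_nullBy hp
    exact ⟨_, h1.mono fun x hx => hS hp hx ▸ hpU⟩

/-- On a connected set two primitives differ by a constant. -/
lemma NullBy.const_of_preconnected (h : NullBy c g S) (h' : NullBy c g' S)
    (hS : IsPreconnected S) {x y : X} (hx : x ∈ S) (hy : y ∈ S) : g x + g' x = g y + g' y := by
  refine hS.induction₂ (fun x y => g x + g' x = g y + g' y) (fun x hx => ?_)
    (fun x y z _ _ _ h1 h2 => h1.trans h2) (fun x y _ _ h => h.symm) hx hy
  obtain ⟨U, hU, h1⟩ := h.const h' hx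
  exact mem_nhdsWithin_of_mem_nhds (Filter.mem_of_superset hU fun y hy => (h1 y hy).symm)

lemma NullBy.eq_of_preconnected (h : NullBy c g S) (h' : NullBy c g' S)
    (hS : IsPreconnected S) {x y : X} (hx : x ∈ S) (hy : y ∈ S) (he : g x = g' x) :
    g y = g' y := by
  have := h.const_of_preconnected h' hS hx hy
  rw [he, CharTwo.add_self_eq_zero] at this
  revert this
  generalize g y = a
  generalize g' y = b
  revert a b
  decide

/-- Primitives may be normalised at a point. -/
lemma NullOn.exists_eq_zero (h : NullOn c S) (x : X) : ∃ g, NullBy c g S ∧ g x = 0 := by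
  obtain ⟨g, hg⟩ := h
  exact ⟨_, hg.add_const (g x), CharTwo.add_self_eq_zero _⟩

/-- Preimages of connected sets under closed maps with connected fibres are connected. -/
lemma isPreconnected_preimage {f : X → Y} (hf : IsClosedMap f) {K : Set Y}
    (hK : IsPreconnected K) (hfib : ∀ t ∈ K, IsConnected (f ⁻¹' {t})) :
    IsPreconnected (f ⁻¹' K) := by
  rw [isPreconnected_iff_subset_of_disjoint]
  intro U V hU hV hUV hdis
  have hfU : ∀ t ∈ K, f ⁻¹' {t} ⊆ U ∨ f ⁻¹' {t} ⊆ V := by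
    intro t ht
    have hsub : f ⁻¹' {t} ⊆ f ⁻¹' K := Set.preimage_mono (Set.singleton_subset_iff.2 ht)
    refine isPreconnected_iff_subset_of_disjoint.1 (hfib t ht).isPreconnected U V hU hV
      (hsub.trans hUV) ?_
    rw [← Set.subset_empty_iff, ← hdis]
    exact Set.inter_subset_inter_left _ hsub
  have hmem : ∀ (W : Set X) (t : Y), t ∈ (f '' Wᶜ)ᶜ ↔ f ⁻¹' {t} ⊆ W := by
    intro W t
    constructor
    · intro h x hx
      by_contra hxW
      exact h ⟨x, hxW, hx⟩
    · rintro h ⟨x, hx, hxt⟩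
      exact hx (h hxt)
  have := isPreconnected_iff_subset_of_disjoint.1 hK (f '' Uᶜ)ᶜ (f '' Vᶜ)ᶜ
    (hf _ hU.isClosed_compl).isOpen_compl (hf _ hV.isClosed_compl).isOpen_compl
    (fun t ht => (hfU t ht).imp (hmem U t).2 (hmem V t).2) (by
      rw [← Set.subset_empty_iff]
      rintro t ⟨ht, h1, h2⟩
      obtain ⟨x, hx⟩ := (hfib t ht).nonempty
      have hxK : x ∈ f ⁻¹' K := by
        rw [Set.mem_preimage, Set.mem_singleton_iff.1 hx]
        exact ht
      have : x ∈ f ⁻¹' K ∩ (U ∩ V) := ⟨hxK, (hmem U t).1 h1 hx, (hmem V t).1 h2 hx⟩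
      rw [hdis] at this
      exact this)
  exact this.imp (fun h x hx => (hmem U _).1 (h hx) rfl) fun h x hx => (hmem V _).1 (h hx) rfl

/-- Two closed sets are separated away from a neighbourhood of their intersection. -/
lemma exists_separation [NormalSpace X] (hA : IsClosed A) (hB : IsClosed B) {N : Set X}
    (hN : IsOpen N) (h : A ∩ B ⊆ N) : ∃ P Q : Set X, IsOpen P ∧ IsOpen Q ∧ A ⊆ P ∪ N ∧
      B ⊆ Q ∪ N ∧ Disjoint P Q := by
  obtain ⟨P, Q, hP, hQ, h1, h2, h3⟩ := normal_separation (hA.sdiff hN) (hB.sdiff hN) (by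
    rw [Set.disjoint_left]
    rintro x ⟨hx, hxN⟩ ⟨hx', -⟩
    exact hxN (h ⟨hx, hx'⟩))
  exact ⟨P, Q, hP, hQ, fun x hx => or_iff_not_imp_right.2 fun h => h1 ⟨hx, h⟩,
    fun x hx => or_iff_not_imp_right.2 fun h => h2 ⟨hx, h⟩, h3⟩

lemma nullOn_union [NormalSpace X] (hA : IsClosed A) (hB : IsClosed B)
    (hAB : IsPreconnected (A ∩ B)) (h : NullOn c A) (h' : NullOn c B) : NullOn c (A ∪ B) := by
  classical
  have key : ∃ g g', NullBy c g A ∧ NullBy c g' B ∧ ∀ x ∈ A ∩ B, g x = g' x := by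
    rcases (A ∩ B).eq_empty_or_nonempty with he | ⟨x₀, hx₀⟩
    · obtain ⟨g, hg⟩ := h
      obtain ⟨g', hg'⟩ := h'
      exact ⟨g, g', hg, hg', by simp [he]⟩
    · obtain ⟨g, hg, h0⟩ := h.exists_eq_zero x₀
      obtain ⟨g', hg', h0'⟩ := h'.exists_eq_zero x₀
      exact ⟨g, g', hg, hg', fun x hx => (hg.mono Set.inter_subset_left).eq_of_preconnected
        (hg'.mono Set.inter_subset_right) hAB hx₀ hx (h0.trans h0'.symm)⟩
  obtain ⟨g, g', hg, hg', he⟩ := key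
  obtain ⟨P, Q, hP, hQ, hAP, hBQ, hPQ⟩ := exists_separation hA hB
    (isOpen_interior (s := {x | g x = g' x})) (fun x hx => by
      obtain ⟨U, hU, h1⟩ := (hg.mono Set.inter_subset_left).const
        (hg'.mono Set.inter_subset_right) hx
      refine mem_interior_iff_mem_nhds.2 (Filter.mem_of_superset hU fun y hy => ?_)
      have := h1 y hy
      rw [he x hx, CharTwo.add_self_eq_zero] at this
      exact CharTwo.add_eq_zero.1 this)
  refine ⟨fun x => if x ∈ P then g x else g' x, fun p hp => ?_⟩
  have hN : ∀ U ∈ 𝓝 p, p ∈ interior {x | g x = g' x} → ∀ h : X → ZMod 2, (h = g ∨ h = g') →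
      (∀ x ∈ U, ∀ y ∈ U, c x y = h x + h y) → ∃ U ∈ 𝓝 p, ∀ x ∈ U, ∀ y ∈ U,
      c x y = (if x ∈ P then g x else g' x) + (if y ∈ P then g y else g' y) := by
    intro U hU hpN h hh h1
    refine ⟨U ∩ interior {x | g x = g' x}, Filter.inter_mem hU (isOpen_interior.mem_nhds hpN),
      fun x hx y hy => ?_⟩
    have hx' : x ∈ {x | g x = g' x} := interior_subset hx.2
    have hy' : y ∈ {x | g x = g' x} := interior_subset hy.2
    rw [Set.mem_ofPred_eq] at hx' hy'
    rw [h1 x hx.1 y hy.1, hx', hy', ite_self, ite_self]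
    rcases hh with rfl | rfl
    · rw [hx', hy']
    · rfl
  rcases hp with hpA | hpB
  · obtain ⟨U, hU, h1⟩ := hg p hpA
    rcases hAP hpA with hpP | hpN
    · refine ⟨U ∩ P, Filter.inter_mem hU (hP.mem_nhds hpP), fun x hx y hy => ?_⟩
      simp only [if_pos hx.2, if_pos hy.2]
      exact h1 x hx.1 y hy.1
    · exact hN U hU hpN g (Or.inl rfl) h1
  · obtain ⟨U, hU, h1⟩ := hg' p hpB
    rcases hBQ hpB with hpQ | hpN
    · refine ⟨U ∩ Q, Filter.inter_mem hU (hQ.mem_nhds hpQ), fun x hx y hy => ?_⟩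
      simp only [if_neg fun h => Set.disjoint_left.1 hPQ h hx.2,
        if_neg fun h => Set.disjoint_left.1 hPQ h hy.2]
      exact h1 x hx.1 y hy.1
    · exact hN U hU hpN g' (Or.inr rfl) h1

/-- Gluing of one-cocycles over closed sets. -/
lemma exists_glue [NormalSpace X] (hA : IsClosed A) (hB : IsClosed B) (ha : CocOn c A)
    (hb : CocOn c' B) (h : NullOn (c + c') (A ∩ B)) :
    ∃ k, CocOn k (A ∪ B) ∧ NullOn (k + c) A ∧ NullOn (k + c') B := by
  classical
  obtain ⟨u, hu⟩ := h
  obtain ⟨N, hN, hABN, huN⟩ := hu.exists_open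
  obtain ⟨P, Q, hP, hQ, hAP, hBQ, hPQ⟩ := exists_separation hA hB hN hABN
  let k : X → X → ZMod 2 := fun x y => if x ∈ P then c x y else c' x y + u x + u y
  have hNk : ∀ p ∈ N, ∃ U ∈ 𝓝 p, ∀ x ∈ U, ∀ y ∈ U, k x y = c x y ∧ k x y + c' x y = u x + u y := by
    intro p hp
    obtain ⟨U, hU, h1⟩ := huN p hp
    refine ⟨U, hU, fun x hx y hy => ?_⟩
    have := h1 x hx y hy
    simp only [Pi.add_apply, k] at this ⊢
    split_ifs <;> grind
  have hk1 : NullBy (k + c) 0 A := by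
    intro p hp
    rcases hAP hp with hpP | hpN
    · refine ⟨P, hP.mem_nhds hpP, fun x hx y hy => ?_⟩
      simp only [Pi.add_apply, k, if_pos hx, CharTwo.add_self_eq_zero, Pi.zero_apply]
    · obtain ⟨U, hU, h1⟩ := hNk p hpN
      refine ⟨U, hU, fun x hx y hy => ?_⟩
      simp only [Pi.add_apply, (h1 x hx y hy).1, CharTwo.add_self_eq_zero, Pi.zero_apply]
  have hk2 : NullBy (k + c') u B := by
    intro p hp
    rcases hBQ hp with hpQ | hpN
    · refine ⟨Q, hQ.mem_nhds hpQ, fun x hx y hy => ?_⟩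
      simp only [Pi.add_apply, k, if_neg fun h => Set.disjoint_left.1 hPQ h hx]
      grind
    · obtain ⟨U, hU, h1⟩ := hNk p hpN
      exact ⟨U, hU, fun x hx y hy => (h1 x hx y hy).2⟩
  exact ⟨k, (hk1.cocOn.add_cancel ha).union (hk2.cocOn.add_cancel hb), ⟨_, hk1⟩, ⟨_, hk2⟩⟩

/-- A class which is trivial on the connected slices of a compact set is trivial. -/
lemma nullOn_of_slices [NormalSpace X] (hA : IsClosed A) (hAc : IsCompact A) {f : X → ℝ}
    (hf : Continuous f) (hs : ∀ t, IsPreconnected (A ∩ f ⁻¹' {t}))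
    (h : ∀ t, NullOn c (A ∩ f ⁻¹' {t})) : NullOn c A := by
  rcases A.eq_empty_or_nonempty with rfl | hne
  · exact ⟨0, fun p hp => hp.elim⟩
  obtain ⟨a, -, ha⟩ := hAc.exists_isMinOn hne hf.continuousOn
  obtain ⟨b, -, hb⟩ := hAc.exists_isMaxOn hne hf.continuousOn
  have key := real_continuation (P := fun t => NullOn c (A ∩ f ⁻¹' Set.Iic t)) (a := f a - 1)
    (fun u v huv h => h.mono fun x hx => ⟨hx.1, le_trans hx.2 huv⟩)
    ⟨0, fun p hp => absurd ((show f a ≤ f p from ha hp.1).trans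
      (show f p ≤ f a - 1 from hp.2)) (by linarith)⟩ ?_ (f b)
  · exact key.mono fun x hx => ⟨hx, hb hx⟩
  intro t
  obtain ⟨g, hg⟩ := h t
  obtain ⟨O, hO, hsub, hgO⟩ := hg.exists_open
  obtain ⟨ε, hε, h1⟩ := exists_forall_dist_lt hAc hf.continuousOn hO
    (fun x hx hxt => hsub ⟨hx, hxt⟩)
  refine ⟨ε, hε, fun u v hu huv hv hPu => ?_⟩
  have h2 : NullOn c (A ∩ f ⁻¹' Set.Icc u v) := ⟨g, hgO.mono fun x hx => h1 x hx.1 (by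
    have := hx.2.1
    have := hx.2.2
    rw [abs_lt]
    constructor <;> linarith)⟩
  refine (nullOn_union (hA.inter (isClosed_Iic.preimage hf)) (hA.inter (isClosed_Icc.preimage hf))
    ?_ hPu h2).mono ?_
  · convert hs u using 1
    ext x
    simp only [Set.mem_inter_iff, Set.mem_preimage, Set.mem_Iic, Set.mem_Icc,
      Set.mem_singleton_iff]
    constructor
    · rintro ⟨⟨h1, h2⟩, -, h3, h4⟩
      exact ⟨h1, le_antisymm h2 h3⟩
    · rintro ⟨h1, h2⟩
      exact ⟨⟨h1, h2.le⟩, h1, h2.ge, h2.le.trans huv⟩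
  · rintro x ⟨hx, hxv⟩
    rcases le_total (f x) u with h | h
    · exact Or.inl ⟨hx, h⟩
    · exact Or.inr ⟨hx, h, hxv⟩

end Toolbox

section Planar

variable {X : Type*} [TopologicalSpace X] [CompactSpace X] [T2Space X]
  {c : X → X → ZMod 2} {f : X → ℂ} {K : Set ℂ}

/-- A class over a compact convex planar set which is trivial on all fibres is trivial. -/
lemma nullOn_preimage_of_fibers (hf : Continuous f) (hK : IsCompact K) (hc : Convex ℝ K)
    (hfib : ∀ t ∈ K, IsConnected (f ⁻¹' {t})) (h : ∀ t ∈ K, NullOn c (f ⁻¹' {t})) :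
    NullOn c (f ⁻¹' K) := by
  have hcl : ∀ K' ⊆ K, IsClosed K' → Convex ℝ K' → IsPreconnected (f ⁻¹' K') :=
    fun K' hK' _ hc' => isPreconnected_preimage hf.isClosedMap hc'.isPreconnected
      fun t ht => hfib t (hK' ht)
  have hre : ∀ t : ℝ, IsClosed (K ∩ {z | z.re = t}) ∧ Convex ℝ (K ∩ {z | z.re = t}) := fun t =>
    ⟨hK.isClosed.inter (isClosed_eq Complex.continuous_re continuous_const),
      hc.inter (convex_hyperplane Complex.reLm.isLinear t)⟩
  refine nullOn_of_slices (hK.isClosed.preimage hf) (hK.isClosed.preimage hf).isCompact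
    (f := fun x => (f x).re) (by fun_prop)
    (fun t => hcl _ Set.inter_subset_left (hre t).1 (hre t).2) fun t => ?_
  have hcl' := (hre t).1.preimage hf
  refine nullOn_of_slices (A := f ⁻¹' (K ∩ {z | z.re = t})) hcl' hcl'.isCompact
    (f := fun x => (f x).im) (by fun_prop) (fun s => ?_) (fun s => ?_)
  · exact hcl (K ∩ {z | z.re = t} ∩ {z | z.im = s})
      (Set.inter_subset_left.trans Set.inter_subset_left)
      ((hre t).1.inter (isClosed_eq Complex.continuous_im continuous_const))
      ((hre t).2.inter (convex_hyperplane Complex.imLm.isLinear s))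
  · by_cases hts : (⟨t, s⟩ : ℂ) ∈ K
    · refine (h _ hts).mono fun x hx => ?_
      exact Complex.ext hx.1.2 hx.2
    · exact ⟨0, fun p hp => (hts (by
        rw [← show f p = ⟨t, s⟩ from Complex.ext hp.1.2 hp.2]
        exact hp.1.1)).elim⟩

/-- The open version of `nullOn_preimage_of_fibers`. -/
lemma nullOn_preimage_of_isOpen (hf : Continuous f) (hK : IsOpen K) (hc : Convex ℝ K)
    (hfib : ∀ t ∈ K, IsConnected (f ⁻¹' {t})) (h : ∀ t ∈ K, NullOn c (f ⁻¹' {t})) :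
    NullOn c (f ⁻¹' K) := by
  rcases K.eq_empty_or_nonempty with rfl | ⟨t₀, ht₀⟩
  · exact ⟨0, fun p hp => hp.elim⟩
  obtain ⟨x₀, hx₀⟩ := (hfib t₀ ht₀).nonempty
  rw [Set.mem_preimage, Set.mem_singleton_iff] at hx₀
  have hseg : ∀ t ∈ K, segment ℝ t₀ t ⊆ K := fun t ht => hc.segment_subset ht₀ ht
  have hcomp : ∀ t, IsCompact (segment ℝ t₀ t) := fun t => by
    rw [segment_eq_image_lineMap]
    exact isCompact_Icc.image (AffineMap.lineMap_continuous)
  have hex : ∀ t ∈ K, ∃ g, NullBy c g (f ⁻¹' segment ℝ t₀ t) ∧ g x₀ = 0 := fun t ht =>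
    (nullOn_preimage_of_fibers hf (hcomp t) (convex_segment _ _)
      (fun s hs => hfib s (hseg t ht hs)) fun s hs => h s (hseg t ht hs)).exists_eq_zero x₀
  choose! G hG hG0 using hex
  refine ⟨fun x => G (f x) x, fun p hp => ?_⟩
  obtain ⟨δ, hδ, hsub⟩ := (hcomp (f p)).exists_cthickening_subset_open hK (hseg _ hp)
  set C := Metric.cthickening δ (segment ℝ t₀ (f p))
  have hCc : IsCompact C := (hcomp _).cthickening
  have hCv : Convex ℝ C := (convex_segment _ _).cthickening δ
  have htC : t₀ ∈ C := Metric.self_subset_cthickening _ (left_mem_segment ℝ _ _)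
  obtain ⟨g, hg, hg0⟩ := (nullOn_preimage_of_fibers (c := c) hf hCc hCv
    (fun s hs => hfib s (hsub hs)) fun s hs => h s (hsub hs)).exists_eq_zero x₀
  have heq : ∀ x, f x ∈ C → G (f x) x = g x := by
    intro x hx
    have hs : f ⁻¹' segment ℝ t₀ (f x) ⊆ f ⁻¹' C := Set.preimage_mono (hCv.segment_subset htC hx)
    refine (hG (f x) (hsub hx)).eq_of_preconnected (hg.mono hs)
      (isPreconnected_preimage hf.isClosedMap (convex_segment _ _).isPreconnected
        fun s hs => hfib s (hseg _ (hsub hx) hs)) (x := x₀) ?_ ?_ ((hG0 _ (hsub hx)).trans hg0.symm)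
    · rw [Set.mem_preimage, hx₀]
      exact left_mem_segment ℝ _ _
    · exact right_mem_segment ℝ _ _
  have hpC : f ⁻¹' C ∈ 𝓝 p := by
    refine hf.continuousAt (Filter.mem_of_superset (Metric.ball_mem_nhds (f p) hδ) ?_)
    exact (Metric.ball_subset_closedBall).trans
      (Metric.closedBall_subset_cthickening (right_mem_segment ℝ _ _) δ)
  obtain ⟨U, hU, h1⟩ := hg p (mem_of_mem_nhds hpC)
  refine ⟨U ∩ f ⁻¹' C, Filter.inter_mem hU hpC, fun x hx y hy => ?_⟩
  simp only [heq x hx.2, heq y hy.2]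
  exact h1 x hx.1 y hy.1

end Planar

section Thin

variable {X : Type*} [TopologicalSpace X] {c : X → X → ZMod 2} {g : X → ZMod 2} {N F : Set X}

/-- A set which does not locally separate and has empty interior. -/
def Thin (F : Set X) : Prop :=
  ∀ p, ∀ U ∈ 𝓝 p, ∃ W ⊆ U, IsOpen W ∧ p ∈ W ∧ IsPreconnected (W \ F) ∧ (W \ F).Nonempty

lemma CocOn.exists_extend (h : CocOn c N) (hN : IsOpen N) (hF : Thin F) (hg : NullBy c g (N \ F)) :
    ∃ g', NullBy c g' N ∧ ∀ x ∈ N \ F, g' x = g x := by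
  have hex : ∀ p ∈ N, ∃ W ⊆ N, IsOpen W ∧ p ∈ W ∧ (W \ F).Nonempty ∧
      (∀ x ∈ W, ∀ y ∈ W, c x y = c p x + c p y) ∧
      ∀ x ∈ W \ F, ∀ y ∈ W \ F, g x + c p x = g y + c p y := by
    intro p hp
    obtain ⟨U, hU, hpU, h1⟩ := h.exists_nhds_nullBy hp
    obtain ⟨W, hWU, hW, hpW, hc, hne⟩ := hF p (U ∩ N)
      (Filter.inter_mem (hU.mem_nhds hpU) (hN.mem_nhds hp))
    refine ⟨W, hWU.trans Set.inter_subset_right, hW, hpW, hne,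
      fun x hx y hy => h1 x (hWU hx).1 y (hWU hy).1, fun x hx y hy => ?_⟩
    have hn : NullBy c (c p) (W \ F) := fun q hq => ⟨U, hU.mem_nhds (hWU hq.1).1, h1⟩
    exact (hg.mono (Set.sdiff_subset_sdiff_left (hWU.trans Set.inter_subset_right))).const_of_preconnected
      hn hc hx hy
  choose! W hWN hW hpW hne hcW hconst using hex
  classical
  have : ∀ p, ∃ y, p ∈ N → y ∈ W p \ F := fun p => by
    by_cases hp : p ∈ N
    · exact (hne p hp).imp fun y hy _ => hy
    · exact ⟨p, fun h => (hp h).elim⟩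
  choose Y hY using this
  refine ⟨fun p => g (Y p) + c p (Y p), fun p hp => ⟨W p, (hW p hp).mem_nhds (hpW p hp), ?_⟩,
    fun x hx => ?_⟩
  · have key : ∀ x ∈ W p, g (Y x) + c x (Y x) = g (Y p) + c p (Y p) + c p x := by
      intro x hx
      have hxN := hWN p hp hx
      obtain ⟨V, hVU, hV, hxV, -, z, hz⟩ := hF x (W x ∩ W p)
        (((hW x hxN).inter (hW p hp)).mem_nhds ⟨hpW x hxN, hx⟩)
      have e1 := hconst x hxN _ (hY x hxN) z ⟨(hVU hz.1).1, hz.2⟩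
      have e2 := hconst p hp _ (hY p hp) z ⟨(hVU hz.1).2, hz.2⟩
      have e3 := hcW p hp x hx z (hVU hz.1).2
      grind
    intro x hx y hy
    simp only [key x hx, key y hy, hcW p hp x hx y hy]
    grind
  · have e := hconst x hx.1 _ (hY x hx.1) x ⟨hpW x hx.1, hx.2⟩
    simp only [e, h.self_eq_zero hx.1, add_zero]

end Thin

section Glue

variable {X : Type*} [TopologicalSpace X] {N : Set X}

/-- Gluing of one-cocycles over countable open covers. -/
lemma exists_glue_open (O C : ℕ → Set X) (hO : ∀ k, IsOpen (O k)) (hC : ∀ k, IsClosed (C k))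
    (hCO : ∀ k, C k ⊆ O k) (hN : ∀ x ∈ N, ∃ k, x ∈ interior (C k))
    (c : ℕ → X → X → ZMod 2) (g : ℕ → ℕ → X → ZMod 2) (hc : ∀ k, CocOn (c k) (O k ∩ N))
    (hNo : IsOpen N)
    (hg : ∀ k l, NullBy (c k + c l) (g k l) (O k ∩ O l ∩ N))
    (hcoc : ∀ k l m, ∀ x ∈ O k ∩ O l ∩ O m ∩ N, g k l x + g l m x = g k m x) :
    ∃ b, CocOn b N ∧ ∀ k, NullOn (b + c k) (O k ∩ N) := by
  classical
  have hN' : ∀ x ∈ N, ∃ k, x ∈ C k := fun x hx => (hN x hx).imp fun k h => interior_subset h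
  let j : X → ℕ := fun x => if h : ∃ k, x ∈ C k then Nat.find h else 0
  have hj : ∀ x ∈ N, x ∈ C (j x) := fun x hx => by
    simp only [j, dif_pos (hN' x hx)]
    exact Nat.find_spec (hN' x hx)
  have hjle : ∀ x k, x ∈ C k → j x ≤ k := fun x k h => by
    simp only [j, dif_pos (show ∃ k, x ∈ C k from ⟨k, h⟩)]
    exact Nat.find_min' _ h
  let b : X → X → ZMod 2 := fun x y => c (j x) x y + g (j x) (j y) y
  have key : ∀ k, NullBy (b + c k) (fun x => g (j x) k x) (O k ∩ N) := by
    intro k p hp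
    obtain ⟨m, hm⟩ := hN p hp.2
    have hfin : ∀ i ∈ Finset.range (m + 1), ∃ U ∈ 𝓝 p, ((∃ x ∈ U, x ∈ C i) → ∀ x ∈ U, x ∈ O i ∩ O k ∩ N ∧ ∀ y ∈ U, y ∈ O i ∧
          c i x y + c k x y = g i k x + g i k y) := by
      intro i _
      by_cases hpi : p ∈ C i
      · obtain ⟨U, hU, h1⟩ := hg i k p ⟨⟨hCO i hpi, hp.1⟩, hp.2⟩
        refine ⟨U ∩ (O i ∩ O k ∩ N), Filter.inter_mem hU ((((hO i).inter (hO k)).inter hNo).mem_nhds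
          ⟨⟨hCO i hpi, hp.1⟩, hp.2⟩), fun _ x hx => ⟨hx.2, fun y hy => ⟨hy.2.1.1, h1 x hx.1 y hy.1⟩⟩⟩
      · exact ⟨(C i)ᶜ, (hC i).isOpen_compl.mem_nhds hpi, fun ⟨x, hx, h⟩ => (hx h).elim⟩
    choose! U hU hU2 using hfin
    refine ⟨(⋂ i ∈ Finset.range (m + 1), U i) ∩ (interior (C m) ∩ N), Filter.inter_mem
      ((Filter.biInter_finset_mem _).2 hU)
      ((isOpen_interior.inter hNo).mem_nhds ⟨hm, hp.2⟩), fun x hx y hy => ?_⟩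
    have hr : ∀ z ∈ interior (C m) ∩ N, j z ∈ Finset.range (m + 1) := fun z hz =>
      Finset.mem_range_succ_iff.2 (hjle z m (interior_subset hz.1))
    have hxU := Set.mem_iInter₂.1 hx.1
    have hyU := Set.mem_iInter₂.1 hy.1
    obtain ⟨hx1, hx2⟩ := hU2 _ (hr x hx.2) ⟨x, hxU _ (hr x hx.2), hj x hx.2.2⟩ x
      (hxU _ (hr x hx.2))
    obtain ⟨hy1, hy2⟩ := hx2 y (hyU _ (hr x hx.2))
    have hyO : y ∈ O (j y) := hCO _ (hj y hy.2.2)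
    obtain ⟨hy3, -⟩ := hU2 _ (hr x hx.2) ⟨x, hxU _ (hr x hx.2), hj x hx.2.2⟩ y
      (hyU _ (hr x hx.2))
    have e := hcoc (j x) (j y) k y ⟨⟨⟨hy1, hyO⟩, hy3.1.2⟩, hy.2.2⟩
    simp only [Pi.add_apply, b]
    grind
  refine ⟨b, fun p hp => ?_, fun k => ⟨_, key k⟩⟩
  obtain ⟨k, hk⟩ := hN' p hp
  exact ((key k).cocOn.add_cancel (hc k)) p ⟨hCO k hk, hp⟩

end Glue

section Holonomy

variable {X : Type*} [TopologicalSpace X] {c : X → X → ZMod 2}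

lemma CocOn.nullOn_interval {c : I → I → ZMod 2} (h : CocOn c Set.univ) : NullOn c Set.univ := by
  have hs : ∀ t : ℝ, (Set.univ ∩ (fun s : I => (s : ℝ)) ⁻¹' {t}).Subsingleton :=
    fun t x hx y hy => Subtype.ext (hx.2.trans hy.2.symm)
  exact nullOn_of_slices isClosed_univ isCompact_univ continuous_subtype_val
    (fun t => (hs t).isPreconnected)
    fun t => (h.mono (Set.subset_univ _)).nullOn_of_subsingleton (hs t)

lemma CocOn.nullOn_square {c : I × I → I × I → ZMod 2} (h : CocOn c Set.univ) :
    NullOn c Set.univ := by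
  have hcl : ∀ t : ℝ, IsClosed (Set.univ ∩ (fun s : I × I => (s.2 : ℝ)) ⁻¹' {t}) := fun t =>
    isClosed_univ.inter (isClosed_singleton.preimage (by fun_prop))
  refine nullOn_of_slices (f := fun s : I × I => (s.2 : ℝ)) isClosed_univ isCompact_univ
    (by fun_prop) (fun t => ?_) fun t => ?_
  · rcases (Set.univ ∩ (fun s : I × I => (s.2 : ℝ)) ⁻¹' {t}).eq_empty_or_nonempty with he | ⟨s, hs⟩
    · rw [he]
      exact isPreconnected_empty
    · convert isPreconnected_range (f := fun r : I => (r, s.2)) (by fun_prop) using 1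
      ext r
      simp only [Set.univ_inter, Set.mem_preimage, Set.mem_singleton_iff, Set.mem_range] at hs ⊢
      constructor
      · intro hr
        exact ⟨r.1, Prod.ext rfl (Subtype.ext (hs.trans hr.symm))⟩
      · rintro ⟨r, rfl⟩
        exact hs
  · have hsub : ∀ r : ℝ, ((Set.univ ∩ (fun s : I × I => (s.2 : ℝ)) ⁻¹' {t}) ∩
        (fun s : I × I => (s.1 : ℝ)) ⁻¹' {r}).Subsingleton := fun r x hx y hy =>
      Prod.ext (Subtype.ext (hx.2.trans hy.2.symm)) (Subtype.ext (hx.1.2.trans hy.1.2.symm))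
    exact nullOn_of_slices (hcl t) (hcl t).isCompact (f := fun s : I × I => (s.1 : ℝ))
      (by fun_prop) (fun r => (hsub r).isPreconnected)
      fun r => (h.mono (Set.subset_univ _)).nullOn_of_subsingleton (hsub r)

/-- The holonomy of a one-cocycle along a path. -/
def Hol (c : X → X → ZMod 2) {x y : X} (γ : Path x y) (a : ZMod 2) : Prop :=
  ∃ G : I → ZMod 2, NullBy (pull γ c) G Set.univ ∧ G 0 + G 1 = a

lemma CocOn.exists_hol (h : CocOn c Set.univ) {x y : X} (γ : Path x y) : ∃ a, Hol c γ a :=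
  let ⟨G, hG⟩ := (h.pull (f := γ) (fun _ _ => γ.continuous.continuousAt)
    (Set.mapsTo_univ _ _)).nullOn_interval
  ⟨_, G, hG, rfl⟩

lemma Hol.unique {x y : X} {γ : Path x y} {a b : ZMod 2} (h : Hol c γ a) (h' : Hol c γ b) :
    a = b := by
  obtain ⟨G, hG, rfl⟩ := h
  obtain ⟨G', hG', rfl⟩ := h'
  have := hG.const_of_preconnected hG' isPreconnected_univ (Set.mem_univ 0) (Set.mem_univ 1)
  grind

lemma Hol.trans {x y z : X} {γ : Path x y} {δ : Path y z} {a b e : ZMod 2}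
    (h : Hol c (γ.trans δ) a) (h1 : Hol c γ b) (h2 : Hol c δ e) : a = b + e := by
  obtain ⟨G, hG, rfl⟩ := h
  let l : I → I := fun t => ⟨t / 2, by linarith [t.2.1], by linarith [t.2.2]⟩
  let r : I → I := fun t => ⟨(t + 1) / 2, by linarith [t.2.1], by linarith [t.2.2]⟩
  have hl : Continuous l := by fun_prop
  have hr : Continuous r := by fun_prop
  have el : ∀ t, (γ.trans δ) (l t) = γ t := by
    intro t
    rw [Path.trans_apply, dif_pos (by simp only [l]; linarith [t.2.2])]
    congr 1
    ext
    simp only [l]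
    ring
  have er : ∀ t, (γ.trans δ) (r t) = δ t := by
    intro t
    rw [Path.trans_apply]
    split_ifs with ht
    · simp only [r] at ht
      have h0 : t = 0 := Subtype.ext (by
        rw [Set.Icc.coe_zero]
        linarith [t.2.1])
      subst h0
      have : (⟨2 * (r 0 : ℝ), (unitInterval.mul_pos_mem_iff zero_lt_two).2
        ⟨(r 0).2.1, ht⟩⟩ : I) = 1 := Subtype.ext (by simp [r])
      rw [this]
      simp
    · congr 1
      ext
      simp only [r]
      ring
  have k1 : Hol c γ (G 0 + G (l 1)) := by
    refine ⟨G ∘ l, ?_, ?_⟩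
    · have := hG.pull (f := l) (S' := Set.univ) (fun p _ => hl.continuousAt)
        (fun _ _ => Set.mem_univ _)
      convert this using 1
      funext s t
      simp only [AS.pull, el]
    · have : l 0 = 0 := Subtype.ext (by simp [l])
      simp [this]
  have k2 : Hol c δ (G (r 0) + G 1) := by
    refine ⟨G ∘ r, ?_, ?_⟩
    · have := hG.pull (f := r) (S' := Set.univ) (fun p _ => hr.continuousAt)
        (fun _ _ => Set.mem_univ _)
      convert this using 1
      funext s t
      simp only [AS.pull, er]
    · have : r 1 = 1 := Subtype.ext (by simp [r])
      simp [this]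
  have hlr : l 1 = r 0 := Subtype.ext (by simp [l, r])
  rw [h1.unique k1, h2.unique k2, hlr]
  grind

lemma CocOn.hol_eq (h : CocOn c Set.univ) {x y : X} {γ δ : Path x y} (H : γ.Homotopy δ)
    {a b : ZMod 2} (h1 : Hol c γ a) (h2 : Hol c δ b) : a = b := by
  obtain ⟨G, hG⟩ := (h.pull (f := H) (fun p _ => H.continuous.continuousAt)
    (Set.mapsTo_univ _ _)).nullOn_square
  have side : ∀ t : I, NullBy (AS.pull (fun s : I => (H (s, t) : X)) c) (fun s => G (s, t))
      Set.univ := fun t =>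
    hG.pull (f := fun s : I => (s, t)) (fun p _ => Continuous.continuousAt (by fun_prop))
      (Set.mapsTo_univ _ _)
  have line : ∀ s : I, NullBy (AS.pull (fun t : I => (H (s, t) : X)) c) (fun t => G (s, t))
      Set.univ := fun s =>
    hG.pull (f := fun t : I => (s, t)) (fun p _ => Continuous.continuousAt (by fun_prop))
      (Set.mapsTo_univ _ _)
  have e0 : G (0, 0) = G (1, 0) := by
    have hz : NullBy (AS.pull (fun s : I => (H (s, 0) : X)) c) (fun _ => 0) Set.univ :=
      fun p _ => ⟨Set.univ, Filter.univ_mem, fun s _ t _ => by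
        simp [AS.pull, h.self_eq_zero (Set.mem_univ x)]⟩
    have := (side 0).const_of_preconnected hz isPreconnected_univ (Set.mem_univ 0) (Set.mem_univ 1)
    simpa using this
  have e1 : G (0, 1) = G (1, 1) := by
    have hz : NullBy (AS.pull (fun s : I => (H (s, 1) : X)) c) (fun _ => 0) Set.univ :=
      fun p _ => ⟨Set.univ, Filter.univ_mem, fun s _ t _ => by
        simp [AS.pull, h.self_eq_zero (Set.mem_univ y)]⟩
    have := (side 1).const_of_preconnected hz isPreconnected_univ (Set.mem_univ 0) (Set.mem_univ 1)
    simpa using this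
  have k1 : Hol c γ (G (0, 0) + G (0, 1)) := by
    refine ⟨fun t => G (0, t), ?_, rfl⟩
    convert line 0 using 1
    funext s t
    simp [AS.pull]
  have k2 : Hol c δ (G (1, 0) + G (1, 1)) := by
    refine ⟨fun t => G (1, t), ?_, rfl⟩
    convert line 1 using 1
    funext s t
    simp [AS.pull]
  rw [h1.unique k1, h2.unique k2, e0, e1]

/-- One-cocycles on simply connected spaces are coboundaries. -/
lemma CocOn.nullOn_of_simplyConnected [SimplyConnectedSpace X] [LocallyPathConnectedSpace X]
    (h : CocOn c Set.univ) : NullOn c Set.univ := by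
  obtain ⟨x₀⟩ : Nonempty X := inferInstance
  have γ : ∀ x, Path x₀ x := fun x => (PathConnectedSpace.joined x₀ x).somePath
  choose u hu using fun x => h.exists_hol (γ x)
  refine ⟨u, fun p _ => ?_⟩
  obtain ⟨U, hU, hpU, hcU⟩ := h.exists_nhds_nullBy (Set.mem_univ p)
  obtain ⟨W, ⟨hW, hWc⟩, hWU⟩ := (path_connected_basis p).mem_iff.1 (hU.mem_nhds hpU)
  have key : ∀ x ∈ W, u x = u p + c p x := by
    intro x hx
    obtain ⟨δ, hδ⟩ := hWc.joinedIn p (mem_of_mem_nhds hW) x hx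
    have h1 : Hol c δ (c p x) := by
      refine ⟨fun t => c p (δ t), fun q _ => ⟨Set.univ, Filter.univ_mem, fun s _ t _ =>
        hcU _ (hWU (hδ s)) _ (hWU (hδ t))⟩, ?_⟩
      simp [h.self_eq_zero (Set.mem_univ p)]
    obtain ⟨a, ha⟩ := h.exists_hol ((γ p).trans δ)
    obtain ⟨H⟩ := SimplyConnectedSpace.paths_homotopic (γ x) ((γ p).trans δ)
    rw [h.hol_eq H (hu x) ha, ha.trans (hu p) h1]
  refine ⟨W, hW, fun x hx y hy => ?_⟩
  rw [key x hx, key y hy, hcU x (hWU hx) y (hWU hy)]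
  grind

end Holonomy

section Extension

variable {X : Type*} [TopologicalSpace X] [T2Space X] {m : ℕ}
  {Λ : Coch X →ₗ[ZMod 2] ZMod 2} {c : X → X → ZMod 2} {F : Set X}

lemma Fund.not_subset (h : Fund (m + 1) Set.univ Λ) {n : ℕ} (hFd : DimLE F n) (hF : IsClosed F)
    (hnm : n < m + 1) {e : OpenPartialHomeomorph X (Fin (m + 1) → ℝ)} (he : IsCell e) :
    (cell e \ F).Nonempty := by
  rw [Set.sdiff_nonempty]
  intro hs
  obtain ⟨ω, h1, h2⟩ := h.exists_one he (Set.subset_univ _)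
  obtain ⟨ψ, t1, t2, t3⟩ := hFd F subset_rfl hF _ (isOpen_cell e).isClosed_compl (m + 1) hnm ω
    ⟨h1.cc, h1.rel, Z_anti (Set.subset_univ _) h1.cyc⟩
  have h3 := h.z_zero _ (mem_Z_of_union (add_mem h1.rel (d_mem_Z t2)) t3 fun x _ => by
    by_cases hx : x ∈ cell e
    · exact Or.inr (hs hx)
    · exact Or.inl hx)
  have h4 := h.d_zero ψ t1 (by simp [mem_Z])
  rw [map_add, h4, h2] at h3
  simp at h3

variable [CompactSpace X]

lemma Fund.thin (h : Fund (m + 1) Set.univ Λ) (hd : DimLE (Set.univ : Set X) (m + 1))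
    (hl : LocEuc (m + 1) X) (hF : IsClosed F) {n : ℕ} (hFd : DimLE F n) (hnm : n < m) :
    Thin F := by
  intro p U hU
  obtain ⟨e, he, hpe, hs⟩ := hl.exists_cell hU
  exact ⟨cell e, hs, isOpen_cell e, hpe, h.isPreconnected_diff hd hl (isOpen_cell e)
    (isPreconnected_cell he) hF hFd hnm, h.not_subset hFd hF (by omega) he⟩

end Extension

section GlueThin

variable {X : Type*} [TopologicalSpace X] {N F : Set X}

lemma NullBy.eq_zero_of_thin {g : X → ZMod 2} (hN : IsOpen N) (hg : NullBy 0 g N)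
    (hF : Thin F) (h0 : ∀ x ∈ N \ F, g x = 0) : ∀ x ∈ N, g x = 0 := by
  intro x hx
  obtain ⟨U, hU, h1⟩ := hg x hx
  obtain ⟨W, hW, -, -, -, y, hy⟩ := hF x (U ∩ N) (Filter.inter_mem hU (hN.mem_nhds hx))
  have := h1 x (mem_of_mem_nhds hU) y (hW hy.1).1
  rw [h0 y ⟨(hW hy.1).2, hy.2⟩] at this
  simpa using this.symm

/-- Gluing of one-cocycles over open covers, with gluing data outside of a thin set. -/
lemma exists_glue_thin [RegularSpace X] [SecondCountableTopology X] (hN : IsOpen N) (hF : Thin F)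
    {p₀ : X} (hp₀ : p₀ ∈ N) (O : X → Set X) (hO : ∀ p ∈ N, IsOpen (O p)) (hpO : ∀ p ∈ N, p ∈ O p)
    (c : X → X → X → ZMod 2) (g : X → X → X → ZMod 2) (hc : ∀ p ∈ N, CocOn (c p) (O p ∩ N))
    (hg : ∀ p ∈ N, ∀ q ∈ N, NullBy (c p + c q) (g p q) ((O p ∩ O q ∩ N) \ F))
    (hcoc : ∀ p ∈ N, ∀ q ∈ N, ∀ r ∈ N, ∀ x ∈ (O p ∩ O q ∩ O r ∩ N) \ F,
      g p q x + g q r x = g p r x) :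
    ∃ b, CocOn b N ∧ NullOn (b + c p₀) (O p₀ ∩ N) := by
  have hC : ∀ p ∈ N, ∃ C ∈ 𝓝 p, IsClosed C ∧ C ⊆ O p := fun p hp =>
    exists_mem_nhds_isClosed_subset ((hO p hp).mem_nhds (hpO p hp))
  choose! C hCn hCc hCO using hC
  obtain ⟨t, ht, htc, hcov⟩ := TopologicalSpace.countable_cover_nhdsWithin
    (f := fun p => interior (C p)) (s := N) fun p hp =>
      mem_nhdsWithin_of_mem_nhds (interior_mem_nhds.2 (hCn p hp))
  obtain ⟨a, ha⟩ := (htc.insert p₀).exists_eq_range (Set.insert_nonempty _ _)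
  have haN : ∀ k, a k ∈ N := fun k => by
    have : a k ∈ insert p₀ t := ha ▸ Set.mem_range_self k
    rcases this with h | h
    · exact h ▸ hp₀
    · exact ht h
  have hOO : ∀ k l, IsOpen (O (a k) ∩ O (a l) ∩ N) := fun k l =>
    ((hO _ (haN k)).inter (hO _ (haN l))).inter hN
  have hex : ∀ k l, ∃ g', NullBy (c (a k) + c (a l)) g' (O (a k) ∩ O (a l) ∩ N) ∧
      ∀ x ∈ (O (a k) ∩ O (a l) ∩ N) \ F, g' x = g (a k) (a l) x := fun k l =>
    CocOn.exists_extend (((hc _ (haN k)).mono fun x hx => ⟨hx.1.1, hx.2⟩).add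
      ((hc _ (haN l)).mono fun x hx => ⟨hx.1.2, hx.2⟩)) (hOO k l) hF (hg _ (haN k) _ (haN l))
  choose G hG hGg using hex
  obtain ⟨b, hb, hbc⟩ := exists_glue_open (N := N) (fun k => O (a k)) (fun k => C (a k))
    (fun k => hO _ (haN k)) (fun k => hCc _ (haN k)) (fun k => hCO _ (haN k)) (fun x hx => by
      obtain ⟨p, hp, hxp⟩ := Set.mem_iUnion₂.1 (hcov hx)
      obtain ⟨k, rfl⟩ : p ∈ Set.range a := ha ▸ Or.inr hp
      exact ⟨k, hxp⟩) (fun k => c (a k)) G (fun k => hc _ (haN k)) hN hG (by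
      intro k l m x hx
      have hopen : IsOpen (O (a k) ∩ O (a l) ∩ O (a m) ∩ N) :=
        (((hO _ (haN k)).inter (hO _ (haN l))).inter (hO _ (haN m))).inter hN
      have h1 := (hG k l).mono (T := O (a k) ∩ O (a l) ∩ O (a m) ∩ N) fun y hy => ⟨hy.1.1, hy.2⟩
      have h2 := (hG l m).mono (T := O (a k) ∩ O (a l) ∩ O (a m) ∩ N) fun y hy =>
        ⟨⟨hy.1.1.2, hy.1.2⟩, hy.2⟩
      have h3 := (hG k m).mono (T := O (a k) ∩ O (a l) ∩ O (a m) ∩ N) fun y hy =>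
        ⟨⟨hy.1.1.1, hy.1.2⟩, hy.2⟩
      have h4 := (h1.add h2).add h3
      rw [show c (a k) + c (a l) + (c (a l) + c (a m)) + (c (a k) + c (a m)) = 0 by
        funext x y
        simp only [Pi.add_apply, Pi.zero_apply]
        grind] at h4
      have h5 := h4.eq_zero_of_thin hopen hF (fun y hy => by
        have e := hcoc _ (haN k) _ (haN l) _ (haN m) y hy
        simp only [Pi.add_apply, hGg k l y ⟨⟨hy.1.1.1, hy.1.2⟩, hy.2⟩,
          hGg l m y ⟨⟨⟨hy.1.1.1.2, hy.1.1.2⟩, hy.1.2⟩, hy.2⟩,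
          hGg k m y ⟨⟨⟨hy.1.1.1.1, hy.1.1.2⟩, hy.1.2⟩, hy.2⟩]
        grind) x hx
      simp only [Pi.add_apply] at h5
      grind)
  obtain ⟨k, hk⟩ : p₀ ∈ Set.range a := ha ▸ Or.inl rfl
  exact ⟨b, hb, hk ▸ hbc k⟩

/-- A class on the complement of a thin set in a simply connected space is trivial if it is
trivial near the points of the thin set. -/
lemma CocOn.nullOn_compl_of_thin [RegularSpace X] [SecondCountableTopology X]
    [SimplyConnectedSpace X] [LocallyPathConnectedSpace X] (hF : Thin F) (hFc : IsClosed F)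
    {c : X → X → ZMod 2} (hc : CocOn c Fᶜ)
    (h : ∀ z ∈ F, ∃ Q, IsOpen Q ∧ z ∈ Q ∧ NullOn c (Q \ F)) : NullOn c Fᶜ := by
  classical
  choose! Q hQ hzQ hnQ using h
  choose! u hu using hnQ
  rcases (Fᶜ).eq_empty_or_nonempty with he | ⟨p₀, hp₀⟩
  · rw [he]
    exact ⟨0, fun p hp => hp.elim⟩
  let O : X → Set X := fun p => if p ∈ F then Q p else Fᶜ
  let b : X → X → X → ZMod 2 := fun p => if p ∈ F then 0 else c
  let v : X → X → ZMod 2 := fun p => if p ∈ F then u p else 0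
  have hv : ∀ p, NullBy (c + b p) (v p) (O p \ F) := by
    intro p
    by_cases hp : p ∈ F
    · simpa only [O, b, v, if_pos hp, add_zero] using hu p hp
    · simp only [b, v, if_neg hp, add_self_fun]
      exact fun q _ => ⟨Set.univ, Filter.univ_mem, by simp⟩
  obtain ⟨a, ha, hab⟩ := exists_glue_thin (N := Set.univ) isOpen_univ hF (Set.mem_univ p₀) O
    (fun p _ => by
      by_cases hp : p ∈ F
      · simpa only [O, if_pos hp] using hQ p hp
      · simpa only [O, if_neg hp] using hFc.isOpen_compl)
    (fun p _ => by
      by_cases hp : p ∈ F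
      · simpa only [O, if_pos hp] using hzQ p hp
      · simp only [O, if_neg hp]
        exact hp)
    b (fun p q => v p + v q)
    (fun p _ => by
      by_cases hp : p ∈ F
      · simp only [b, if_pos hp]
        exact fun q _ => ⟨Set.univ, Filter.univ_mem, by simp [dTwo]⟩
      · simpa only [O, b, if_neg hp, Set.inter_univ] using hc)
    (fun p _ q _ => by
      have := ((hv p).mono (T := (O p ∩ O q ∩ Set.univ) \ F) fun x hx => ⟨hx.1.1.1, hx.2⟩).add
        ((hv q).mono fun x hx => ⟨hx.1.1.2, hx.2⟩)
      rwa [show c + b p + (c + b q) = b p + b q by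
        funext x y
        simp only [Pi.add_apply]
        grind] at this)
    (fun p _ q _ r _ x _ => by
      simp only [Pi.add_apply]
      grind)
  have h1 := ha.nullOn_of_simplyConnected
  have h2 : NullOn (a + c) Fᶜ := by
    simpa only [O, b, if_neg (show p₀ ∉ F from hp₀), Set.inter_univ] using hab
  rw [add_comm] at h2
  exact h2.add_cancel (h1.mono (Set.subset_univ _))

end GlueThin

section TorusPeriods

variable {k : ℕ}

/-- The universal covering of the torus. -/
def tq (k : ℕ) (x : Fin k → ℝ) : Fin k → Circle := fun i => Circle.exp (x i)

/-- A set-theoretic section of the universal covering of the torus. -/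
def ts (z : Fin k → Circle) : Fin k → ℝ := fun i => Complex.arg (z i)

lemma tq_ts (z : Fin k → Circle) : tq k (ts z) = z := funext fun i => Circle.exp_arg (z i)

lemma continuous_tq : Continuous (tq k) := by
  unfold tq
  fun_prop

lemma isOpenMap_tq : IsOpenMap (tq k) :=
  IsOpenMap.piMap (fun _ => isLocalHomeomorph_circleExp.isOpenMap)
    (Filter.Eventually.of_forall fun _ z => ⟨_, Circle.exp_arg z⟩)

lemma tq_eq_tq {x y : Fin k → ℝ} :
    tq k x = tq k y ↔ ∃ m : Fin k → ℤ, x = y + fun i => m i * (2 * Real.pi) := by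
  constructor
  · intro h
    have := fun i => Circle.exp_eq_exp.1 (congrFun h i)
    choose m hm using this
    exact ⟨m, funext hm⟩
  · rintro ⟨m, rfl⟩
    exact funext fun i => Circle.exp_eq_exp.2 ⟨m i, rfl⟩

/-- The `i`-th generator of the group of deck transformations. -/
def tau (i : Fin k) : Fin k → ℝ := Pi.single i (2 * Real.pi)

lemma tau_eq (i : Fin k) :
    tau i = fun j => ((Pi.single i 1 : Fin k → ℤ) j : ℝ) * (2 * Real.pi) := by
  ext j
  by_cases h : j = i
  · subst h
    simp [tau]
  · simp [tau, h]

lemma tq_add_tau (x : Fin k → ℝ) (i : Fin k) : tq k (x + tau i) = tq k x :=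
  tq_eq_tq.2 ⟨Pi.single i 1, by rw [tau_eq]⟩

lemma invariant_of_tau {g : (Fin k → ℝ) → ZMod 2} (h : ∀ i x, g (x + tau i) = g x)
    {x y : Fin k → ℝ} (hxy : tq k x = tq k y) : g x = g y := by
  let P : AddSubgroup (Fin k → ℝ) :=
    { carrier := {τ | ∀ x, g (x + τ) = g x}
      zero_mem' := fun x => by rw [add_zero]
      add_mem' := fun {a b} ha hb x => by rw [← add_assoc, hb, ha]
      neg_mem' := fun {a} ha x => by rw [← ha (x + -a), neg_add_cancel_right] }
  obtain ⟨m, rfl⟩ := tq_eq_tq.1 hxy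
  have : (fun i => m i * (2 * Real.pi)) ∈ P := by
    have e : (fun i => m i * (2 * Real.pi)) = ∑ i, m i • tau i := by
      rw [← Finset.univ_sum_single fun i => m i * (2 * Real.pi)]
      refine Finset.sum_congr rfl fun i _ => ?_
      ext j
      by_cases h : j = i
      · subst h
        simp [tau]
      · simp [tau, h]
    rw [e]
    exact P.sum_mem fun i _ => P.zsmul_mem (h i) _
  exact this y

lemma cocOn_of_pull_tq {c : (Fin k → Circle) → (Fin k → Circle) → ZMod 2}
    (h : CocOn (pull (tq k) c) Set.univ) : CocOn c Set.univ := by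
  intro p _
  obtain ⟨U, hU, hc⟩ := h (ts p) (Set.mem_univ _)
  refine ⟨tq k '' U, by simpa only [tq_ts] using isOpenMap_tq.image_mem_nhds hU, ?_⟩
  rintro _ ⟨x, hx, rfl⟩ _ ⟨y, hy, rfl⟩ _ ⟨z, hz, rfl⟩
  exact hc x hx y hy z hz

/-- The cocycle `c` on the torus has periods `v`. -/
def Per (c : (Fin k → Circle) → (Fin k → Circle) → ZMod 2) (v : Fin k → ZMod 2) : Prop :=
  ∃ g, NullBy (pull (tq k) c) g Set.univ ∧ ∀ i x, g (x + tau i) + g x = v i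

lemma CocOn.exists_per {c : (Fin k → Circle) → (Fin k → Circle) → ZMod 2}
    (h : CocOn c Set.univ) : ∃ v, Per c v := by
  obtain ⟨g, hg⟩ := (h.pull (f := tq k) (S' := Set.univ)
    (fun _ _ => continuous_tq.continuousAt) fun _ _ => Set.mem_univ _).nullOn_of_simplyConnected
  refine ⟨fun i => g (0 + tau i) + g 0, g, hg, fun i x => ?_⟩
  have := hg.pull (f := fun x => x + tau i) (S' := Set.univ)
    (fun _ _ => Continuous.continuousAt (by fun_prop)) fun _ _ => Set.mem_univ _
  have e : AS.pull (fun x => x + tau i) (AS.pull (tq k) c) = AS.pull (tq k) c := by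
    funext x y
    simp only [AS.pull, tq_add_tau]
  rw [e] at this
  exact this.const_of_preconnected hg isPreconnected_univ (Set.mem_univ _) (Set.mem_univ _)

lemma Per.unique {c : (Fin k → Circle) → (Fin k → Circle) → ZMod 2} {v w : Fin k → ZMod 2}
    (h : Per c v) (h' : Per c w) : v = w := by
  obtain ⟨g, hg, hv⟩ := h
  obtain ⟨g', hg', hw⟩ := h'
  ext1 i
  have := hg.const_of_preconnected hg' isPreconnected_univ (Set.mem_univ (0 + tau i))
    (Set.mem_univ 0)
  rw [← hv i 0, ← hw i 0]
  grind

lemma Per.add {c c' : (Fin k → Circle) → (Fin k → Circle) → ZMod 2} {v w : Fin k → ZMod 2}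
    (h : Per c v) (h' : Per c' w) : Per (c + c') (v + w) := by
  obtain ⟨g, hg, hv⟩ := h
  obtain ⟨g', hg', hw⟩ := h'
  refine ⟨g + g', hg.add hg', fun i x => ?_⟩
  simp only [Pi.add_apply, ← hv i x, ← hw i x]
  grind

lemma Per.nullOn_iff {c : (Fin k → Circle) → (Fin k → Circle) → ZMod 2} {v : Fin k → ZMod 2}
    (h : Per c v) : v = 0 ↔ NullOn c Set.univ := by
  constructor
  · rintro rfl
    obtain ⟨g, hg, hv⟩ := h
    have inv {x y : Fin k → ℝ} : tq k x = tq k y → g x = g y :=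
      invariant_of_tau fun i x => CharTwo.add_eq_zero.1 (hv i x)
    refine ⟨fun z => g (ts z), fun p _ => ?_⟩
    obtain ⟨U, hU, hc⟩ := hg (ts p) (Set.mem_univ _)
    refine ⟨tq k '' U, by simpa only [tq_ts] using isOpenMap_tq.image_mem_nhds hU, ?_⟩
    rintro _ ⟨x, hx, rfl⟩ _ ⟨y, hy, rfl⟩
    beta_reduce
    rw [inv (tq_ts (tq k x)), inv (tq_ts (tq k y))]
    exact hc x hx y hy
  · rintro ⟨g, hg⟩
    refine h.unique ⟨g ∘ tq k, hg.pull (fun _ _ => continuous_tq.continuousAt)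
      fun _ _ => Set.mem_univ _, fun i x => ?_⟩
    simp only [Function.comp_apply, tq_add_tau]
    exact CharTwo.add_self_eq_zero _

lemma exists_cocOn_per (v : Fin k → ZMod 2) :
    ∃ c : (Fin k → Circle) → (Fin k → Circle) → ZMod 2, CocOn c Set.univ ∧ Per c v := by
  let G : (Fin k → ℝ) → ZMod 2 := fun t => ∑ i, v i * (⌊t i / (2 * Real.pi)⌋ : ZMod 2)
  have hG (t : Fin k → ℝ) (m : Fin k → ℤ) :
      G (t + fun i => m i * (2 * Real.pi)) = G t + ∑ i, v i * (m i : ZMod 2) := by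
    simp only [G]
    rw [← Finset.sum_add_distrib]
    refine Finset.sum_congr rfl fun i _ => ?_
    have : (t i + m i * (2 * Real.pi)) / (2 * Real.pi) = t i / (2 * Real.pi) + m i := by
      field_simp
    rw [Pi.add_apply, this, Int.floor_add_intCast]
    push_cast
    ring
  let c : (Fin k → Circle) → (Fin k → Circle) → ZMod 2 := fun z w =>
    G (ts z) + G (ts z + ts (w / z))
  have hc : NullBy (pull (tq k) c) G Set.univ := by
    intro p _
    refine ⟨Metric.ball p (Real.pi / 2), Metric.ball_mem_nhds _ (by positivity),
      fun x hx y hy => ?_⟩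
    obtain ⟨m, hm⟩ := tq_eq_tq.1 (tq_ts (tq k x))
    have hxy : ∀ i, |y i - x i| < Real.pi := fun i => by
      have h2 : dist (y i) (x i) ≤ dist y x := dist_le_pi_dist y x i
      have h3 := dist_triangle_right y x p
      rw [← Real.dist_eq]
      linarith [Metric.mem_ball.1 hx, Metric.mem_ball.1 hy]
    have e : ts (tq k y / tq k x) = y - x := by
      ext i
      have := abs_lt.1 (hxy i)
      have e1 : (tq k y / tq k x) i = Circle.exp (y i - x i) := by
        rw [Circle.exp_sub]
        rfl
      simp only [ts, e1, Pi.sub_apply]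
      exact Circle.arg_exp this.1 this.2.le
    have e2 : x + (fun i => m i * (2 * Real.pi)) + (y - x)
        = y + fun i => m i * (2 * Real.pi) := by abel
    simp only [AS.pull, c, e, hm, e2, hG]
    grind
  refine ⟨c, cocOn_of_pull_tq hc.cocOn, G, hc, fun i x => ?_⟩
  rw [tau_eq, hG]
  have : ∑ j, v j * (((Pi.single i 1 : Fin k → ℤ) j : ℤ) : ZMod 2) = v i := by
    rw [Finset.sum_eq_single i] <;> simp +contextual
  rw [this]
  grind

end TorusPeriods

section EmbeddedTorus

variable {X : Type*} [TopologicalSpace X] {F : Set X} {k : ℕ}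

/-- The set `F` is an embedded torus. -/
def IsTorus (k : ℕ) (F : Set X) : Prop :=
  ∃ ι : (Fin k → Circle) → X, Continuous ι ∧ Function.Injective ι ∧ Set.range ι = F

lemma IsTorus.isCompact (h : IsTorus k F) : IsCompact F := by
  obtain ⟨ι, hι, -, rfl⟩ := h
  exact isCompact_range hι

lemma locEuc_torus (k : ℕ) : LocEuc k (Fin k → Circle) := by
  intro z
  have h (i : Fin k) : ∃ e : OpenPartialHomeomorph Circle ℝ, z i ∈ e.source := by
    obtain ⟨e, he, hx⟩ := isLocalHomeomorph_circleExp (Complex.arg (z i))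
    refine ⟨e.symm, ?_⟩
    have := e.map_source he
    rwa [← hx, Circle.exp_arg] at this
  choose e he using h
  exact ⟨OpenPartialHomeomorph.pi e, fun i _ => he i⟩

lemma CocOn.nullBy_retraction {ρ : X → X} (hρ : ∀ p ∈ F, ContinuousAt ρ p) (h : ∀ p ∈ F, ρ p = p)
    {c : X → X → ZMod 2} (hc : CocOn c F) :
    NullBy (c + AS.pull ρ c) (fun x => c x (ρ x)) F := by
  intro p hp
  obtain ⟨U, hU, hu⟩ := hc p hp
  refine ⟨U ∩ ρ ⁻¹' U, Filter.inter_mem hU (hρ p hp (by rwa [h p hp])), fun x hx y hy => ?_⟩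
  have h1 := hu x hx.1 y hy.1 (ρ y) hy.2
  have h2 := hu x hx.1 (ρ x) hx.2 (ρ y) hy.2
  simp only [dTwo, Pi.add_apply, AS.pull] at *
  grind

variable [CompactSpace X] [T2Space X] [SecondCountableTopology X]

lemma IsTorus.exists_retraction (h : IsTorus k F) :
    ∃ (ι : (Fin k → Circle) → X) (r : X → Fin k → Circle), Continuous ι ∧ Set.range ι = F ∧
      (∀ z, r (ι z) = z) ∧ (∀ p ∈ F, ContinuousAt r p) ∧ ∀ p ∈ F, ι (r p) = p := by
  obtain ⟨ι, hι, hi, rfl⟩ := h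
  let := TopologicalSpace.metrizableSpaceMetric X
  have hc := isCompact_range hι
  have := fun x => hc.exists_infDist_eq_dist (Set.range_nonempty ι) x
  choose n hn hd using this
  choose r hr using hn
  have hnp (z) : n (ι z) = ι z := by
    have h1 := hd (ι z)
    rw [Metric.infDist_zero_of_mem (Set.mem_range_self z)] at h1
    exact (dist_eq_zero.1 h1.symm).symm
  have hr' : ∀ z, r (ι z) = z := fun z => hi ((hr _).trans (hnp z))
  refine ⟨ι, r, hι, rfl, hr', ?_, ?_⟩
  · rintro _ ⟨z, rfl⟩
    have he := (hι.isClosedEmbedding hi).isInducing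
    rw [ContinuousAt, he.tendsto_nhds_iff]
    have e : ι ∘ r = n := funext hr
    rw [e, hr', tendsto_iff_dist_tendsto_zero]
    refine squeeze_zero (g := fun x => dist x (ι z) + dist x (ι z)) (fun _ => dist_nonneg)
      (fun x => ?_) ?_
    · have h1 := Metric.infDist_le_dist_of_mem (x := x) (Set.mem_range_self (f := ι) z)
      rw [hd] at h1
      have h2 := dist_triangle_left (n x) (ι z) x
      linarith
    · have : Continuous fun x => dist x (ι z) + dist x (ι z) := by fun_prop
      simpa using this.tendsto (ι z)
  · rintro _ ⟨z, rfl⟩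
    rw [hr']

lemma IsTorus.dimLE (h : IsTorus k F) : DimLE F k := by
  have hc := h.isCompact
  obtain ⟨ι, r, hι, rfl, hr, hrc, -⟩ := h.exists_retraction
  refine dimLE_of_circle_coords k hc.isClosed hc (fun i x => (r x i : ℂ)) (fun i x hx => ?_)
    (fun i x _ => Circle.norm_coe _) ?_
  · have h1 := (continuous_apply i).continuousAt.comp (hrc x hx)
    exact (continuous_subtype_val.continuousAt.comp h1).continuousWithinAt
  · rintro _ ⟨z, rfl⟩ _ ⟨w, rfl⟩ h
    simp only [hr, Circle.coe_inj] at h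
    rw [funext h]

lemma IsTorus.exists_per (h : IsTorus k F) :
    ∃ per : (X → X → ZMod 2) → Fin k → ZMod 2,
      (∀ c c', CocOn c F → CocOn c' F → per (c + c') = per c + per c') ∧
      (∀ c, CocOn c F → (per c = 0 ↔ NullOn c F)) ∧ ∀ v, ∃ c, CocOn c F ∧ per c = v := by
  classical
  obtain ⟨ι, r, hι, rfl, hr, hrc, hrι⟩ := h.exists_retraction
  have hp {c : X → X → ZMod 2} (hc : CocOn c (Set.range ι)) : CocOn (pull ι c) Set.univ :=
    hc.pull (fun _ _ => hι.continuousAt) fun z _ => Set.mem_range_self z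
  let per : (X → X → ZMod 2) → Fin k → ZMod 2 := fun c => Classical.epsilon (Per (pull ι c))
  have hper {c : X → X → ZMod 2} (hc : CocOn c (Set.range ι)) : Per (pull ι c) (per c) :=
    Classical.epsilon_spec (hp hc).exists_per
  refine ⟨per, fun c c' hc hc' => (hper (hc.add hc')).unique ((hper hc).add (hper hc')),
    fun c hc => (hper hc).nullOn_iff.trans ⟨fun h => ?_, fun h => ?_⟩, fun v => ?_⟩
  · have h1 : NullOn (pull r (pull ι c)) (Set.range ι) := h.pull hrc fun _ _ => Set.mem_univ _
    exact NullOn.add_cancel ⟨_, hc.nullBy_retraction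
      (fun p hp => hι.continuousAt.comp (hrc p hp)) hrι⟩ h1
  · exact h.pull (fun _ _ => hι.continuousAt) fun z _ => Set.mem_range_self z
  · obtain ⟨c, hc, hv⟩ := exists_cocOn_per v
    have hcr : CocOn (pull r c) (Set.range ι) := hc.pull hrc fun _ _ => Set.mem_univ _
    refine ⟨pull r c, hcr, (hper hcr).unique ?_⟩
    have e : pull ι (pull r c) = c := by
      funext z w
      simp only [AS.pull, hr]
    rwa [e]

lemma IsTorus.exists_cup_null {m : ℕ} (h : IsTorus (m + 1) F) {c : X → X → ZMod 2}
    (hc : CocOn c F) (hn : ¬ NullOn c F) {α : Coch X} (hα : Cyc (m + 1) F ∅ α) :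
    ∃ β, Cyc m F ∅ β ∧ Null (m + 1) F ∅ (α + cup c β) := by
  obtain ⟨ι, r, hι, rfl, hr, hrc, hrι⟩ := h.exists_retraction
  have hιr : ∀ p ∈ Set.range ι, ContinuousAt (ι ∘ r) p :=
    fun p hp => hι.continuousAt.comp (hrc p hp)
  have hl := locEuc_torus (m + 1)
  have hd := hl.dimLE
  obtain ⟨Λ, hΛ⟩ := exists_fund hd hl
  have hc' : CocOn (pull ι c) Set.univ :=
    hc.pull (fun _ _ => hι.continuousAt) fun z _ => Set.mem_range_self z
  have hh := hc.nullBy_retraction (ρ := ι ∘ r) hιr hrι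
  have hn' : ¬ NullOn (pull ι c) Set.univ := fun h0 =>
    hn (NullOn.add_cancel ⟨_, hh⟩
      (h0.pull (f := r) (S' := Set.range ι) hrc fun _ _ => Set.mem_univ _))
  have hα' : Cyc (m + 1) Set.univ ∅ (pb ι α) :=
    ⟨pb_mem_Cc ι hα.cc, fun p hp => hp.elim, by
      rw [d_pb]
      exact pb_mem_Z (fun _ _ => hι.continuousAt) (fun z _ => Set.mem_range_self z) hα.cyc⟩
  obtain ⟨β, hβ, hβ0⟩ : ∃ β, Cyc m Set.univ ∅ β ∧ Λ (pb ι α + cup (pull ι c) β) = 0 := by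
    by_cases h0 : Λ (pb ι α) = 0
    · refine ⟨0, ⟨zero_mem _, zero_mem _, by simp⟩, ?_⟩
      have : cup (pull ι c) 0 = 0 := by
        have := cup_add (pull ι c) 0 0
        simpa using this
      rw [this, add_zero, h0]
    · obtain ⟨β, hβ, h1⟩ := hΛ.exists_cup hd hl isOpen_univ isPreconnected_univ hc' hn'
      rw [Set.compl_univ] at hβ
      refine ⟨β, hβ, ?_⟩
      rw [map_add, h1, zmod_two_ne_zero.1 h0]
      rfl
  have hcup : Cyc (m + 1) Set.univ ∅ (cup (pull ι c) β) := by
    refine ⟨cup_mem_Cc _ hβ.cc, fun p hp => hp.elim, ?_⟩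
    have h1 := hc'.d_cup_add_mem hβ.cc hβ.rel
    rw [Set.union_empty] at h1
    exact mem_of_eq (add_mem h1 (cup_mem_Z (pull ι c) hβ.cyc))
      (by rw [add_assoc, add_self_coch, add_zero])
  obtain ⟨ψ, hψ, -, hψ0⟩ := hΛ.null_of_connected hd hl isOpen_univ isPreconnected_univ
    (by rw [Set.compl_univ]; exact hα'.add hcup) hβ0
  have hb : Cyc m (Set.range ι) ∅ (pb r β) :=
    ⟨pb_mem_Cc r hβ.cc, fun p hp => hp.elim, by
      rw [d_pb]
      exact pb_mem_Z hrc (fun _ _ => Set.mem_univ _) hβ.cyc⟩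
  refine ⟨pb r β, hb, pb r ψ + prism id (ι ∘ r) α + fmul (fun x => c x ((ι ∘ r) x)) (pb r β),
    add_mem (add_mem (pb_mem_Cc r hψ) (prism_mem_Cc _ _ hα.cc)) (fmul_mem_Cc _ hb.cc),
    fun p hp => hp.elim, ?_⟩
  have e1 := pb_mem_Z hrc (fun _ _ => Set.mem_univ _) hψ0
  have e2 : prism id (ι ∘ r) (d α) ∈ Z (Set.range ι) :=
    prism_mem_Z (fun _ _ => continuousAt_id) hιr (fun p hp => (hrι p hp).symm)
      (fun _ h => h) hα.cyc
  have e3 := prism_homotopy id (ι ∘ r) α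
  have e4 := hh.d_fmul_mem hb.cc hb.rel
  rw [Set.union_empty] at e4
  have e5 := fmul_mem_Z (fun x => c x ((ι ∘ r) x)) hb.cyc
  have e6 : pb r (cup (pull ι c) β) = cup (pull (ι ∘ r) c) (pb r β) := by
    funext l
    rcases l with _ | ⟨a, _ | ⟨b, l⟩⟩ <;> rfl
  have e7 : pb r (pb ι α) = pb (ι ∘ r) α := by
    funext l
    simp [pb_apply]
  have e8 := add_cup c (pull (ι ∘ r) c) (pb r β)
  rw [pb_id] at e3
  simp only [map_add, e6, e7, ← d_pb] at e1
  refine mem_of_eq (add_mem (add_mem e1 e2) (add_mem e4 e5)) ?_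
  rw [e8]
  simp only [map_add]
  grind

end EmbeddedTorus

section Winding

variable {X : Type*} [TopologicalSpace X] {ζ : X → ℂ}

/-- The indicator function of the closed upper half plane. -/
def upper (ζ : X → ℂ) (x : X) : ZMod 2 := if 0 ≤ (ζ x).im then 1 else 0

/-- The mod two winding cocycle, defined off the zeros of `ζ`. -/
def winding (ζ : X → ℂ) (x y : X) : ZMod 2 :=
  if 0 < (ζ x).re then upper ζ x + upper ζ y else 0

lemma exists_nhds_upper (hζ : Continuous ζ) {p : X} (hp : (ζ p).im ≠ 0) :
    ∃ U ∈ 𝓝 p, ∀ x ∈ U, ∀ y ∈ U, upper ζ x + upper ζ y = 0 := by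
  rcases hp.lt_or_gt with h | h
  · refine ⟨{x | (ζ x).im < 0}, (isOpen_lt (by fun_prop) (by fun_prop)).mem_nhds h,
      fun x hx y hy => ?_⟩
    rw [Set.mem_ofPred_eq] at hx hy
    simp [upper, hx.not_ge, hy.not_ge]
  · refine ⟨{x | 0 < (ζ x).im}, (isOpen_lt (by fun_prop) (by fun_prop)).mem_nhds h,
      fun x hx y hy => ?_⟩
    rw [Set.mem_ofPred_eq] at hx hy
    simp only [upper, hx.le, hy.le, if_true]
    rfl

lemma nullBy_winding_right (hζ : Continuous ζ) :
    NullBy (winding ζ) (upper ζ) {x | 0 < (ζ x).re ∨ (ζ x).im ≠ 0} := by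
  rintro p (hp | hp)
  · refine ⟨{x | 0 < (ζ x).re}, (isOpen_lt (by fun_prop) (by fun_prop)).mem_nhds hp,
      fun x hx y _ => if_pos hx⟩
  · obtain ⟨U, hU, h⟩ := exists_nhds_upper hζ hp
    refine ⟨U, hU, fun x hx y hy => ?_⟩
    simp [winding, h x hx y hy]

lemma nullBy_winding_left (hζ : Continuous ζ) :
    NullBy (winding ζ) 0 {x | (ζ x).re < 0 ∨ (ζ x).im ≠ 0} := by
  rintro p (hp | hp)
  · refine ⟨{x | (ζ x).re < 0}, (isOpen_lt (by fun_prop) (by fun_prop)).mem_nhds hp,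
      fun x hx y _ => ?_⟩
    rw [Set.mem_ofPred_eq] at hx
    simp [winding, hx.not_gt]
  · obtain ⟨U, hU, h⟩ := exists_nhds_upper hζ hp
    refine ⟨U, hU, fun x hx y hy => ?_⟩
    simp [winding, h x hx y hy]

lemma cocOn_winding (hζ : Continuous ζ) : CocOn (winding ζ) {x | ζ x ≠ 0} := by
  refine ((nullBy_winding_right hζ).cocOn.union (nullBy_winding_left hζ).cocOn).mono ?_
  intro x hx
  by_cases h : (ζ x).im = 0
  · rcases lt_trichotomy (ζ x).re 0 with h' | h' | h'
    · exact Or.inr (Or.inl h')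
    · exact absurd (Complex.ext h' h) hx
    · exact Or.inl (Or.inl h')
  · exact Or.inl (Or.inr h)

lemma nullBy_winding_add {ζ' : X → ℂ} (hζ : Continuous ζ) {a : ℝ} (ha : 0 ≤ a)
    (h : ∀ x, ζ' x = ζ x - a) :
    NullBy (winding ζ + winding ζ') 0 {x | (ζ x).im = 0 ∧ 0 ≤ (ζ x).re ∧ (ζ x).re ≤ a}ᶜ := by
  have hu : upper ζ' = upper ζ := by
    funext x
    simp [upper, h]
  have hr (x : X) : 0 < (ζ' x).re ↔ a < (ζ x).re := by simp [h]
  intro p hp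
  by_cases him : (ζ p).im = 0
  · by_cases hre : (ζ p).re < 0
    · refine ⟨{x | (ζ x).re < 0}, (isOpen_lt (by fun_prop) (by fun_prop)).mem_nhds hre,
        fun x hx y _ => ?_⟩
      rw [Set.mem_ofPred_eq] at hx
      simp [winding, hr, hx.not_gt, (hx.trans_le ha).not_gt]
    · have hpa : a < (ζ p).re := by
        by_contra hpa
        exact hp ⟨him, not_lt.1 hre, not_lt.1 hpa⟩
      refine ⟨{x | a < (ζ x).re}, (isOpen_lt (by fun_prop) (by fun_prop)).mem_nhds hpa,
        fun x hx y _ => ?_⟩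
      rw [Set.mem_ofPred_eq] at hx
      simp only [Pi.add_apply, winding, hr, hu, hx, ha.trans_lt hx, if_true]
      simpa using CharTwo.add_self_eq_zero _
  · obtain ⟨U, hU, h⟩ := exists_nhds_upper hζ him
    refine ⟨U, hU, fun x hx y hy => ?_⟩
    simp [winding, hu, h x hx y hy]

lemma convex_halfPlane (s e : ℂ) : Convex ℝ {w : ℂ | 0 < ((w - s) * e).re} := by
  intro w hw w' hw' a b ha hb hab
  rw [Set.mem_ofPred_eq] at *
  have e1 : a • w + b • w' - s = a • (w - s) + b • (w' - s) := by
    have : s = a • s + b • s := by rw [← add_smul, hab, one_smul]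
    rw [smul_sub, smul_sub]
    nth_rewrite 1 [this]
    abel
  rw [e1, add_mul, smul_mul_assoc, smul_mul_assoc, Complex.add_re, Complex.smul_re,
    Complex.smul_re, smul_eq_mul, smul_eq_mul]
  rcases ha.eq_or_lt with rfl | ha'
  · have : b = 1 := by linarith
    simpa [this] using hw'
  · have := mul_pos ha' hw
    have := mul_nonneg hb hw'.le
    linarith

end Winding

section Interior

variable {X : Type*} [TopologicalSpace X] {m : ℕ} {f : X → ℂ} {c : X → X → ZMod 2}

/-- A closed manifold of dimension `m + 3` mapped onto the disk with connected fibres, the fibres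
over the interior being tori of dimension `m + 1`. -/
structure DiskFib (m : ℕ) (f : X → ℂ) : Prop where
  cont : Continuous f
  range : Set.range f = Metric.closedBall 0 1
  conn : ∀ t ∈ Metric.closedBall (0 : ℂ) 1, IsConnected (f ⁻¹' {t})
  torus : ∀ t ∈ Metric.ball (0 : ℂ) 1, IsTorus (m + 1) (f ⁻¹' {t})
  locEuc : LocEuc (m + 3) X

lemma DiskFib.mem (D : DiskFib m f) (x : X) : f x ∈ Metric.closedBall (0 : ℂ) 1 :=
  D.range ▸ Set.mem_range_self x

variable [CompactSpace X]

lemma exists_isOpen_preimage_subset (hf : Continuous f) {K : Set ℂ} {O : Set X} (hO : IsOpen O)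
    (h : f ⁻¹' K ⊆ O) : ∃ V, IsOpen V ∧ K ⊆ V ∧ f ⁻¹' V ⊆ O :=
  ⟨(f '' Oᶜ)ᶜ, (hf.isClosedMap _ hO.isClosed_compl).isOpen_compl,
    fun _ ht ⟨x, hx, e⟩ => hx (h (show f x ∈ K from e ▸ ht)),
    fun x hx => by_contra fun hxO => hx ⟨x, hxO, rfl⟩⟩

lemma exists_ball_preimage_subset (hf : Continuous f) {s : ℂ} {O : Set X} (hO : IsOpen O)
    (h : f ⁻¹' {s} ⊆ O) : ∃ ε > 0, f ⁻¹' Metric.ball s ε ⊆ O := by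
  obtain ⟨V, hV, hsV, hVO⟩ := exists_isOpen_preimage_subset hf hO h
  obtain ⟨ε, hε, hb⟩ := Metric.isOpen_iff.1 hV s (hsV rfl)
  exact ⟨ε, hε, (Set.preimage_mono hb).trans hVO⟩

lemma DiskFib.isPreconnected (D : DiskFib m f) {K : Set ℂ} (hK : Convex ℝ K) :
    IsPreconnected (f ⁻¹' K) := by
  have e : f ⁻¹' K = f ⁻¹' (Metric.closedBall 0 1 ∩ K) := by
    ext x
    simp only [Set.mem_preimage, Set.mem_inter_iff, D.mem x, true_and]
  rw [e]
  exact isPreconnected_preimage D.cont.isClosedMap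
    ((convex_closedBall _ _).inter hK).isPreconnected fun t ht => D.conn t ht.1

lemma DiskFib.not_nullOn_winding (D : DiskFib m f) {s d : ℂ} (hs : s ∈ Metric.ball (0 : ℂ) 1)
    (hd : d ≠ 0) :
    ¬ NullOn (winding fun x => (f x - s) * starRingEnd ℂ d) (f ⁻¹' {s})ᶜ := by
  set ζ : X → ℂ := fun x => (f x - s) * starRingEnd ℂ d with hζd
  have hζ : Continuous ζ := by
    have := D.cont
    fun_prop
  rintro ⟨g, hg⟩
  have hne {x : X} (h : ζ x ≠ 0) : x ∈ (f ⁻¹' {s})ᶜ := fun hx => h (by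
    have hx : f x = s := hx
    simp [ζ, hx])
  obtain ⟨δ, hδ, hb⟩ := Metric.isOpen_iff.1 Metric.isOpen_ball s hs
  have hpt (w : ℂ) (hw : ‖w‖ = 1) : ∃ x, ∃ a > 0, ζ x = (a : ℝ) * w := by
    obtain ⟨x, hx⟩ : s + (δ / 2 / ‖d‖ : ℝ) * (w * d) ∈ Set.range f := by
      rw [D.range]
      refine Metric.ball_subset_closedBall (hb ?_)
      have : ‖d‖ ≠ 0 := norm_ne_zero_iff.2 hd
      rw [Metric.mem_ball, dist_eq_norm, add_sub_cancel_left, norm_mul, norm_mul, hw,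
        Complex.norm_real, norm_div, norm_norm, one_mul, div_mul_cancel₀ _ this, Real.norm_eq_abs,
        abs_of_pos (by positivity)]
      linarith
    refine ⟨x, δ / 2 / ‖d‖ * ‖d‖ ^ 2, by positivity, ?_⟩
    simp only [ζ, hx, add_sub_cancel_left]
    rw [mul_assoc, mul_assoc, Complex.mul_conj, Complex.normSq_eq_norm_sq]
    push_cast
    ring
  have half (e : ℂ) : IsPreconnected {x | 0 < (ζ x * e).re} := by
    have : {x | 0 < (ζ x * e).re} = f ⁻¹' {w | 0 < ((w - s) * (starRingEnd ℂ d * e)).re} := by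
      ext x
      simp only [ζ, Set.mem_ofPred_eq, Set.mem_preimage, mul_assoc]
    rw [this]
    exact D.isPreconnected (convex_halfPlane _ _)
  have hR := (nullBy_winding_right hζ)
  have hL := (nullBy_winding_left hζ)
  have right (e : ℂ) (he : e.re = 1) {x y : X} (hx : 0 < (ζ x * e).re) (hy : 0 < (ζ y * e).re) :
      upper ζ x + g x = upper ζ y + g y := by
    have hsub : ∀ z ∈ {x | 0 < (ζ x * e).re}, 0 < (ζ z).re ∨ (ζ z).im ≠ 0 := by
      intro z hz
      by_contra! h
      simp only [Set.mem_ofPred_eq, Complex.mul_re, he, h.2] at hz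
      linarith
    refine (hR.mono hsub).const_of_preconnected (hg.mono ?_) (half e) hx hy
    intro z hz
    refine hne fun h0 => ?_
    simp [h0] at hz
  have left (e : ℂ) (he : e.re = -1) {x y : X} (hx : 0 < (ζ x * e).re) (hy : 0 < (ζ y * e).re) :
      g x = g y := by
    have hsub : ∀ z ∈ {x | 0 < (ζ x * e).re}, (ζ z).re < 0 ∨ (ζ z).im ≠ 0 := by
      intro z hz
      by_contra! h
      simp only [Set.mem_ofPred_eq, Complex.mul_re, he, h.2] at hz
      linarith
    have := (hL.mono hsub).const_of_preconnected (hg.mono ?_) (half e) hx hy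
    · simpa using this
    · intro z hz
      refine hne fun h0 => ?_
      simp [h0] at hz
  obtain ⟨x₁, a₁, h₁, e₁⟩ := hpt 1 (by simp)
  obtain ⟨x₂, a₂, h₂, e₂⟩ := hpt Complex.I (by simp)
  obtain ⟨x₃, a₃, h₃, e₃⟩ := hpt (-1) (by simp)
  obtain ⟨x₄, a₄, h₄, e₄⟩ := hpt (-Complex.I) (by simp)
  have r1 := right (1 - Complex.I) (by simp) (x := x₂) (y := x₁) (by simpa [e₂]) (by simpa [e₁])
  have r2 := right (1 + Complex.I) (by simp) (x := x₁) (y := x₄) (by simpa [e₁]) (by simpa [e₄])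
  have r3 := left (-1 - Complex.I) (by simp) (x := x₂) (y := x₃) (by simpa [e₂]) (by simpa [e₃])
  have r4 := left (-1 + Complex.I) (by simp) (x := x₃) (y := x₄) (by simpa [e₃]) (by simpa [e₄])
  have u2 : upper ζ x₂ = 1 := by simp [upper, e₂, h₂.le]
  have u4 : upper ζ x₄ = 0 := by simp [upper, e₄, h₄.not_ge]
  have : upper ζ x₂ = upper ζ x₄ := by
    have := r1.trans r2
    rw [r3, r4] at this
    exact add_right_cancel this
  rw [u2, u4] at this
  exact one_ne_zero this

lemma NullOn.exists_ball (hf : Continuous f) {s : ℂ} (h : NullOn c (f ⁻¹' {s})) :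
    ∃ ε > 0, NullOn c (f ⁻¹' Metric.ball s ε) := by
  obtain ⟨g, hg⟩ := h
  obtain ⟨O, hO, hsO, hg⟩ := hg.exists_open
  obtain ⟨ε, hε, hb⟩ := exists_ball_preimage_subset hf hO hsO
  exact ⟨ε, hε, g, hg.mono hb⟩

variable [T2Space X] [SecondCountableTopology X] {Λ : Coch X →ₗ[ZMod 2] ZMod 2}

variable [SimplyConnectedSpace X] [LocallyPathConnectedSpace X]

lemma DiskFib.exists_winding_eq_one (D : DiskFib m f) (hΛ : Fund (m + 3) Set.univ Λ) {s d : ℂ}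
    (hs : s ∈ Metric.ball (0 : ℂ) 1) (hd : d ≠ 0) :
    ∃ α ∈ Cc X (m + 2), AS.d α ∈ Z (f ⁻¹' {s}) ∧
      Λ (cup (winding fun x => (f x - s) * starRingEnd ℂ d) (AS.d α)) = 1 := by
  by_contra! hcon
  have hζ : Continuous fun x => (f x - s) * starRingEnd ℂ d := by
    have := D.cont
    fun_prop
  have hF : IsClosed (f ⁻¹' {s}) := isClosed_singleton.preimage D.cont
  have hFd := (D.torus s hs).dimLE
  have hdim := D.locEuc.dimLE
  have hc : CocOn (winding fun x => (f x - s) * starRingEnd ℂ d) (f ⁻¹' {s})ᶜ :=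
    (cocOn_winding hζ).mono fun x hx =>
      mul_ne_zero (sub_ne_zero.2 hx) ((map_ne_zero _).2 hd)
  refine D.not_nullOn_winding hs hd (CocOn.nullOn_compl_of_thin
    (hΛ.thin hdim D.locEuc hF hFd (by omega)) hF hc fun z _ => ?_)
  obtain ⟨e, he, hze, -⟩ := D.locEuc.exists_cell (x := z) Filter.univ_mem
  refine ⟨cell e, isOpen_cell e, hze, hΛ.nullOn_diff hdim D.locEuc hF hFd he
    (hc.mono fun x hx => hx.2) fun α hα _ hα' => ?_⟩
  by_contra h0
  exact hcon α hα hα' (zmod_two_ne_zero.1 h0)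

lemma DiskFib.not_nullOn_near (D : DiskFib m f) (hΛ : Fund (m + 3) Set.univ Λ) {s d : ℂ}
    (hs : s ∈ Metric.ball (0 : ℂ) 1) (hd : d ≠ 0) (hc : CocOn c (f ⁻¹' {s}))
    (hn : ¬ NullOn c (f ⁻¹' {s})) :
    ∃ ε > 0, ∀ ρ : ℝ, 0 < ρ → ρ < ε → ¬ NullOn c (f ⁻¹' {s + ρ * d}) := by
  obtain ⟨α, hα, hα0, hα1⟩ := D.exists_winding_eq_one hΛ hs hd
  obtain ⟨β, hβ, ψ, hψ, -, hψ0⟩ := (D.torus s hs).exists_cup_null hc hn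
    (α := α) ⟨hα, fun p hp => hp.elim, hα0⟩
  obtain ⟨O₁, hO₁, hs₁, hα0⟩ := exists_open_mem_Z hα0
  obtain ⟨O₂, hO₂, hs₂, hψ0⟩ := exists_open_mem_Z hψ0
  obtain ⟨O₃, hO₃, hs₃, hβ0⟩ := exists_open_mem_Z hβ.cyc
  obtain ⟨ε, hε, hb⟩ := exists_ball_preimage_subset D.cont ((hO₁.inter hO₂).inter hO₃)
    (Set.subset_inter (Set.subset_inter hs₁ hs₂) hs₃)
  have hd' : 0 < ‖d‖ := norm_pos_iff.2 hd
  refine ⟨ε / ‖d‖, by positivity, fun ρ hρ hρε hnull => ?_⟩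
  rw [lt_div_iff₀ hd'] at hρε
  obtain ⟨g, hg⟩ := hnull
  have hy : f ⁻¹' {s + ρ * d} ⊆ O₁ ∩ O₂ ∩ O₃ := fun x hx => hb (by
    have hx : f x = s + ρ * d := hx
    rw [Set.mem_preimage, hx, Metric.mem_ball, dist_eq_norm, add_sub_cancel_left, norm_mul,
      Complex.norm_real, Real.norm_eq_abs, abs_of_pos hρ]
    exact hρε)
  set ζ : X → ℂ := fun x => (f x - s) * starRingEnd ℂ d with hζd
  set ζ' : X → ℂ := fun x => (f x - (s + ρ * d)) * starRingEnd ℂ d with hζd'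
  have hζ : Continuous ζ := by
    have := D.cont
    fun_prop
  have hζ' : Continuous ζ' := by
    have := D.cont
    fun_prop
  have hζζ (x : X) : ζ' x = ζ x - (ρ * ‖d‖ ^ 2 : ℝ) := by
    have := Complex.mul_conj d
    rw [Complex.normSq_eq_norm_sq] at this
    push_cast at this ⊢
    simp only [ζ, ζ', ← this]
    ring
  have hseg : AS.d α ∈ Z {x | (ζ x).im = 0 ∧ 0 ≤ (ζ x).re ∧ (ζ x).re ≤ ρ * ‖d‖ ^ 2} := by
    refine Z_anti (fun x hx => (hb ?_).1.1) hα0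
    obtain ⟨h1, h2, h3⟩ := hx
    have e : ‖ζ x‖ = (ζ x).re := by
      have : ζ x = ((ζ x).re : ℂ) := Complex.ext rfl (by simpa using h1)
      rw [this, Complex.norm_real, Real.norm_eq_abs, Complex.ofReal_re, abs_of_nonneg h2]
    have e' : ‖ζ x‖ = ‖f x - s‖ * ‖d‖ := by
      simp only [ζ, norm_mul, Complex.norm_conj]
    rw [Set.mem_preimage, Metric.mem_ball, dist_eq_norm]
    have : ‖f x - s‖ * ‖d‖ ≤ ρ * ‖d‖ * ‖d‖ := by
      rw [← e', e]
      linarith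
    exact (le_of_mul_le_mul_right this hd').trans_lt hρε
  have hsum : cup (winding ζ + winding ζ') (AS.d α) ∈ Z Set.univ := by
    have h1 := (nullBy_winding_add hζ (by positivity) hζζ).cup_add_mem (AS.d α)
    have h2 : cup (fun x y : X => (0 : X → ZMod 2) x + (0 : X → ZMod 2) y) (AS.d α) = 0 := by
      funext l
      rcases l with _ | ⟨a, _ | ⟨b, l⟩⟩ <;> simp [cup]
    rw [h2, add_zero] at h1
    exact mem_Z_of_union h1 (cup_mem_Z _ hseg) fun x _ => (em _).symm
  have h4 := hg.d_fmul_mem hβ.cc hβ.rel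
  rw [Set.union_empty] at h4
  have hσ : α + AS.d (ψ + fmul g β) ∈ Z (f ⁻¹' {s + ρ * d}) := by
    have h5 := fmul_mem_Z g (Z_anti (hy.trans fun x hx => hx.2) hβ0)
    have h6 := Z_anti (hy.trans fun x hx => hx.1.2) hψ0
    refine mem_of_eq (add_mem (add_mem h4 h5) h6) ?_
    simp only [map_add]
    grind
  have hσc : α + AS.d (ψ + fmul g β) ∈ Cc X (m + 2) :=
    add_mem hα (d_mem_Cc (add_mem hψ (fmul_mem_Cc g hβ.cc)))
  have hc' : CocOn (winding ζ') (f ⁻¹' {s + ρ * d})ᶜ := (cocOn_winding hζ').mono fun x hx =>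
    mul_ne_zero (sub_ne_zero.2 hx) ((map_ne_zero _).2 hd)
  have h7 := hc'.d_cup_add_mem hσc hσ
  rw [Set.compl_union_self] at h7
  have h8 := hΛ.z_zero _ h7
  have h9 := hΛ.z_zero _ hsum
  have h10 := hΛ.d_zero (cup (winding ζ') (α + AS.d (ψ + fmul g β))) (cup_mem_Cc _ hσc)
    (by simp [mem_Z])
  rw [map_add, h10, map_add AS.d, d_d, add_zero, zero_add] at h8
  rw [add_cup, map_add, h8, hα1] at h9
  simp at h9

lemma DiskFib.nullOn_of_nullOn (D : DiskFib m f) (hΛ : Fund (m + 3) Set.univ Λ) {O : Set ℂ}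
    (hO : Convex ℝ O) (hOo : IsOpen O) (hOD : O ⊆ Metric.ball (0 : ℂ) 1) (hc : CocOn c (f ⁻¹' O))
    {s t : ℂ} (hs : s ∈ O) (ht : t ∈ O) (h : NullOn c (f ⁻¹' {s})) : NullOn c (f ⁻¹' {t}) := by
  rcases eq_or_ne s t with rfl | hst
  · exact h
  let γ : ℝ → ℂ := fun u => s + u * (t - s)
  have hγ : Continuous γ := by fun_prop
  let A : Set ℝ := {u | NullOn c (f ⁻¹' {γ u})} ∩ γ ⁻¹' O
  let B : Set ℝ := {u | ¬ NullOn c (f ⁻¹' {γ u})} ∩ γ ⁻¹' O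
  have hAo : IsOpen A := by
    rw [isOpen_iff_mem_nhds]
    rintro u ⟨hu, huO⟩
    obtain ⟨ε, hε, hb⟩ := NullOn.exists_ball D.cont hu
    filter_upwards [hγ.continuousAt.preimage_mem_nhds (Metric.ball_mem_nhds _ hε),
      hγ.continuousAt.preimage_mem_nhds (hOo.mem_nhds huO)] with v hv hvO
    exact ⟨hb.mono (Set.preimage_mono (Set.singleton_subset_iff.2 hv)), hvO⟩
  have hBo : IsOpen B := by
    rw [isOpen_iff_mem_nhds]
    rintro u ⟨hu, huO⟩
    have hcu : CocOn c (f ⁻¹' {γ u}) :=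
      hc.mono (Set.preimage_mono (Set.singleton_subset_iff.2 huO))
    have hd : t - s ≠ 0 := sub_ne_zero.2 hst.symm
    obtain ⟨ε₁, h₁, hb₁⟩ := D.not_nullOn_near hΛ (hOD huO) hd hcu hu
    obtain ⟨ε₂, h₂, hb₂⟩ := D.not_nullOn_near hΛ (hOD huO) (neg_ne_zero.2 hd) hcu hu
    filter_upwards [Metric.ball_mem_nhds u (lt_min h₁ h₂),
      hγ.continuousAt.preimage_mem_nhds (hOo.mem_nhds huO)] with v hv hvO
    refine ⟨?_, hvO⟩
    rw [Metric.mem_ball, Real.dist_eq, lt_min_iff, abs_lt, abs_lt] at hv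
    rw [Set.mem_ofPred_eq]
    rcases lt_trichotomy v u with h | rfl | h
    · have e : γ v = γ u + (u - v : ℝ) * -(t - s) := by
        simp only [γ]
        push_cast
        ring
      rw [e]
      exact hb₂ (u - v) (by linarith) (by linarith)
    · exact hu
    · have e : γ v = γ u + (v - u : ℝ) * (t - s) := by
        simp only [γ]
        push_cast
        ring
      rw [e]
      exact hb₁ (v - u) (by linarith) (by linarith)
  have hγ0 : γ 0 = s := by simp [γ]
  have hγ1 : γ 1 = t := by simp [γ]
  have hI : Set.Icc (0 : ℝ) 1 ⊆ γ ⁻¹' O := by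
    intro u hu
    have := hO hs ht (sub_nonneg.2 hu.2) hu.1 (by ring)
    have e : γ u = (1 - u) • s + u • t := by
      simp only [γ, Complex.real_smul]
      push_cast
      ring
    rwa [Set.mem_preimage, e]
  have := isPreconnected_Icc.subset_left_of_subset_union hAo hBo
    (Set.disjoint_left.2 fun u h1 h2 => h2.1 h1.1)
    (fun u hu => (em _).imp (⟨·, hI hu⟩) (⟨·, hI hu⟩))
    ⟨0, Set.left_mem_Icc.2 zero_le_one, by simpa only [A, Set.mem_ofPred_eq, hγ0] using h, by
      rwa [Set.mem_preimage, hγ0]⟩ (Set.right_mem_Icc.2 zero_le_one)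
  simpa only [Set.mem_ofPred_eq, hγ1] using this.1

end Interior

section Extension

variable {X : Type*} [TopologicalSpace X] {m : ℕ} {f : X → ℂ} {c : X → X → ZMod 2}
  [CompactSpace X]

lemma CocOn.exists_ball (hf : Continuous f) {s : ℂ} (h : CocOn c (f ⁻¹' {s})) :
    ∃ ε > 0, CocOn c (f ⁻¹' Metric.ball s ε) := by
  obtain ⟨O, hO, hsO, hc⟩ := h.exists_open
  obtain ⟨ε, hε, hb⟩ := exists_ball_preimage_subset hf hO hsO
  exact ⟨ε, hε, hc.mono hb⟩

variable [T2Space X] [SecondCountableTopology X]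
  [SimplyConnectedSpace X] [LocallyPathConnectedSpace X] {Λ : Coch X →ₗ[ZMod 2] ZMod 2}

lemma DiskFib.exists_local_extension (D : DiskFib m f) (hΛ : Fund (m + 3) Set.univ Λ) {t : ℂ}
    (ht : t ∈ Metric.ball (0 : ℂ) 1) :
    ∃ ε > 0, ∀ s ∈ Metric.ball t ε, ∀ c, CocOn c (f ⁻¹' {s}) →
      ∃ k, CocOn k (f ⁻¹' Metric.ball t ε) ∧ NullOn (k + c) (f ⁻¹' {s}) := by
  obtain ⟨per, hadd, hnull, hsurj⟩ := (D.torus t ht).exists_per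
  choose e he hev using hsurj
  have := fun v => (he v).exists_ball D.cont
  choose ε hε hb using this
  obtain ⟨δ, hδ, hδb⟩ := Metric.isOpen_iff.1 Metric.isOpen_ball t ht
  have hfin : ∃ η > 0, ∀ v, η ≤ ε v := by
    obtain ⟨v₀, h₀⟩ := Finite.exists_min ε
    exact ⟨ε v₀, hε v₀, h₀⟩
  obtain ⟨η, hη, hηε⟩ := hfin
  refine ⟨min η δ, lt_min hη hδ, fun s hs c hc => ?_⟩
  have hball : Metric.ball t (min η δ) ⊆ Metric.ball (0 : ℂ) 1 :=
    (Metric.ball_subset_ball (min_le_right _ _)).trans hδb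
  have hcv (v) : CocOn (e v) (f ⁻¹' Metric.ball t (min η δ)) :=
    (hb v).mono (Set.preimage_mono (Metric.ball_subset_ball ((min_le_left _ _).trans (hηε v))))
  have hsb : f ⁻¹' {s} ⊆ f ⁻¹' Metric.ball t (min η δ) :=
    Set.preimage_mono (Set.singleton_subset_iff.2 hs)
  obtain ⟨pers, hadds, hnulls, -⟩ := (D.torus s (hball hs)).exists_per
  have hinj : Function.Injective fun v => pers (e v) := by
    intro v w hvw
    have h1 : pers (e v + e w) = 0 := by
      rw [hadds _ _ ((hcv v).mono hsb) ((hcv w).mono hsb), show pers (e v) = pers (e w) from hvw]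
      ext i
      exact CharTwo.add_self_eq_zero _
    have h2 := D.nullOn_of_nullOn hΛ (convex_ball _ _) Metric.isOpen_ball hball
      ((hcv v).add (hcv w)) hs (Metric.mem_ball_self (lt_min hη hδ))
      ((hnulls _ (((hcv v).add (hcv w)).mono hsb)).1 h1)
    have h3 := (hnull _ ((he v).add (he w))).2 h2
    rw [hadd _ _ (he v) (he w), hev, hev] at h3
    ext i
    exact CharTwo.add_eq_zero.1 (congrFun h3 i)
  obtain ⟨v, hv⟩ := Finite.injective_iff_surjective.1 hinj (pers c)
  refine ⟨e v, hcv v, (hnulls _ (((hcv v).mono hsb).add hc)).1 ?_⟩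
  rw [hadds _ _ ((hcv v).mono hsb) hc, show pers (e v) = pers c from hv]
  ext i
  exact CharTwo.add_self_eq_zero _

lemma DiskFib.exists_extension (D : DiskFib m f) (hΛ : Fund (m + 3) Set.univ Λ) {s t : ℂ}
    (hs : s ∈ Metric.ball (0 : ℂ) 1) (ht : t ∈ Metric.ball (0 : ℂ) 1)
    (hc : CocOn c (f ⁻¹' {s})) :
    ∃ k, CocOn k (f ⁻¹' segment ℝ s t) ∧ NullOn (k + c) (f ⁻¹' {s}) := by
  let cl : ℝ → ℝ := fun u => max 0 (min u 1)
  let γ : ℝ → ℂ := fun u => AffineMap.lineMap s t (cl u)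
  have hγ : Continuous γ := by
    have : Continuous fun r : ℝ => (AffineMap.lineMap s t r : ℂ) := AffineMap.lineMap_continuous
    exact this.comp (by fun_prop)
  have hγD (u : ℝ) : γ u ∈ Metric.ball (0 : ℂ) 1 := by
    refine (convex_ball (0 : ℂ) 1).segment_subset hs ht ?_
    rw [segment_eq_image_lineMap]
    exact ⟨cl u, ⟨le_max_left _ _, max_le zero_le_one (min_le_right _ _)⟩, rfl⟩
  have hγ0 : γ 0 = s := by simp [γ, cl]
  have hcl : Monotone cl := fun a b h => max_le_max_left _ (min_le_min_right _ h)
  have hγi {a u b : ℝ} (hau : a ≤ u) (hub : u ≤ b) (h : γ a = γ b) : γ u = γ a := by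
    rcases eq_or_ne s t with rfl | hst
    · simp [γ]
    · have h1 := AffineMap.lineMap_injective ℝ hst h
      have h2 : cl u = cl a := le_antisymm ((hcl hub).trans h1.ge) (hcl hau)
      simp only [γ, h2]
  let P : ℝ → Prop := fun b => ∃ k, CocOn k (f ⁻¹' (γ '' Set.Icc 0 b)) ∧ NullOn (k + c) (f ⁻¹' {s})
  have hP : ∀ u v, u ≤ v → P v → P u := fun u v huv ⟨k, hk, hn⟩ =>
    ⟨k, hk.mono (Set.preimage_mono (Set.image_mono (Set.Icc_subset_Icc_right huv))), hn⟩
  have hP0 : P 0 := by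
    refine ⟨c, ?_, 0, fun p _ => ⟨Set.univ, Filter.univ_mem, fun x _ y _ => ?_⟩⟩
    · rwa [Set.Icc_self, Set.image_singleton, hγ0]
    · rw [add_self_fun]
      rfl
  have key : P 1 := by
    refine real_continuation hP hP0 (fun t₀ => ?_) 1
    obtain ⟨ε, hε, hb⟩ := D.exists_local_extension hΛ (hγD t₀)
    obtain ⟨η, hη, hηb⟩ := Metric.continuousAt_iff.1 hγ.continuousAt ε hε
    have step (u v : ℝ) (hu0 : 0 ≤ u) (hu : t₀ - η < u) (huv : u ≤ v) (hv : v < t₀ + η)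
        (h : P u) : P v := by
      obtain ⟨k, hk, hn⟩ := h
      have hwin (w : ℝ) (hw : w ∈ Set.Icc u v) : γ w ∈ Metric.ball (γ t₀) ε :=
        hηb (by rw [Real.dist_eq, abs_lt]; constructor <;> linarith [hw.1, hw.2])
      have hγu : γ u ∈ γ '' Set.Icc 0 u := ⟨u, ⟨hu0, le_rfl⟩, rfl⟩
      obtain ⟨k', hk', hn'⟩ := hb (γ u) (hwin u ⟨le_rfl, huv⟩) k
        (hk.mono (Set.preimage_mono (Set.singleton_subset_iff.2 hγu)))
      have hcl (a b : ℝ) : IsClosed (f ⁻¹' (γ '' Set.Icc a b)) :=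
        (isCompact_Icc.image hγ).isClosed.preimage D.cont
      obtain ⟨K, hK, hK1, -⟩ := exists_glue (c := k) (c' := k') (hcl 0 u) (hcl u v) hk
        (hk'.mono (Set.preimage_mono (Set.image_subset_iff.2 hwin))) (by
          rw [add_comm]
          refine hn'.mono ?_
          rintro x ⟨⟨a, ha, hax⟩, ⟨b, hb, hbx⟩⟩
          exact ((hγi ha.2 hb.1 (hax.trans hbx.symm)).trans hax).symm)
      refine ⟨K, hK.mono ?_, ?_⟩
      · rw [← Set.preimage_union, ← Set.image_union, Set.Icc_union_Icc_eq_Icc hu0 huv]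
      · have h1 := (hK1.mono (T := f ⁻¹' {s}) (Set.preimage_mono (Set.singleton_subset_iff.2
          ⟨0, ⟨le_rfl, hu0⟩, hγ0⟩))).add hn
        have e : K + k + (k + c) = K + c := by
          rw [add_assoc, ← add_assoc k k c, add_self_fun, zero_add]
        rwa [e] at h1
    refine ⟨η, hη, fun u v hu huv hv h => ?_⟩
    rcases le_or_gt 0 u with h0 | h0
    · exact step u v h0 hu huv hv h
    · rcases le_or_gt 0 v with h1 | h1
      · exact step 0 v le_rfl (hu.trans h0) h1 hv hP0
      · exact hP v 0 h1.le hP0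
  obtain ⟨k, hk, hn⟩ := key
  refine ⟨k, hk.mono (Set.preimage_mono ?_), hn⟩
  rw [segment_eq_image_lineMap]
  rintro _ ⟨u, hu, rfl⟩
  exact ⟨u, hu, by simp only [γ, cl, min_eq_left hu.2, max_eq_right hu.1]⟩

end Extension

section Edges

variable {X : Type*} [TopologicalSpace X] {m : ℕ} {f : X → ℂ} {V : Set ℂ} {c : X → X → ZMod 2}

/-- In addition to `DiskFib`, the fibres over the boundary circle are tori of dimension `m`, except
over a finite set of vertices, where the dimension is at most `m`. -/
structure EdgeFib (m : ℕ) (f : X → ℂ) (V : Set ℂ) : Prop extends DiskFib m f where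
  finite : V.Finite
  nonempty : V.Nonempty
  subset : V ⊆ Metric.sphere 0 1
  edge : ∀ x ∈ Metric.sphere (0 : ℂ) 1 \ V, IsTorus m (f ⁻¹' {x})
  vertex : ∀ x ∈ V, DimLE (f ⁻¹' {x}) m

lemma mem_segment_zero {x w : ℂ} : w ∈ segment ℝ 0 x ↔ ∃ u ∈ Set.Icc (0 : ℝ) 1, u • x = w := by
  rw [segment_eq_image]
  simp

lemma DiskFib.diff_boundary_subset (D : DiskFib m f) (U : Set ℂ) :
    f ⁻¹' U \ f ⁻¹' Metric.sphere 0 1 ⊆ f ⁻¹' (U ∩ Metric.ball 0 1) := fun x hx => ⟨hx.1, by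
  have h1 := D.mem x
  have h2 : f x ∉ Metric.sphere 0 1 := hx.2
  rw [mem_closedBall_zero_iff] at h1
  rw [mem_sphere_zero_iff_norm] at h2
  rw [mem_ball_zero_iff]
  exact lt_of_le_of_ne h1 h2⟩

variable [CompactSpace X]

lemma exists_convex_cocOn (hf : Continuous f) {K : Set ℂ} (hK : Convex ℝ K) (hKc : IsCompact K)
    (hc : CocOn c (f ⁻¹' K)) : ∃ U, IsOpen U ∧ Convex ℝ U ∧ K ⊆ U ∧ CocOn c (f ⁻¹' U) := by
  obtain ⟨O, hO, hKO, hc⟩ := hc.exists_open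
  obtain ⟨W, hW, hKW, hWO⟩ := exists_isOpen_preimage_subset hf hO hKO
  obtain ⟨δ, hδ, hδW⟩ := hKc.exists_thickening_subset_open hW hKW
  exact ⟨_, Metric.isOpen_thickening, hK.thickening δ, Metric.self_subset_thickening hδ K,
    hc.mono ((Set.preimage_mono hδW).trans hWO)⟩

lemma exists_convex_cocOn_segment (hf : Continuous f) {x : ℂ}
    (hc : CocOn c (f ⁻¹' segment ℝ 0 x)) :
    ∃ U, IsOpen U ∧ Convex ℝ U ∧ segment ℝ 0 x ⊆ U ∧ CocOn c (f ⁻¹' U) :=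
  exists_convex_cocOn hf (convex_segment _ _) (by
    rw [segment_eq_image]
    exact isCompact_Icc.image (by fun_prop)) hc

variable [T2Space X] [SecondCountableTopology X] {Λ : Coch X →ₗ[ZMod 2] ZMod 2}

lemma EdgeFib.dimLE_boundary (D : EdgeFib m f V) : DimLE (f ⁻¹' Metric.sphere 0 1) (m + 1) := by
  have hcl : IsClosed (f ⁻¹' Metric.sphere 0 1) := Metric.isClosed_sphere.preimage D.cont
  refine DimLE.of_fibers_circle hcl hcl.isCompact D.cont.continuousOn (fun x hx => by simpa using hx)
    fun t => ?_
  by_cases ht : t ∈ Metric.sphere (0 : ℂ) 1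
  · refine DimLE.mono (A := f ⁻¹' {t}) ?_ Set.inter_subset_right le_rfl
    by_cases hv : t ∈ V
    · exact D.vertex t hv
    · exact (D.edge t ⟨ht, hv⟩).dimLE
  · have : f ⁻¹' Metric.sphere 0 1 ∩ f ⁻¹' {t} = ∅ := by
      rw [← Set.preimage_inter, Set.inter_singleton_eq_empty.2 ht, Set.preimage_empty]
    rw [this]
    exact (dimLE_of_subsingleton Set.subsingleton_empty).mono subset_rfl (Nat.zero_le _)

lemma EdgeFib.thin_boundary (D : EdgeFib m f V) (hΛ : Fund (m + 3) Set.univ Λ) :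
    Thin (f ⁻¹' Metric.sphere 0 1) :=
  hΛ.thin D.locEuc.dimLE D.locEuc (Metric.isClosed_sphere.preimage D.cont) D.dimLE_boundary
    (by omega)

variable [SimplyConnectedSpace X] [LocallyPathConnectedSpace X]

lemma EdgeFib.exists_extension_edge (D : EdgeFib m f V) (hΛ : Fund (m + 3) Set.univ Λ) {x : ℂ}
    (hx : x ∈ Metric.sphere (0 : ℂ) 1) (hc : CocOn c (f ⁻¹' {x})) :
    ∃ k, CocOn k (f ⁻¹' segment ℝ 0 x) ∧ NullOn (k + c) (f ⁻¹' {x}) := by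
  have hx1 : ‖x‖ = 1 := by simpa using hx
  obtain ⟨ε, hε, hb⟩ := hc.exists_ball D.cont
  obtain ⟨δ, hδ, hδ1, hδε⟩ : ∃ δ > 0, δ < 1 ∧ δ < ε := by
    obtain ⟨δ, h1, h2⟩ := exists_between (lt_min one_pos hε)
    exact ⟨δ, h1, h2.trans_le (min_le_left _ _), h2.trans_le (min_le_right _ _)⟩
  set s : ℂ := (1 - δ) • x with hsx
  have hs : s ∈ Metric.ball (0 : ℂ) 1 := by
    rw [mem_ball_zero_iff, hsx, norm_smul, hx1, mul_one, Real.norm_eq_abs, abs_of_pos (by linarith)]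
    linarith
  have hnorm {u : ℝ} (hu : u ∈ Set.Icc (0 : ℝ) 1) : ‖u • x‖ = u := by
    rw [norm_smul, hx1, mul_one, Real.norm_eq_abs, abs_of_nonneg hu.1]
  have hball {u : ℝ} (hu : u ∈ Set.Icc (0 : ℝ) 1) (h : 1 - δ ≤ u) : u • x ∈ Metric.ball x ε := by
    have : u • x - x = (u - 1) • x := by rw [sub_smul, one_smul]
    rw [Metric.mem_ball, dist_eq_norm, this, norm_smul, hx1, mul_one, Real.norm_eq_abs, abs_lt]
    constructor <;> linarith [hu.2]
  have hsb : s ∈ Metric.ball x ε := hball ⟨by linarith, by linarith⟩ le_rfl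
  obtain ⟨k, hk, hn⟩ := D.exists_extension hΛ hs (Metric.mem_ball_self one_pos)
    (hb.mono (Set.preimage_mono (Set.singleton_subset_iff.2 hsb)))
  have hseg : IsClosed (segment ℝ 0 x) := by
    rw [segment_eq_image]
    exact (isCompact_Icc.image (by fun_prop)).isClosed
  set A : Set ℂ := segment ℝ 0 x ∩ {w | ‖w‖ ≤ 1 - δ}
  set B : Set ℂ := segment ℝ 0 x ∩ {w | 1 - δ ≤ ‖w‖}
  have hA : IsClosed A := hseg.inter (isClosed_le (by fun_prop) (by fun_prop))
  have hB : IsClosed B := hseg.inter (isClosed_le (by fun_prop) (by fun_prop))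
  have hAs : A ⊆ segment ℝ s 0 := by
    rintro w ⟨hw, hw1⟩
    obtain ⟨u, hu, rfl⟩ := mem_segment_zero.1 hw
    rw [Set.mem_ofPred_eq, hnorm hu] at hw1
    rw [segment_symm, mem_segment_zero]
    have : 0 < 1 - δ := by linarith
    exact ⟨u / (1 - δ), ⟨div_nonneg hu.1 this.le, (div_le_one this).2 hw1⟩, by
      rw [hsx, smul_smul, div_mul_cancel₀ _ this.ne']⟩
  have hBb : B ⊆ Metric.ball x ε := by
    rintro w ⟨hw, hw1⟩
    obtain ⟨u, hu, rfl⟩ := mem_segment_zero.1 hw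
    rw [Set.mem_ofPred_eq, hnorm hu] at hw1
    exact hball hu hw1
  obtain ⟨K, hK, -, hK2⟩ := exists_glue (hA.preimage D.cont) (hB.preimage D.cont)
    (hk.mono (Set.preimage_mono hAs)) (hb.mono (Set.preimage_mono hBb)) (hn.mono (by
      rw [← Set.preimage_inter]
      refine Set.preimage_mono ?_
      rintro w ⟨⟨hw, hw1⟩, -, hw2⟩
      obtain ⟨u, hu, rfl⟩ := mem_segment_zero.1 hw
      rw [Set.mem_ofPred_eq, hnorm hu] at hw1 hw2
      rw [Set.mem_singleton_iff, hsx, le_antisymm hw1 hw2]))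
  refine ⟨K, hK.mono ?_, hK2.mono (Set.preimage_mono (Set.singleton_subset_iff.2
    ⟨right_mem_segment ℝ 0 x, by rw [Set.mem_ofPred_eq, hx1]; linarith⟩))⟩
  rw [← Set.preimage_union, ← Set.inter_union_distrib_left]
  refine Set.preimage_mono fun w hw => ⟨hw, ?_⟩
  exact le_total ‖w‖ (1 - δ)

lemma EdgeFib.nullOn_iff (D : EdgeFib m f V) (hΛ : Fund (m + 3) Set.univ Λ) {x : ℂ}
    (hx : x ∈ Metric.closedBall (0 : ℂ) 1) (hc : CocOn c (f ⁻¹' segment ℝ 0 x)) :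
    NullOn c (f ⁻¹' {x}) ↔ NullOn c (f ⁻¹' {0}) := by
  obtain ⟨U, hU, hUc, hxU, hcU⟩ := exists_convex_cocOn_segment D.cont hc
  have h0U := hxU (left_mem_segment ℝ 0 x)
  have h0 : (0 : ℂ) ∈ Metric.ball (0 : ℂ) 1 := Metric.mem_ball_self one_pos
  have hO : IsOpen (U ∩ Metric.ball 0 1) := hU.inter Metric.isOpen_ball
  have hOc : Convex ℝ (U ∩ Metric.ball 0 1) := hUc.inter (convex_ball _ _)
  have hcO : CocOn c (f ⁻¹' (U ∩ Metric.ball 0 1)) :=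
    hcU.mono (Set.preimage_mono Set.inter_subset_left)
  rw [mem_closedBall_zero_iff] at hx
  constructor
  · intro h
    obtain ⟨ε, hε, hb⟩ := h.exists_ball D.cont
    obtain ⟨δ, hδ, hδ1⟩ := exists_between (lt_min one_pos hε)
    have h1 := hδ1.trans_le (min_le_left _ _)
    have h2 := hδ1.trans_le (min_le_right _ _)
    have hs : (1 - δ) • x ∈ U ∩ Metric.ball 0 1 := by
      refine ⟨hxU (mem_segment_zero.2 ⟨1 - δ, ⟨by linarith, by linarith⟩, rfl⟩), ?_⟩
      rw [mem_ball_zero_iff, norm_smul, Real.norm_eq_abs, abs_of_pos (by linarith)]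
      nlinarith
    refine D.nullOn_of_nullOn hΛ hOc hO Set.inter_subset_right hcO hs ⟨h0U, h0⟩ (hb.mono ?_)
    refine Set.preimage_mono (Set.singleton_subset_iff.2 ?_)
    have : (1 - δ) • x - x = (-δ) • x := by
      rw [sub_smul, one_smul, neg_smul]
      abel
    rw [Metric.mem_ball, dist_eq_norm, this, norm_smul, norm_neg, Real.norm_eq_abs, abs_of_pos hδ]
    nlinarith
  · intro h
    obtain ⟨g, hg⟩ := nullOn_preimage_of_isOpen (c := c) D.cont hO hOc
      (fun t ht => D.conn t (Metric.ball_subset_closedBall ht.2)) fun t ht =>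
        D.nullOn_of_nullOn hΛ hOc hO Set.inter_subset_right hcO ⟨h0U, h0⟩ ht h
    obtain ⟨g', hg', -⟩ := hcU.exists_extend (hU.preimage D.cont) (D.thin_boundary hΛ)
      (hg.mono (D.diff_boundary_subset U))
    exact ⟨g', hg'.mono (Set.preimage_mono
      (Set.singleton_subset_iff.2 (hxU (right_mem_segment ℝ 0 x))))⟩

end Edges

section Counting

lemma exists_range_of_locally_constant {α : Type*} {J : Set ℝ} (hJ : J.OrdConnected) (T : Finset ℝ)
    {h : ℝ → α} (hh : ∀ θ ∈ J, θ ∉ T → ∀ᶠ θ' in 𝓝[J] θ, h θ' = h θ) (a : α) :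
    ∃ H : ℕ → α, (∀ k, H k = a ∨ ∃ θ ∈ J, θ ∉ T ∧ h θ = H k) ∧
      ∀ θ ∈ J, θ ∉ T → ∃ k ∈ Finset.range (T.card + 1), h θ = H k := by
  classical
  let j : ℝ → ℕ := fun θ => (T.filter (· < θ)).card
  have hlt : ∀ θ ∈ J, θ ∉ T → ∀ θ' ∈ J, θ' ∉ T → θ ≤ θ' → j θ = j θ' → h θ = h θ' := by
    intro θ hθ hθT θ' hθ' hθT' hle hj
    have hsub : Set.Icc θ θ' ⊆ J := hJ.out hθ hθ'
    have hd : ∀ τ ∈ Set.Icc θ θ', τ ∉ T := by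
      intro τ hτ hτT
      have h1 : τ < θ' := lt_of_le_of_ne hτ.2 fun e => hθT' (e ▸ hτT)
      have h2 : T.filter (· < θ) ⊂ T.filter (· < θ') := by
        rw [Finset.ssubset_iff_of_subset (Finset.monotone_filter_right T fun x _ hx =>
          lt_of_lt_of_le hx hle)]
        exact ⟨τ, by simp [hτT, h1], by simp [hτ.1]⟩
      exact (Finset.card_lt_card h2).ne hj
    let _ : TopologicalSpace α := ⊥
    have : DiscreteTopology α := ⟨rfl⟩
    refine isPreconnected_Icc.constant (f := h) (fun τ hτ => ?_) (Set.left_mem_Icc.2 hle)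
      (Set.right_mem_Icc.2 hle)
    exact (tendsto_const_nhds (x := h τ)).congr'
      (((hh τ (hsub hτ) (hd τ hτ)).filter_mono (nhdsWithin_mono _ hsub)).mono fun _ e => e.symm)
  have heq : ∀ θ ∈ J, θ ∉ T → ∀ θ' ∈ J, θ' ∉ T → j θ = j θ' → h θ = h θ' := by
    intro θ hθ hθT θ' hθ' hθT' hj
    rcases le_total θ θ' with hle | hle
    · exact hlt θ hθ hθT θ' hθ' hθT' hle hj
    · exact (hlt θ' hθ' hθT' θ hθ hθT hle hj.symm).symm
  refine ⟨fun k => if hk : ∃ θ ∈ J, θ ∉ T ∧ j θ = k then h hk.choose else a, fun k => ?_,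
    fun θ hθ hθT => ⟨j θ, ?_, ?_⟩⟩
  · by_cases hk : ∃ θ ∈ J, θ ∉ T ∧ j θ = k
    · exact Or.inr ⟨hk.choose, hk.choose_spec.1, hk.choose_spec.2.1, by simp only [dif_pos hk]⟩
    · exact Or.inl (by simp only [dif_neg hk])
  · exact Finset.mem_range_succ_iff.2 (Finset.card_filter_le _ _)
  · have hk : ∃ θ' ∈ J, θ' ∉ T ∧ j θ' = j θ := ⟨θ, hθ, hθT, rfl⟩
    simp only [dif_pos hk]
    exact heq θ hθ hθT _ hk.choose_spec.1 hk.choose_spec.2.1 hk.choose_spec.2.2.symm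

lemma finrank_le_finrank_inf_add {K W : Type*} [Field K] [AddCommGroup W] [Module K W]
    [FiniteDimensional K W] {m : ℕ} (hW : Module.finrank K W = m + 1) (E : ℕ → Submodule K W)
    (hE : ∀ k, m ≤ Module.finrank K (E k)) (s : Finset ℕ) :
    m + 1 ≤ Module.finrank K (s.inf E : Submodule K W) + s.card := by
  classical
  induction s using Finset.induction_on with
  | empty => rw [Finset.inf_empty, finrank_top, hW, Finset.card_empty]
  | insert k s hk ih =>
    rw [Finset.inf_insert, Finset.card_insert_of_notMem hk]
    have h1 := Submodule.finrank_sup_add_finrank_inf_eq (E k) (s.inf E)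
    have h2 := Submodule.finrank_le (E k ⊔ s.inf E)
    have h3 := hE k
    omega

lemma exists_angle {x y : ℂ} {θ₀ : ℝ} (hy : y = Complex.exp (θ₀ * Complex.I))
    (hx : x ∈ Metric.sphere (0 : ℂ) 1) (hxy : x ≠ y) :
    ∃ θ ∈ Set.Ioo θ₀ (θ₀ + 2 * Real.pi), Complex.exp (θ * Complex.I) = x := by
  have hx1 : ‖x‖ = 1 := by simpa using hx
  refine ⟨toIcoMod Real.two_pi_pos θ₀ x.arg, ?_, ?_⟩
  · have h1 := toIcoMod_mem_Ico Real.two_pi_pos θ₀ x.arg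
    refine ⟨lt_of_le_of_ne h1.1 fun e => hxy ?_, h1.2⟩
    rw [hy, e]
    have := Complex.norm_mul_exp_arg_mul_I x
    rw [hx1, Complex.ofReal_one, one_mul] at this
    conv_lhs => rw [← this]
    rw [toIcoMod, Complex.exp_eq_exp_iff_exists_int]
    exact ⟨toIcoDiv Real.two_pi_pos θ₀ x.arg, by push_cast; simp; ring⟩
  · have := Complex.norm_mul_exp_arg_mul_I x
    rw [hx1, Complex.ofReal_one, one_mul] at this
    conv_rhs => rw [← this]
    rw [toIcoMod, Complex.exp_eq_exp_iff_exists_int]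
    exact ⟨-toIcoDiv Real.two_pi_pos θ₀ x.arg, by push_cast; simp; ring⟩

/-- A locally constant family of hyperplanes on the complement of `r` points of the circle, in
a space of dimension greater than `r`, has a common nonzero vector. -/
lemma exists_common_vector {K W : Type*} [Field K] [AddCommGroup W] [Module K W]
    [FiniteDimensional K W] {m : ℕ} (hW : Module.finrank K W = m + 1) {V : Set ℂ} (hV : V.Finite)
    (hne : V.Nonempty) (hVs : V ⊆ Metric.sphere 0 1) (hcard : V.ncard ≤ m) (E : ℂ → Submodule K W)
    (hE : ∀ x ∈ Metric.sphere (0 : ℂ) 1 \ V, m ≤ Module.finrank K (E x))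
    (hloc : ∀ x ∈ Metric.sphere (0 : ℂ) 1 \ V,
      ∀ᶠ y in 𝓝 x, y ∈ Metric.sphere (0 : ℂ) 1 \ V → E y = E x) :
    ∃ v ≠ 0, ∀ x ∈ Metric.sphere (0 : ℂ) 1 \ V, v ∈ E x := by
  classical
  obtain ⟨v₁, hv₁⟩ := hne
  set θ₀ := v₁.arg
  have hv₁' : v₁ = Complex.exp (θ₀ * Complex.I) := by
    have := Complex.norm_mul_exp_arg_mul_I v₁
    rw [show ‖v₁‖ = 1 by simpa using hVs hv₁, Complex.ofReal_one, one_mul] at this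
    exact this.symm
  have hang : ∀ x ∈ Metric.sphere (0 : ℂ) 1, x ≠ v₁ →
      ∃ θ ∈ Set.Ioo θ₀ (θ₀ + 2 * Real.pi), Complex.exp (θ * Complex.I) = x := fun x hx hxv =>
    exists_angle hv₁' hx hxv
  choose! a haJ ha using hang
  set J := Set.Ioo θ₀ (θ₀ + 2 * Real.pi)
  set T : Finset ℝ := (hV.toFinset.erase v₁).image a with hT
  have hTc : T.card + 1 ≤ m := by
    have h1 : T.card ≤ (hV.toFinset.erase v₁).card := Finset.card_image_le
    rw [Finset.card_erase_of_mem (hV.mem_toFinset.2 hv₁), ← Set.ncard_eq_toFinset_card V hV] at h1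
    have h2 : 0 < V.ncard := (Set.ncard_pos hV).2 ⟨v₁, hv₁⟩
    omega
  have hmem : ∀ θ : ℝ, Complex.exp (θ * Complex.I) ∈ Metric.sphere (0 : ℂ) 1 := fun θ => by
    simp [Complex.norm_exp_ofReal_mul_I]
  have hinj : ∀ θ ∈ J, ∀ θ' ∈ J, Complex.exp (θ * Complex.I) = Complex.exp (θ' * Complex.I) →
      θ = θ' := by
    intro θ hθ θ' hθ' he
    obtain ⟨n, hn⟩ := Complex.exp_eq_exp_iff_exists_int.1 he
    have hn' : θ = θ' + n * (2 * Real.pi) := by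
      have := congrArg Complex.im hn
      simpa using this
    have hp := Real.pi_pos
    have h1 : (-1 : ℝ) < n := by
      by_contra hcon
      nlinarith [hθ.1, hθ.2, hθ'.1, hθ'.2]
    have h2 : (n : ℝ) < 1 := by
      by_contra hcon
      nlinarith [hθ.1, hθ.2, hθ'.1, hθ'.2]
    have h3 : n = 0 := by
      have h4 : (-1 : ℤ) < n := by exact_mod_cast h1
      have h5 : n < (1 : ℤ) := by exact_mod_cast h2
      omega
    rw [hn', h3]
    simp
  have hnv : ∀ θ ∈ J, Complex.exp (θ * Complex.I) ≠ v₁ := by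
    intro θ hθ he
    rw [hv₁'] at he
    obtain ⟨n, hn⟩ := Complex.exp_eq_exp_iff_exists_int.1 he
    have hn' : θ = θ₀ + n * (2 * Real.pi) := by
      have := congrArg Complex.im hn
      simpa using this
    have hp := Real.pi_pos
    have h1 : (0 : ℝ) < n := by
      by_contra hcon
      nlinarith [hθ.1, hθ.2]
    have h2 : (n : ℝ) < 1 := by
      by_contra hcon
      nlinarith [hθ.1, hθ.2]
    have h4 : (0 : ℤ) < n := by exact_mod_cast h1
    have h5 : n < (1 : ℤ) := by exact_mod_cast h2
    omega
  have hTV : ∀ θ ∈ J, (θ ∉ T ↔ Complex.exp (θ * Complex.I) ∈ Metric.sphere (0 : ℂ) 1 \ V) := by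
    intro θ hθ
    constructor
    · refine fun h => ⟨hmem θ, fun hv => h ?_⟩
      refine Finset.mem_image.2 ⟨_, Finset.mem_erase.2 ⟨hnv θ hθ, hV.mem_toFinset.2 hv⟩, ?_⟩
      exact hinj _ (haJ _ (hmem θ) (hnv θ hθ)) _ hθ (ha _ (hmem θ) (hnv θ hθ))
    · intro h hθT
      obtain ⟨x, hx, rfl⟩ := Finset.mem_image.1 hθT
      obtain ⟨hx1, hx2⟩ := Finset.mem_erase.1 hx
      have hx3 := hV.mem_toFinset.1 hx2
      rw [ha x (hVs hx3) hx1] at h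
      exact h.2 hx3
  obtain ⟨H, hH1, hH2⟩ := exists_range_of_locally_constant (J := J) Set.ordConnected_Ioo T
    (h := fun θ => E (Complex.exp (θ * Complex.I))) (fun θ hθ hθT => by
      have h1 : Continuous fun θ : ℝ => Complex.exp (θ * Complex.I) := by fun_prop
      have h2 := h1.continuousAt.eventually (hloc _ ((hTV θ hθ).1 hθT))
      have h3 : ∀ᶠ θ' : ℝ in 𝓝 θ, θ' ∉ T :=
        (T.finite_toSet.isClosed.isOpen_compl.mem_nhds hθT)
      filter_upwards [nhdsWithin_le_nhds h2, nhdsWithin_le_nhds h3, self_mem_nhdsWithin]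
        with θ' e1 e2 e3
      exact e1 ((hTV θ' e3).1 e2)) ⊤
  have hfr := finrank_le_finrank_inf_add hW H (fun k => by
    rcases hH1 k with h | ⟨θ, hθ, hθT, h⟩
    · rw [h, finrank_top]
      omega
    · rw [← h]
      exact hE _ ((hTV θ hθ).1 hθT)) (Finset.range (T.card + 1))
  rw [Finset.card_range] at hfr
  obtain ⟨v, hv, hv0⟩ := Submodule.exists_mem_ne_zero_of_ne_bot
    (p := (Finset.range (T.card + 1)).inf H) fun hb => by
      rw [hb, finrank_bot] at hfr
      omega
  refine ⟨v, hv0, fun x hx => ?_⟩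
  have hxv : x ≠ v₁ := fun e => hx.2 (e ▸ hv₁)
  have hJ := haJ x hx.1 hxv
  have hax := ha x hx.1 hxv
  obtain ⟨k, hk, he⟩ := hH2 (a x) hJ ((hTV _ hJ).2 (hax.symm ▸ hx))
  have : E x = H k := by rw [← he, hax]
  rw [this]
  exact Finset.inf_le (f := H) hk hv

end Counting

section Periods

lemma add_eq_zero_zmod_two {ι : Type*} {v w : ι → ZMod 2} : v + w = 0 ↔ v = w := by
  simp only [funext_iff, Pi.add_apply, Pi.zero_apply, CharTwo.add_eq_zero]

variable {X : Type*} [TopologicalSpace X] {m : ℕ} {f : X → ℂ} {V : Set ℂ}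
  [CompactSpace X] [T2Space X] [SecondCountableTopology X] {Λ : Coch X →ₗ[ZMod 2] ZMod 2}
  [SimplyConnectedSpace X] [LocallyPathConnectedSpace X]
  {per : (X → X → ZMod 2) → Fin (m + 1) → ZMod 2}

lemma EdgeFib.exists_submodule (D : EdgeFib m f V) (hΛ : Fund (m + 3) Set.univ Λ)
    (hadd : ∀ c c', CocOn c (f ⁻¹' {0}) → CocOn c' (f ⁻¹' {0}) → per (c + c') = per c + per c')
    (hnull : ∀ c, CocOn c (f ⁻¹' {0}) → (per c = 0 ↔ NullOn c (f ⁻¹' {0}))) {x : ℂ}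
    (hx : x ∈ Metric.sphere (0 : ℂ) 1 \ V) :
    ∃ E : Submodule (ZMod 2) (Fin (m + 1) → ZMod 2), Module.finrank (ZMod 2) E = m ∧
      ∀ v, v ∈ E ↔ ∃ c, CocOn c (f ⁻¹' segment ℝ 0 x) ∧ per c = v := by
  obtain ⟨per', hadd', hnull', hsurj'⟩ := (D.edge x hx).exists_per
  have hx' : f ⁻¹' {x} ⊆ f ⁻¹' segment ℝ 0 x :=
    Set.preimage_mono (Set.singleton_subset_iff.2 (right_mem_segment ℝ 0 x))
  have h0' : f ⁻¹' {0} ⊆ f ⁻¹' segment ℝ 0 x :=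
    Set.preimage_mono (Set.singleton_subset_iff.2 (left_mem_segment ℝ 0 x))
  have hxc := Metric.sphere_subset_closedBall hx.1
  have key : ∀ c c', CocOn c (f ⁻¹' segment ℝ 0 x) → CocOn c' (f ⁻¹' segment ℝ 0 x) →
      (per' c = per' c' ↔ per c = per c') := by
    intro c c' hc hc'
    have h1 := D.nullOn_iff hΛ hxc (hc.add hc')
    rw [← hnull' _ ((hc.add hc').mono hx'), ← hnull _ ((hc.add hc').mono h0'),
      hadd' _ _ (hc.mono hx') (hc'.mono hx'), hadd _ _ (hc.mono h0') (hc'.mono h0')] at h1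
    rwa [add_eq_zero_zmod_two, add_eq_zero_zmod_two] at h1
  have hext : ∀ w, ∃ c, CocOn c (f ⁻¹' segment ℝ 0 x) ∧ per' c = w := by
    intro w
    obtain ⟨c, hc, hw⟩ := hsurj' w
    obtain ⟨k, hk, hn⟩ := D.exists_extension_edge hΛ hx.1 hc
    refine ⟨k, hk, ?_⟩
    rw [← hnull' _ ((hk.mono hx').add hc), hadd' _ _ (hk.mono hx') hc, add_eq_zero_zmod_two] at hn
    rw [hn, hw]
  choose k hk hkw using hext
  let L : (Fin m → ZMod 2) →+ (Fin (m + 1) → ZMod 2) := AddMonoidHom.mk' (fun w => per (k w))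
    fun w w' => by
      rw [← hadd _ _ ((hk w).mono h0') ((hk w').mono h0'),
        ← key _ _ (hk _) ((hk w).add (hk w')), hadd' _ _ ((hk w).mono hx') ((hk w').mono hx'),
        hkw, hkw, hkw]
  refine ⟨LinearMap.range (L.toZModLinearMap 2), ?_, fun v => ⟨?_, ?_⟩⟩
  · rw [LinearMap.finrank_range_of_inj, Module.finrank_fin_fun]
    intro w w' h
    have h : per (k w) = per (k w') := h
    rwa [← key _ _ (hk w) (hk w'), hkw, hkw] at h
  · rintro ⟨w, rfl⟩
    exact ⟨k w, hk w, rfl⟩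
  · rintro ⟨c, hc, rfl⟩
    exact ⟨per' c, (key _ _ (hk _) hc).1 (hkw _)⟩

lemma EdgeFib.exists_period (D : EdgeFib m f V) (hΛ : Fund (m + 3) Set.univ Λ)
    (hadd : ∀ c c', CocOn c (f ⁻¹' {0}) → CocOn c' (f ⁻¹' {0}) → per (c + c') = per c + per c')
    (hnull : ∀ c, CocOn c (f ⁻¹' {0}) → (per c = 0 ↔ NullOn c (f ⁻¹' {0}))) (hV : V.ncard ≤ m) :
    ∃ v ≠ 0, ∀ x ∈ Metric.sphere (0 : ℂ) 1 \ V, ∃ c, CocOn c (f ⁻¹' segment ℝ 0 x) ∧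
      per c = v := by
  have hex : ∀ x ∈ Metric.sphere (0 : ℂ) 1 \ V, _ := fun x hx =>
    D.exists_submodule hΛ hadd hnull hx
  choose! E hEr hE using hex
  obtain ⟨v, hv, h⟩ := exists_common_vector (K := ZMod 2) (W := Fin (m + 1) → ZMod 2)
    (Module.finrank_fin_fun _) D.finite D.nonempty D.subset hV E (fun x hx => (hEr x hx).ge)
    fun x hx => by
      have h1 : ∀ v ∈ (E x : Set (Fin (m + 1) → ZMod 2)), ∀ᶠ y in 𝓝 x,
          y ∈ Metric.sphere (0 : ℂ) 1 \ V → v ∈ E y := by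
        intro v hv
        obtain ⟨c, hc, hcv⟩ := (hE x hx v).1 hv
        obtain ⟨U, hU, hUc, hxU, hcU⟩ := exists_convex_cocOn_segment D.cont hc
        filter_upwards [hU.mem_nhds (hxU (right_mem_segment ℝ 0 x))] with y hy hyV
        exact (hE y hyV v).2 ⟨c, hcU.mono (Set.preimage_mono
          (hUc.segment_subset (hxU (left_mem_segment ℝ 0 x)) hy)), hcv⟩
      filter_upwards [(Filter.eventually_all_finite (Set.toFinite _)).2 h1] with y hy hyV
      exact (Submodule.eq_of_le_of_finrank_eq (fun v hv => hy v hv hyV)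
        ((hEr x hx).trans (hEr y hyV).symm)).symm
  exact ⟨v, hv, fun x hx => (hE x hx v).1 (h x hx)⟩

end Periods

section Core

variable {X : Type*} [TopologicalSpace X] {m : ℕ} {f : X → ℂ} {V : Set ℂ} {c : X → X → ZMod 2}

lemma EdgeFib.isClosed_vertices (D : EdgeFib m f V) : IsClosed (f ⁻¹' V) :=
  D.finite.isClosed.preimage D.cont

lemma EdgeFib.zero_notMem (D : EdgeFib m f V) : (0 : ℂ) ∉ V := fun h => by
  have := D.subset h
  simp at this

variable [CompactSpace X] [T2Space X]

lemma EdgeFib.dimLE_vertices (D : EdgeFib m f V) : DimLE (f ⁻¹' V) m := by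
  have key : ∀ s : Set ℂ, s.Finite → s ⊆ V → DimLE (f ⁻¹' s) m := by
    intro s hs
    induction s, hs using Set.Finite.induction_on with
    | empty =>
      exact fun _ => (dimLE_of_subsingleton Set.subsingleton_empty).mono subset_rfl (Nat.zero_le m)
    | @insert a s _ hs ih =>
      intro h
      rw [Set.insert_eq, Set.preimage_union]
      exact DimLE.union (isClosed_singleton.preimage D.cont) (hs.isClosed.preimage D.cont)
        (D.vertex a (h (Set.mem_insert a s))) (ih ((Set.subset_insert a s).trans h))
  exact key V D.finite subset_rfl

variable [SecondCountableTopology X] {Λ : Coch X →ₗ[ZMod 2] ZMod 2}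
  [SimplyConnectedSpace X] [LocallyPathConnectedSpace X]

lemma EdgeFib.nullOn_compl_vertices (D : EdgeFib m f V) (hΛ : Fund (m + 3) Set.univ Λ)
    (hc : CocOn c (f ⁻¹' V)ᶜ) : NullOn c (f ⁻¹' V)ᶜ := by
  have hF := D.isClosed_vertices
  have hFd := D.dimLE_vertices
  have hdim := D.locEuc.dimLE
  refine CocOn.nullOn_compl_of_thin (hΛ.thin hdim D.locEuc hF hFd (by omega)) hF hc fun z _ => ?_
  obtain ⟨e, he, hze, -⟩ := D.locEuc.exists_cell (x := z) Filter.univ_mem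
  refine ⟨cell e, isOpen_cell e, hze, hΛ.nullOn_diff hdim D.locEuc hF
    (hFd.mono subset_rfl (Nat.le_succ m)) he (hc.mono fun x hx => hx.2) fun α hα _ hα' => ?_⟩
  obtain ⟨ψ, hψ, -, hψ0⟩ := hFd _ subset_rfl hF ∅ isClosed_empty (m + 1) m.lt_succ_self α
    ⟨hα, fun p hp => hp.elim, hα'⟩
  have hσc : α + d ψ ∈ Cc X (m + 2) := add_mem hα (d_mem_Cc hψ)
  have h7 := hc.d_cup_add_mem hσc hψ0
  rw [Set.compl_union_self] at h7
  have h8 := hΛ.z_zero _ h7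
  have h10 := hΛ.d_zero (cup c (α + d ψ)) (cup_mem_Cc _ hσc) (by simp [mem_Z])
  rwa [map_add, h10, map_add d, d_d, add_zero, zero_add] at h8

lemma EdgeFib.exists_global (D : EdgeFib m f V) (hΛ : Fund (m + 3) Set.univ Λ)
    (c : ℂ → X → X → ZMod 2)
    (hc : ∀ x ∈ Metric.closedBall (0 : ℂ) 1 \ V, CocOn (c x) (f ⁻¹' segment ℝ 0 x))
    (hcc : ∀ x ∈ Metric.closedBall (0 : ℂ) 1 \ V, ∀ y ∈ Metric.closedBall (0 : ℂ) 1 \ V,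
      NullOn (c x + c y) (f ⁻¹' {0})) :
    ∃ b, CocOn b (f ⁻¹' V)ᶜ ∧ NullOn (b + c 0) (f ⁻¹' {0}) := by
  have h0 : (0 : ℂ) ∈ Metric.ball (0 : ℂ) 1 := Metric.mem_ball_self one_pos
  obtain ⟨p₀, hp₀⟩ := (D.conn 0 (Metric.ball_subset_closedBall h0)).nonempty
  have hp₀ : f p₀ = 0 := hp₀
  have hex : ∀ x ∈ Metric.closedBall (0 : ℂ) 1 \ V, _ := fun x hx =>
    exists_convex_cocOn_segment D.cont (hc x hx)
  choose! U hU hUc hxU hcU using hex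
  have h0U : ∀ x ∈ Metric.closedBall (0 : ℂ) 1 \ V, 0 ∈ U x := fun x hx =>
    hxU x hx (left_mem_segment ℝ 0 x)
  have hex : ∀ x y, ∃ g, x ∈ Metric.closedBall (0 : ℂ) 1 \ V → y ∈ Metric.closedBall (0 : ℂ) 1 \ V →
      NullBy (c x + c y) g (f ⁻¹' (U x ∩ U y ∩ Metric.ball 0 1)) ∧ g p₀ = 0 := by
    intro x y
    by_cases hx : x ∈ Metric.closedBall (0 : ℂ) 1 \ V
    · by_cases hy : y ∈ Metric.closedBall (0 : ℂ) 1 \ V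
      · have hO : IsOpen (U x ∩ U y ∩ Metric.ball 0 1) :=
          ((hU x hx).inter (hU y hy)).inter Metric.isOpen_ball
        have hOc : Convex ℝ (U x ∩ U y ∩ Metric.ball 0 1) :=
          ((hUc x hx).inter (hUc y hy)).inter (convex_ball _ _)
        have hcO : CocOn (c x + c y) (f ⁻¹' (U x ∩ U y ∩ Metric.ball 0 1)) :=
          ((hcU x hx).mono (Set.preimage_mono fun w hw => hw.1.1)).add
            ((hcU y hy).mono (Set.preimage_mono fun w hw => hw.1.2))
        obtain ⟨g, hg⟩ := (nullOn_preimage_of_isOpen D.cont hO hOc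
          (fun t ht => D.conn t (Metric.ball_subset_closedBall ht.2)) fun t ht =>
            D.nullOn_of_nullOn hΛ hOc hO Set.inter_subset_right hcO
              ⟨⟨h0U x hx, h0U y hy⟩, h0⟩ ht (hcc x hx y hy)).exists_eq_zero p₀
        exact ⟨g, fun _ _ => hg⟩
      · exact ⟨0, fun _ h => (hy h).elim⟩
    · exact ⟨0, fun h => (hx h).elim⟩
  choose g hg using hex
  have hmem : ∀ p ∈ (f ⁻¹' V)ᶜ, f p ∈ Metric.closedBall (0 : ℂ) 1 \ V := fun p hp => ⟨D.mem p, hp⟩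
  have hp₀N : p₀ ∈ (f ⁻¹' V)ᶜ := fun h => D.zero_notMem (hp₀ ▸ h)
  obtain ⟨b, hb, hbn⟩ := exists_glue_thin D.isClosed_vertices.isOpen_compl (D.thin_boundary hΛ) hp₀N
    (fun p => f ⁻¹' U (f p)) (fun p hp => (hU _ (hmem p hp)).preimage D.cont)
    (fun p hp => hxU _ (hmem p hp) (right_mem_segment ℝ 0 (f p))) (fun p => c (f p))
    (fun p q => g (f p) (f q))
    (fun p hp => (hcU _ (hmem p hp)).mono Set.inter_subset_left)
    (fun p hp q hq => (hg _ _ (hmem p hp) (hmem q hq)).1.mono fun x hx =>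
      D.diff_boundary_subset (U (f p) ∩ U (f q)) ⟨hx.1.1, hx.2⟩)
    (fun p hp q hq r hr x hx => by
      obtain ⟨h1, e1⟩ := hg _ _ (hmem p hp) (hmem q hq)
      obtain ⟨h2, e2⟩ := hg _ _ (hmem q hq) (hmem r hr)
      obtain ⟨h3, e3⟩ := hg _ _ (hmem p hp) (hmem r hr)
      set K := U (f p) ∩ U (f q) ∩ U (f r) ∩ Metric.ball 0 1
      have hK : Convex ℝ K :=
        (((hUc _ (hmem p hp)).inter (hUc _ (hmem q hq))).inter (hUc _ (hmem r hr))).inter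
          (convex_ball _ _)
      have h12 : NullBy (c (f p) + c (f q) + (c (f q) + c (f r))) _ (f ⁻¹' K) :=
        (h1.mono (Set.preimage_mono fun w hw => ⟨hw.1.1, hw.2⟩)).add
          (h2.mono (Set.preimage_mono fun w hw => ⟨⟨hw.1.1.2, hw.1.2⟩, hw.2⟩))
      have e : c (f p) + c (f q) + (c (f q) + c (f r)) = c (f p) + c (f r) := by
        rw [add_assoc, ← add_assoc (c (f q)), add_self_fun, zero_add]
      rw [e] at h12
      refine h12.eq_of_preconnected (h3.mono (Set.preimage_mono fun w hw => ⟨⟨hw.1.1.1, hw.1.2⟩, hw.2⟩))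
        (D.isPreconnected hK) (x := p₀) ?_
        (D.diff_boundary_subset (U (f p) ∩ U (f q) ∩ U (f r)) ⟨hx.1.1, hx.2⟩) ?_
      · rw [Set.mem_preimage, hp₀]
        exact ⟨⟨⟨h0U _ (hmem p hp), h0U _ (hmem q hq)⟩, h0U _ (hmem r hr)⟩, h0⟩
      · rw [Pi.add_apply, e1, e2, e3, add_zero])
  rw [hp₀] at hbn
  have h00 : (0 : ℂ) ∈ Metric.closedBall (0 : ℂ) 1 \ V := hp₀ ▸ hmem p₀ hp₀N
  refine ⟨b, hb, hbn.mono fun x hx => ?_⟩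
  have hx : f x = 0 := hx
  exact ⟨by rw [Set.mem_preimage, hx]; exact h0U 0 h00, fun h => D.zero_notMem (hx ▸ h)⟩

/-- The number of vertices is at least the dimension of the generic fibre. -/
theorem EdgeFib.succ_le_ncard (D : EdgeFib m f V) : m + 1 ≤ V.ncard := by
  by_contra! hV
  obtain ⟨Λ, hΛ⟩ := exists_fund D.locEuc.dimLE D.locEuc
  have h0 : (0 : ℂ) ∈ Metric.ball (0 : ℂ) 1 := Metric.mem_ball_self one_pos
  obtain ⟨per, hadd, hnull, hsurj⟩ := (D.torus 0 h0).exists_per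
  obtain ⟨v, hv, hper⟩ := D.exists_period hΛ hadd hnull (Nat.lt_succ_iff.1 hV)
  have hex : ∀ x ∈ Metric.closedBall (0 : ℂ) 1 \ V,
      ∃ c, CocOn c (f ⁻¹' segment ℝ 0 x) ∧ per c = v := by
    intro x hx
    by_cases hxs : x ∈ Metric.sphere (0 : ℂ) 1
    · exact hper x ⟨hxs, hx.2⟩
    · have hxb : x ∈ Metric.ball (0 : ℂ) 1 := by
        rw [mem_ball_zero_iff]
        exact lt_of_le_of_ne (by simpa using hx.1) (by simpa using hxs)
      obtain ⟨c, hc, hcv⟩ := hsurj v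
      obtain ⟨k, hk, hkn⟩ := D.exists_extension hΛ h0 hxb hc
      have hk0 : CocOn k (f ⁻¹' {0}) :=
        hk.mono (Set.preimage_mono (Set.singleton_subset_iff.2 (left_mem_segment ℝ 0 x)))
      rw [← hnull _ (hk0.add hc), hadd _ _ hk0 hc, add_eq_zero_zmod_two] at hkn
      exact ⟨k, hk, hkn.trans hcv⟩
  choose! c hc hcv using hex
  have hc0 : ∀ x ∈ Metric.closedBall (0 : ℂ) 1 \ V, CocOn (c x) (f ⁻¹' {0}) := fun x hx =>
    (hc x hx).mono (Set.preimage_mono (Set.singleton_subset_iff.2 (left_mem_segment ℝ 0 x)))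
  obtain ⟨b, hb, hbn⟩ := D.exists_global hΛ c hc fun x hx y hy => by
    rw [← hnull _ ((hc0 x hx).add (hc0 y hy)), hadd _ _ (hc0 x hx) (hc0 y hy), hcv x hx, hcv y hy,
      add_eq_zero_zmod_two]
  have h00 : (0 : ℂ) ∈ Metric.closedBall (0 : ℂ) 1 \ V :=
    ⟨Metric.ball_subset_closedBall h0, D.zero_notMem⟩
  have hsub : f ⁻¹' {0} ⊆ (f ⁻¹' V)ᶜ := fun x hx h => D.zero_notMem (by
    have hx : f x = 0 := hx
    exact hx ▸ h)
  have hn := ((D.nullOn_compl_vertices hΛ hb).mono hsub).add hbn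
  rw [← add_assoc, add_self_fun, zero_add, ← hnull _ (hc0 0 h00), hcv 0 h00] at hn
  exact hv hn

end Core

end AS

/-- Let `(M, F)` be a compact, simply-connected `(n+2)`-manifold with a
non-regular A-foliation of codimension `2`, with regular leaves of dimension `n`.  If the
boundary of the leaf-space disk `M*` consists of `r` edges (equivalently, there are `r`
most singular leaves, one at each vertex of the boundary circle), then `r ≥ n`. -/
theorem num_boundary_edges_ge_dim
    {n : ℕ} {M : Type*} [TopologicalSpace M] [T2Space M]
    [ChartedSpace (EuclideanSpace ℝ (Fin (n + 2))) M]
    [CompactSpace M] [SimplyConnectedSpace M]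
    (F : SFoliation M) (hA : F.IsAFoliation)
    (hcodim : F.dim = n)
    -- the leaf space is a `2`-disk:
    (Φ : F.LeafSpace ≃ₜ ↥(Metric.closedBall (0 : EuclideanSpace ℝ (Fin 2)) 1))
    -- interior points of the disk correspond to the principal (regular) leaves:
    (hint : ∀ p : M, ‖(Φ (F.proj p) : EuclideanSpace ℝ (Fin 2))‖ < 1 ↔ F.IsRegular p)
    -- every leaf is regular of dimension `n`, least singular of dimension `n-1`, or
    -- most singular of dimension `n-2`:
    (hdims : ∀ p : M,
      F.leafDim p = n ∨ F.leafDim p + 1 = n ∨ F.leafDim p + 2 = n)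
    -- all leaves are (homeomorphic to) tori of the corresponding dimension:
    (htori : ∀ p : M, Nonempty (↥(F.leaf p) ≃ₜ Torus (F.leafDim p)))
    -- `r` edges in the boundary, i.e. `r` vertices (most singular leaves):
    (r : ℕ) (hr : 0 < r)
    (hvertices :
      {x : F.LeafSpace | ∃ p : M, F.proj p = x ∧ F.leafDim p + 2 = n}.ncard = r)
    (hfin : {x : F.LeafSpace | ∃ p : M, F.proj p = x ∧ F.leafDim p + 2 = n}.Finite) :
    n ≤ r := by
  have := ChartedSpace.secondCountable_of_sigmaCompact (EuclideanSpace ℝ (Fin (n + 2))) M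
  have := ChartedSpace.locallyPathConnectedSpace (EuclideanSpace ℝ (Fin (n + 2))) M
  have hle : ∀ p, F.leafDim p ≤ n := fun p => by
    have := hdims p
    omega
  have hreg : ∀ p, F.IsRegular p ↔ F.leafDim p = n := fun p =>
    ⟨fun h => le_antisymm (hle p) (hcodim ▸ ciSup_le' h), fun h q => h ▸ hle q⟩
  have hn : 2 ≤ n := by
    obtain ⟨x, p, -, hp⟩ := (Set.ncard_pos hfin).1 (hvertices ▸ hr)
    omega
  obtain ⟨m, rfl⟩ : ∃ m, n = m + 1 := ⟨n - 1, by omega⟩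
  let φ := Complex.orthonormalBasisOneI.repr.symm
  let j : F.LeafSpace → ℂ := fun x => φ (Φ x)
  have hj : Function.Injective j :=
    φ.injective.comp (Subtype.val_injective.comp Φ.injective)
  let f : M → ℂ := fun p => j (F.proj p)
  have hf : Continuous f :=
    φ.continuous.comp (continuous_subtype_val.comp (Φ.continuous.comp F.continuous_proj))
  have hnorm : ∀ p, ‖f p‖ = ‖(Φ (F.proj p) : EuclideanSpace ℝ (Fin 2))‖ := fun p =>
    φ.norm_map _
  have hfib : ∀ p, f ⁻¹' {f p} = F.leaf p := fun p => by
    ext q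
    rw [Set.mem_preimage, Set.mem_singleton_iff, eq_comm]
    exact hj.eq_iff.trans (Quotient.eq (r := F.toSetoid))
  have hrange : Set.range f = Metric.closedBall 0 1 := by
    ext z
    constructor
    · rintro ⟨p, rfl⟩
      rw [mem_closedBall_zero_iff, hnorm]
      exact mem_closedBall_zero_iff.1 (Φ (F.proj p)).2
    · intro hz
      have hz' : φ.symm z ∈ Metric.closedBall (0 : EuclideanSpace ℝ (Fin 2)) 1 := by
        rw [mem_closedBall_zero_iff] at hz ⊢
        rwa [φ.symm.norm_map]
      obtain ⟨p, hp⟩ := Quotient.exists_rep (Φ.symm ⟨_, hz'⟩)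
      refine ⟨p, ?_⟩
      have hp : F.proj p = Φ.symm ⟨_, hz'⟩ := hp
      simp only [f, j, hp, Φ.apply_symm_apply, φ.apply_symm_apply]
  have hsurj : ∀ t ∈ Metric.closedBall (0 : ℂ) 1, ∃ p, f p = t := fun t ht => by
    rwa [← hrange] at ht
  have htor : ∀ p k, F.leafDim p = k → AS.IsTorus k (f ⁻¹' {f p}) := by
    rintro p k rfl
    obtain ⟨e⟩ := htori p
    refine ⟨fun x => (e.symm x : M), continuous_subtype_val.comp e.symm.continuous,
      Subtype.val_injective.comp e.symm.injective, ?_⟩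
    rw [hfib]
    ext q
    exact ⟨fun ⟨x, hx⟩ => hx ▸ (e.symm x).2, fun hq => ⟨e ⟨q, hq⟩, by simp⟩⟩
  have hball : ∀ p, f p ∈ Metric.ball (0 : ℂ) 1 ↔ F.leafDim p = m + 1 := fun p => by
    rw [mem_ball_zero_iff, hnorm, hint, hreg]
  have hD : AS.DiskFib m f :=
    { cont := hf
      range := hrange
      conn := fun t ht => by
        obtain ⟨p, rfl⟩ := hsurj t ht
        rw [hfib]
        exact F.leaf_connected p
      torus := fun t ht => by
        obtain ⟨p, rfl⟩ := hsurj t (Metric.ball_subset_closedBall ht)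
        exact htor p _ ((hball p).1 ht)
      locEuc := fun x =>
        ⟨(chartAt (EuclideanSpace ℝ (Fin (m + 1 + 2))) x).transHomeomorph
          (EuclideanSpace.equiv (Fin (m + 1 + 2)) ℝ).toHomeomorph, mem_chart_source _ x⟩ }
  have hVmem : ∀ p, f p ∈ j '' {x | ∃ p, F.proj p = x ∧ F.leafDim p + 2 = m + 1} ↔
      F.leafDim p + 2 = m + 1 := by
    refine fun p => ⟨?_, fun h => ⟨_, ⟨p, rfl, h⟩, rfl⟩⟩
    rintro ⟨x, ⟨q, rfl, hq⟩, h⟩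
    rwa [← F.leafDim_congr (Quotient.exact (s := F.toSetoid) (hj h))]
  have hE : AS.EdgeFib m f (j '' {x | ∃ p, F.proj p = x ∧ F.leafDim p + 2 = m + 1}) :=
    { hD with
      finite := hfin.image _
      nonempty := ((Set.ncard_pos hfin).1 (hvertices ▸ hr)).image _
      subset := by
        rintro _ ⟨_, ⟨p, rfl, hp⟩, rfl⟩
        have h1 := hD.mem p
        have h2 := mt (hball p).1 (by omega)
        rw [mem_closedBall_zero_iff] at h1
        rw [mem_ball_zero_iff, not_lt] at h2
        exact mem_sphere_zero_iff_norm.2 (le_antisymm h1 h2)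
      edge := by
        rintro t ⟨ht, htV⟩
        obtain ⟨p, rfl⟩ := hsurj t (Metric.sphere_subset_closedBall ht)
        rw [hVmem] at htV
        have h1 : F.leafDim p ≠ m + 1 := fun h => by
          have h2 := (hball p).2 h
          rw [mem_ball_zero_iff, mem_sphere_zero_iff_norm.1 ht] at h2
          exact lt_irrefl _ h2
        refine htor p m ?_
        have := hdims p
        omega
      vertex := by
        rintro _ ⟨_, ⟨p, rfl, hp⟩, rfl⟩
        exact (htor p _ rfl).dimLE.mono subset_rfl (by omega) }
  have := hE.succ_le_ncard
  rwa [Set.ncard_image_of_injective _ hj, hvertices] at this
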